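/- Let 1 < r₁, r₂ ≤ ∞ and 1/2 < r < ∞ with 1/r₁ + 1/r₂ = 1/r, and let 1 < p, q ≤ ∞ and 1/2 < s < ∞ with 1/p + 1/q = 1/s. Then there is a constant C, depending only on φ and the exponents, such that for every N ∈ ℕ, every finite set Λ ⊆ ℤ, and all Schwartz functions f₁,…,f_N, g₁,…,g_N : ℝ → ℂ: ‖ (Σ_{k=1}^N |Π_Λ(f_k, g_k)|^r)^{1/r} ‖_{L^s(ℝ)} ≤ C · ‖ (Σ_{k=1}^N |f_k|^{r₁})^{1/r₁} ‖_{L^p(ℝ)} · ‖ (Σ_{k=1}^N |g_k|^{r₂})^{1/r₂} ‖_{L^q(ℝ)}. -/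

import Mathlib

open MeasureTheory ENNReal NNReal

/-- Convolution on `ℝ`: `(f ∗ g)(x) = ∫ f(t) g(x − t) dt`. -/
noncomputable def conv (f g : ℝ → ℂ) : ℝ → ℂ := fun x => ∫ t, f t * g (x - t)

/-- The Fourier transform `f̂(ξ) = ∫ f(x) e^{−2πixξ} dx`. -/
noncomputable def ft1 (f : ℝ → ℂ) (ξ : ℝ) : ℂ :=
  ∫ x, f x * Complex.exp (((-2) * Real.pi * x * ξ : ℝ) * Complex.I)

/-- The `L¹`-normalized dyadic dilation `u_k(x) = 2^k u(2^k x)`. -/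
noncomputable def dil (u : ℝ → ℂ) (k : ℤ) : ℝ → ℂ :=
  fun x => (2 : ℂ) ^ k * u ((2 : ℝ) ^ k * x)

/-- The function `ψ` with `ψ̂(ξ) = φ̂(ξ/2) − φ̂(ξ)`, i.e. `ψ(x) = 2φ(2x) − φ(x)`. -/
noncomputable def psiOf (φ : ℝ → ℂ) : ℝ → ℂ := fun x => 2 * φ (2 * x) - φ x

/-- The truncated classical paraproduct
`Π_Λ(f,g) = Σ_{k∈Λ} ((f ∗ φ_k)·(g ∗ ψ_k)) ∗ ψ_k`. -/
noncomputable def para (φ : ℝ → ℂ) (Λ : Finset ℤ) (f g : ℝ → ℂ) : ℝ → ℂ :=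
  fun x => ∑ k ∈ Λ,
    conv (fun y => conv f (dil φ k) y * conv g (dil (psiOf φ) k) y) (dil (psiOf φ) k) x

/-- Finite `ℓ^t` expression `(Σ_{k<N} a_k^t)^{1/t}`, interpreted as a maximum when `t = ∞`. -/
noncomputable def ellN (t : ℝ≥0∞) (N : ℕ) (a : ℕ → ℝ≥0∞) : ℝ≥0∞ :=
  if t = ∞ then ⨆ k ∈ Finset.range N, a k
  else (∑ k ∈ Finset.range N, a k ^ t.toReal) ^ (1 / t.toReal)

/-- The Lebesgue (quasi)norm with exponent `t ∈ (0, ∞]` of an `ℝ≥0∞`-valued function,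
interpreted as the essential supremum when `t = ∞`. -/
noncomputable def LqNorm {X : Type*} [MeasurableSpace X] (μ : Measure X) (t : ℝ≥0∞)
    (φ : X → ℝ≥0∞) : ℝ≥0∞ :=
  if t = ∞ then essSup φ μ else (∫⁻ x, φ x ^ t.toReal ∂μ) ^ (1 / t.toReal)

section Norms

variable {X : Type*} [MeasurableSpace X] {μ : Measure X}

theorem LqNorm_mono {t : ℝ≥0∞} {f g : X → ℝ≥0∞} (h : ∀ x, f x ≤ g x) :
    LqNorm μ t f ≤ LqNorm μ t g := by
  unfold LqNorm
  split_ifs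
  · exact essSup_mono_ae (Filter.Eventually.of_forall h)
  · gcongr
    exact h _

theorem LqNorm_const_mul_le {t : ℝ≥0∞} (ht : t ≠ 0) {f : X → ℝ≥0∞} {c : ℝ≥0∞} (hc : c ≠ ∞) :
    LqNorm μ t (fun x => c * f x) ≤ c * LqNorm μ t f := by
  unfold LqNorm
  split_ifs with h
  · exact (ENNReal.essSup_const_mul (f := f) (a := c)).le
  · have h0 : 0 < t.toReal := ENNReal.toReal_pos ht h
    simp_rw [ENNReal.mul_rpow_of_nonneg _ _ h0.le]
    rw [lintegral_const_mul' _ _ (ENNReal.rpow_ne_top_of_nonneg h0.le hc),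
      ENNReal.mul_rpow_of_nonneg _ _ (by positivity), ← ENNReal.rpow_mul,
      mul_one_div_cancel h0.ne', ENNReal.rpow_one]

theorem holder_ne_zero_left {p q s : ℝ≥0∞} (hs0 : s ≠ 0) (hH : s⁻¹ = p⁻¹ + q⁻¹) : p ≠ 0 := by
  rintro rfl
  simp at hH
  exact hs0 hH

theorem holder_toReal {p q s : ℝ≥0∞} (hs0 : s ≠ 0) (hH : s⁻¹ = p⁻¹ + q⁻¹) :
    1 / s.toReal = 1 / p.toReal + 1 / q.toReal := by
  have hp := holder_ne_zero_left hs0 hH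
  have hq := holder_ne_zero_left hs0 (hH.trans (add_comm _ _))
  have := congrArg ENNReal.toReal hH
  rw [ENNReal.toReal_add (by simpa) (by simpa)] at this
  simpa [ENNReal.toReal_inv] using this

theorem LqNorm_mul_le_of_top {s : ℝ≥0∞} (hs0 : s ≠ 0) (hs : s ≠ ∞) {f g : X → ℝ≥0∞}
    (hg : AEMeasurable g μ) :
    LqNorm μ s (fun x => f x * g x) ≤ essSup f μ * LqNorm μ s g := by
  have h0 : 0 < s.toReal := ENNReal.toReal_pos hs0 hs
  simp only [LqNorm, hs, if_false]
  calc (∫⁻ x, (f x * g x) ^ s.toReal ∂μ) ^ (1 / s.toReal)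
      ≤ (∫⁻ x, essSup f μ ^ s.toReal * g x ^ s.toReal ∂μ) ^ (1 / s.toReal) := by
        gcongr ?_ ^ _
        apply lintegral_mono_ae
        filter_upwards [ENNReal.ae_le_essSup f] with x hx
        rw [ENNReal.mul_rpow_of_nonneg _ _ h0.le]
        gcongr
    _ = _ := by
        rw [lintegral_const_mul'' _ (hg.pow_const _),
          ENNReal.mul_rpow_of_nonneg _ _ (by positivity), ← ENNReal.rpow_mul,
          mul_one_div_cancel h0.ne', ENNReal.rpow_one]

theorem LqNorm_mul_le {p q s : ℝ≥0∞} (hs0 : s ≠ 0) (hs : s ≠ ∞) (hH : s⁻¹ = p⁻¹ + q⁻¹)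
    {f g : X → ℝ≥0∞} (hf : AEMeasurable f μ) (hg : AEMeasurable g μ) :
    LqNorm μ s (fun x => f x * g x) ≤ LqNorm μ p f * LqNorm μ q g := by
  have hp0 := holder_ne_zero_left hs0 hH
  have hq0 := holder_ne_zero_left hs0 (hH.trans (add_comm _ _))
  by_cases hp : p = ∞
  · subst hp
    obtain rfl : s = q := by simpa using hH
    simpa [LqNorm, hs] using LqNorm_mul_le_of_top hs0 hs (f := f) hg
  by_cases hq : q = ∞
  · subst hq
    obtain rfl : s = p := by simpa using hH
    have := LqNorm_mul_le_of_top hs0 hs (f := g) hf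
    simp only [mul_comm] at this ⊢
    simpa [LqNorm, hs] using this
  have hR := holder_toReal hs0 hH
  have h0 : 0 < s.toReal := ENNReal.toReal_pos hs0 hs
  have hp1 : 0 < p.toReal := ENNReal.toReal_pos hp0 hp
  have hq1 : 0 < q.toReal := ENNReal.toReal_pos hq0 hq
  have hlt : s.toReal < p.toReal := by
    have : 1 / p.toReal < 1 / s.toReal := by rw [hR]; simpa using hq1
    exact (one_div_lt_one_div hp1 h0).1 this
  simpa [LqNorm, hs, hp, hq] using ENNReal.lintegral_Lp_mul_le_Lq_mul_Lr h0 hlt hR μ hf hg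

end Norms

section FiniteSums

variable {N : ℕ} {t : ℝ≥0∞}

theorem ellN_eq_LqNorm (t : ℝ≥0∞) (N : ℕ) (a : ℕ → ℝ≥0∞) :
    ellN t N a = LqNorm (Measure.count : Measure (Fin N)) t (fun i => a i) := by
  unfold ellN LqNorm
  split_ifs
  · rw [essSup_eq_iSup (by simp)]
    simp [iSup_subtype', ← (Fin.equivSubtype (n := N)).symm.iSup_comp]
  · rw [lintegral_count, tsum_fintype, Finset.sum_range]

theorem ellN_mono {a b : ℕ → ℝ≥0∞} (h : ∀ i, a i ≤ b i) : ellN t N a ≤ ellN t N b := by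
  simp only [ellN_eq_LqNorm]
  exact LqNorm_mono fun i => h i

theorem ellN_const_mul_le (ht : t ≠ 0) {c : ℝ≥0∞} (hc : c ≠ ∞) (a : ℕ → ℝ≥0∞) :
    ellN t N (fun i => c * a i) ≤ c * ellN t N a := by
  simp only [ellN_eq_LqNorm]
  exact LqNorm_const_mul_le ht hc

theorem ellN_mul_le {p q s : ℝ≥0∞} (hs0 : s ≠ 0) (hs : s ≠ ∞) (hH : s⁻¹ = p⁻¹ + q⁻¹)
    (a b : ℕ → ℝ≥0∞) : ellN s N (fun i => a i * b i) ≤ ellN p N a * ellN q N b := by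
  simp only [ellN_eq_LqNorm]
  exact LqNorm_mul_le hs0 hs hH (measurable_of_finite _).aemeasurable
    (measurable_of_finite _).aemeasurable

theorem ellN_one (ht : t ≠ 0) (a : ℕ → ℝ≥0∞) : ellN t 1 a = a 0 := by
  unfold ellN
  split_ifs with h
  · simp
  · have h0 : 0 < t.toReal := ENNReal.toReal_pos ht h
    simp [← ENNReal.rpow_mul, h0.ne']

theorem measurable_ellN {X : Type*} [MeasurableSpace X] {a : ℕ → X → ℝ≥0∞}
    (h : ∀ i, Measurable (a i)) : Measurable fun x => ellN t N (fun i => a i x) := by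
  unfold ellN
  split_ifs
  · exact Measurable.biSup _ (Finset.range N).countable_toSet fun i _ => h i
  · exact (Finset.measurable_fun_sum _ fun i _ => (h i).pow_const _).pow_const _

theorem ellN_zero (ht : t ≠ 0) : ellN t N (fun _ => 0) = 0 := by
  simpa using ellN_const_mul_le (N := N) ht (c := 0) (by simp) (fun _ => 0)

theorem le_ellN (ht : t ≠ 0) {a : ℕ → ℝ≥0∞} {i : ℕ} (hi : i < N) : a i ≤ ellN t N a := by
  unfold ellN
  split_ifs with h
  · exact le_biSup (f := fun i => a i) (Finset.mem_range.2 hi)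
  · have h0 : 0 < t.toReal := ENNReal.toReal_pos ht h
    calc a i = (a i ^ t.toReal) ^ (1 / t.toReal) := by
          rw [← ENNReal.rpow_mul, mul_one_div_cancel h0.ne', ENNReal.rpow_one]
      _ ≤ _ := by
        gcongr
        exact Finset.single_le_sum (f := fun i => a i ^ t.toReal) (fun _ _ => zero_le)
          (Finset.mem_range.2 hi)

theorem ellN_ne_top {a : ℕ → ℝ≥0∞} (h : ∀ i, a i ≠ ∞) : ellN t N a ≠ ∞ := by
  unfold ellN
  split_ifs
  · exact (Finset.sup_eq_iSup (Finset.range N) a ▸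
      (Finset.sup_lt_iff (by simp)).2 fun i _ => (h i).lt_top).ne
  · refine ENNReal.rpow_ne_top_of_nonneg (by positivity) (ENNReal.sum_ne_top.2 fun i _ => ?_)
    exact ENNReal.rpow_ne_top_of_nonneg (by positivity) (h i)

/-- The exponent `min(1, t)` for which `ℓ^t` is a `ρ`-normed space. -/
noncomputable def rhoOf (t : ℝ≥0∞) : ℝ := min 1 t.toReal

theorem rhoOf_pos (ht : t ≠ 0) (ht' : t ≠ ∞) : 0 < rhoOf t :=
  lt_min one_pos (ENNReal.toReal_pos ht ht')

theorem rhoOf_le_one : rhoOf t ≤ 1 := min_le_left _ _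

theorem half_lt_rhoOf (ht : 1 / 2 < t) (ht' : t ≠ ∞) : 1 / 2 < rhoOf t := by
  refine lt_min (by norm_num) ?_
  have := (ENNReal.toReal_lt_toReal (by simp) ht').2 ht
  simpa using this

theorem ellN_rpow_add_le (ht : t ≠ 0) (ht' : t ≠ ∞) (a b : ℕ → ℝ≥0∞) :
    ellN t N (fun i => a i + b i) ^ rhoOf t ≤ ellN t N a ^ rhoOf t + ellN t N b ^ rhoOf t := by
  have h0 : 0 < t.toReal := ENNReal.toReal_pos ht ht'
  simp only [ellN, ht', if_false, rhoOf]
  rcases le_total 1 t.toReal with h1 | h1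
  · rw [min_eq_left h1]
    simpa using ENNReal.Lp_add_le (Finset.range N) a b h1
  · rw [min_eq_right h1]
    simp only [← ENNReal.rpow_mul, one_div_mul_cancel h0.ne', ENNReal.rpow_one]
    rw [← Finset.sum_add_distrib]
    gcongr
    exact ENNReal.rpow_add_le_add_rpow _ _ h0.le h1

theorem ellN_rpow_sum_le {ι : Type*} (ht : t ≠ 0) (ht' : t ≠ ∞) (s : Finset ι)
    (a : ι → ℕ → ℝ≥0∞) :
    ellN t N (fun i => ∑ k ∈ s, a k i) ^ rhoOf t ≤ ∑ k ∈ s, ellN t N (a k) ^ rhoOf t := by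
  classical
  induction s using Finset.induction_on with
  | empty => simp [ellN_zero ht, ENNReal.zero_rpow_of_pos (rhoOf_pos ht ht')]
  | insert k s hk ih =>
    simp only [Finset.sum_insert hk]
    exact (ellN_rpow_add_le ht ht' _ _).trans (by gcongr)

/-- Minkowski's integral inequality for finite `ℓ^t` sums. -/
theorem ellN_lintegral_le {X : Type*} [MeasurableSpace X] {μ : Measure X} (ht : 1 ≤ t)
    {h : ℕ → X → ℝ≥0∞} (hm : ∀ i, Measurable (h i)) :
    ellN t N (fun i => ∫⁻ x, h i x ∂μ) ≤ ∫⁻ x, ellN t N (fun i => h i x) ∂μ := by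
  have ht0 : t ≠ 0 := (one_pos.trans_le ht).ne'
  by_cases htop : t = ∞
  · simp only [ellN, htop, if_true]
    exact iSup₂_le fun i hi => lintegral_mono fun x => le_biSup (f := fun i => h i x) hi
  have hle : ∀ i, i < N → ∫⁻ x, h i x ∂μ ≤ ∫⁻ x, ellN t N (fun i => h i x) ∂μ := fun i hi =>
    lintegral_mono fun x => le_ellN ht0 (a := fun i => h i x) hi
  have ht1 : 1 ≤ t.toReal := by
    simpa using (ENNReal.toReal_le_toReal (by simp) htop).2 ht
  rcases eq_or_lt_of_le ht1 with ht1 | ht1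
  · simp only [ellN, htop, if_false, ← ht1]
    simp only [ENNReal.rpow_one, one_div, inv_one]
    rw [lintegral_finsetSum _ fun i _ => hm i]
  by_cases hfin : ∃ i < N, ∫⁻ x, h i x ∂μ = ∞
  · obtain ⟨i, hi, h'⟩ := hfin
    exact le_top.trans (h' ▸ hle i hi)
  push Not at hfin
  set a : ℕ → ℝ≥0∞ := fun i => ∫⁻ x, h i x ∂μ
  set τ := t.toReal
  have hτ : 0 < τ := by linarith
  have hconj : τ.HolderConjugate (τ / (τ - 1)) := Real.HolderConjugate.conjExponent ht1
  set S := ∑ i ∈ Finset.range N, a i ^ τ with hS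
  have hSfin : S ≠ ∞ := by
    refine ENNReal.sum_ne_top.2 fun i hi => ENNReal.rpow_ne_top_of_nonneg hτ.le ?_
    exact hfin i (Finset.mem_range.1 hi)
  have hae : ∀ i, a i ^ τ = a i ^ (τ - 1) * a i := fun i => by
    rcases eq_or_ne (a i) 0 with h0 | h0
    · simp [h0, hτ]
    · by_cases h1 : a i = ∞
      · rw [h1, ENNReal.top_rpow_of_pos hτ, ENNReal.top_rpow_of_pos (by linarith)]; simp
      · conv_rhs => rw [← ENNReal.rpow_one (a i), ← ENNReal.rpow_mul, ← ENNReal.rpow_add _ _ h0 h1]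
        congr 1; ring
  have key : S ≤ S ^ (1 / (τ / (τ - 1))) * ∫⁻ x, ellN t N (fun i => h i x) ∂μ := by
    calc S = ∫⁻ x, ∑ i ∈ Finset.range N, a i ^ (τ - 1) * h i x ∂μ := by
          rw [lintegral_finsetSum _ fun i _ => (hm i).const_mul _]
          refine Finset.sum_congr rfl fun i _ => ?_
          rw [lintegral_const_mul _ (hm i), hae]
      _ ≤ ∫⁻ x, S ^ (1 / (τ / (τ - 1))) * ellN t N (fun i => h i x) ∂μ := by
          refine lintegral_mono fun x => ?_
          refine (ENNReal.inner_le_Lp_mul_Lq _ _ _ hconj.symm).trans (le_of_eq ?_)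
          simp only [ellN, htop, if_false]
          congr 2
          refine Finset.sum_congr rfl fun i _ => ?_
          rw [← ENNReal.rpow_mul]
          congr 1
          have : τ - 1 ≠ 0 := by linarith
          field_simp
      _ = _ := lintegral_const_mul _ (measurable_ellN hm)
  simp only [ellN, htop, if_false] at key ⊢
  change S ^ (1 / τ) ≤ _
  by_cases hS0 : S = 0
  · rw [hS0, ENNReal.zero_rpow_of_pos (by positivity)]; exact zero_le
  have hc : S ^ (1 / (τ / (τ - 1))) ≠ 0 := by
    simp [ENNReal.rpow_eq_zero_iff, hS0, hSfin]
  have hc' : S ^ (1 / (τ / (τ - 1))) ≠ ∞ :=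
    ENNReal.rpow_ne_top_of_nonneg (by have : 0 < τ - 1 := by linarith
                                      positivity) hSfin
  have : S = S ^ (1 / (τ / (τ - 1))) * S ^ (1 / τ) := by
    rw [← ENNReal.rpow_add _ _ hS0 hSfin]
    have h2 : τ - 1 ≠ 0 := by linarith
    have : 1 / (τ / (τ - 1)) + 1 / τ = 1 := by field_simp; ring
    rw [this, ENNReal.rpow_one]
  rw [this] at key
  exact (ENNReal.mul_le_mul_iff_right hc hc').1 (by rw [← this]; rw [← this] at key; exact key)

end FiniteSums

/-- The centered dyadic-radius Hardy–Littlewood maximal function (up to normalization). -/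
noncomputable def hl (F : ℝ → ℝ≥0∞) (x : ℝ) : ℝ≥0∞ :=
  ⨆ n : ℤ, ENNReal.ofReal ((2 : ℝ) ^ n) * ∫⁻ y in Metric.closedBall x ((2 : ℝ) ^ (-n)), F y

section Maximal

variable {F G : ℝ → ℝ≥0∞}

theorem setLIntegral_closedBall_le_hl (F : ℝ → ℝ≥0∞) (x : ℝ) (n : ℤ) :
    ∫⁻ y in Metric.closedBall x ((2 : ℝ) ^ (-n)), F y
      ≤ ENNReal.ofReal ((2 : ℝ) ^ (-n)) * hl F x := by
  have h : ENNReal.ofReal ((2 : ℝ) ^ (-n)) * ENNReal.ofReal ((2 : ℝ) ^ n) = 1 := by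
    rw [← ENNReal.ofReal_mul (by positivity), ← zpow_add₀ (by norm_num)]; simp
  calc _ = ENNReal.ofReal ((2 : ℝ) ^ (-n)) * (ENNReal.ofReal ((2 : ℝ) ^ n) *
          ∫⁻ y in Metric.closedBall x ((2 : ℝ) ^ (-n)), F y) := by rw [← mul_assoc, h, one_mul]
    _ ≤ _ := by
      gcongr
      exact le_iSup (fun n : ℤ => ENNReal.ofReal ((2 : ℝ) ^ n) *
        ∫⁻ y in Metric.closedBall x ((2 : ℝ) ^ (-n)), F y) n

theorem hl_mono (h : ∀ x, F x ≤ G x) (x : ℝ) : hl F x ≤ hl G x :=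
  iSup_mono fun _ => by
    gcongr
    exact h _

theorem hl_add_le (hF : Measurable F) (x : ℝ) :
    hl (fun y => F y + G y) x ≤ hl F x + hl G x := by
  refine iSup_le fun n => ?_
  rw [lintegral_add_left hF, mul_add]
  gcongr
  · exact le_iSup (fun n : ℤ => ENNReal.ofReal ((2 : ℝ) ^ n) *
      ∫⁻ y in Metric.closedBall x ((2 : ℝ) ^ (-n)), F y) n
  · exact le_iSup (fun n : ℤ => ENNReal.ofReal ((2 : ℝ) ^ n) *
      ∫⁻ y in Metric.closedBall x ((2 : ℝ) ^ (-n)), G y) n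

theorem hl_le_of_ae_le {c : ℝ≥0∞} (h : ∀ᵐ y, F y ≤ c) (x : ℝ) : hl F x ≤ 2 * c := by
  refine iSup_le fun n => ?_
  calc ENNReal.ofReal ((2 : ℝ) ^ n) * ∫⁻ y in Metric.closedBall x ((2 : ℝ) ^ (-n)), F y
      ≤ ENNReal.ofReal ((2 : ℝ) ^ n) * ∫⁻ _ in Metric.closedBall x ((2 : ℝ) ^ (-n)), c := by
        refine mul_le_mul' le_rfl ?_
        exact lintegral_mono_ae (ae_restrict_of_ae h)
    _ = ENNReal.ofReal ((2 : ℝ) ^ n * (2 * (2 : ℝ) ^ (-n))) * c := by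
        rw [setLIntegral_const, Real.volume_closedBall,
          ENNReal.ofReal_mul (p := (2 : ℝ) ^ n) (by positivity)]
        ring
    _ = 2 * c := by
        have : (2 : ℝ) ^ n * (2 * (2 : ℝ) ^ (-n)) = 2 := by
          rw [mul_left_comm, ← zpow_add₀ (by norm_num)]; simp
        rw [this]; simp

theorem measurable_hl (hF : Measurable F) : Measurable (hl F) := by
  refine Measurable.iSup fun n => Measurable.const_mul ?_ _
  have hs : MeasurableSet {z : ℝ × ℝ | dist z.2 z.1 ≤ (2 : ℝ) ^ (-n)} :=
    (isClosed_le (by fun_prop) continuous_const).measurableSet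
  have : ∀ x : ℝ, ∫⁻ y in Metric.closedBall x ((2 : ℝ) ^ (-n)), F y =
      ∫⁻ y, {z : ℝ × ℝ | dist z.2 z.1 ≤ (2 : ℝ) ^ (-n)}.indicator (fun z => F z.2) (x, y) := by
    intro x
    rw [← lintegral_indicator Metric.isClosed_closedBall.measurableSet]
    rfl
  simp_rw [this]
  exact Measurable.lintegral_prod_right' ((hF.comp measurable_snd).indicator hs)

/-- Weak type `(1, 1)` bound for the maximal function. -/
theorem hl_weak (F : ℝ → ℝ≥0∞) (l : ℝ≥0∞) :
    l * volume {x | l < hl F x} ≤ 8 * ∫⁻ y, F y := by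
  by_cases hl0 : l = 0
  · simp [hl0]
  by_cases hlt : l = ∞
  · simp [hlt]
  by_cases hfin : ∫⁻ y, F y = ∞
  · simp [hfin]
  have hex : ∀ x : ℝ, ∃ n : ℤ, l < hl F x → l < ENNReal.ofReal ((2 : ℝ) ^ n) *
      ∫⁻ y in Metric.closedBall x ((2 : ℝ) ^ (-n)), F y := by
    intro x
    by_cases h : l < hl F x
    · obtain ⟨n, hn⟩ := lt_iSup_iff.1 h
      exact ⟨n, fun _ => hn⟩
    · exact ⟨0, fun h' => absurd h' h⟩
  choose n hn using hex
  set r : ℝ → ℝ := fun x => (2 : ℝ) ^ (-n x) with hr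
  have hrpos : ∀ x, 0 < r x := fun x => by positivity
  have hrl : ∀ x, l < hl F x → ENNReal.ofReal (r x) * l ≤ ∫⁻ y in Metric.closedBall x (r x),
      F y := by
    intro x hx
    have h : ENNReal.ofReal (r x) * ENNReal.ofReal ((2 : ℝ) ^ n x) = 1 := by
      rw [← ENNReal.ofReal_mul (by positivity), ← zpow_add₀ (by norm_num)]; simp
    calc _ ≤ ENNReal.ofReal (r x) * (ENNReal.ofReal ((2 : ℝ) ^ n x) *
          ∫⁻ y in Metric.closedBall x (r x), F y) := by gcongr; exact (hn x hx).le
      _ = _ := by rw [← mul_assoc, h, one_mul]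
  obtain ⟨u, hut, hdisj, hcov⟩ := Vitali.exists_disjoint_subfamily_covering_enlargement_closedBall
    {x | l < hl F x} (fun x => x) r (((∫⁻ y, F y) / l).toReal) (by
      intro x hx
      refine (ENNReal.ofReal_le_iff_le_toReal (ENNReal.div_ne_top hfin hl0)).1 ?_
      rw [ENNReal.le_div_iff_mul_le (Or.inl hl0) (Or.inl hlt)]
      exact (hrl x hx).trans (setLIntegral_le_lintegral _ _)) 4 (by norm_num)
  have hu : u.Countable := by
    refine Set.PairwiseDisjoint.countable_of_nonempty_interior hdisj fun x _ => ?_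
    rw [interior_closedBall _ (hrpos x).ne']
    exact ⟨x, by simp [hrpos x]⟩
  have hsub : {x | l < hl F x} ⊆ ⋃ b ∈ u, Metric.closedBall b (4 * r b) := by
    intro x hx
    obtain ⟨b, hb, hb'⟩ := hcov x hx
    exact Set.mem_biUnion hb (hb' (Metric.mem_closedBall_self (hrpos x).le))
  have : Countable u := hu
  calc l * volume {x | l < hl F x}
      ≤ l * ∑' b : u, volume (Metric.closedBall (b : ℝ) (4 * r b)) := by
        gcongr
        exact (measure_mono hsub).trans (measure_biUnion_le _ hu _)
    _ = 8 * ∑' b : u, ENNReal.ofReal (r b) * l := by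
        rw [← ENNReal.tsum_mul_left, ← ENNReal.tsum_mul_left]
        refine tsum_congr fun b => ?_
        rw [Real.volume_closedBall, show 2 * (4 * r b) = 8 * r b by ring,
          ENNReal.ofReal_mul (by norm_num)]
        norm_num
        ring
    _ ≤ 8 * ∑' b : u, ∫⁻ y in Metric.closedBall (b : ℝ) (r b), F y := by
        gcongr with b
        exact hrl b (hut b.2)
    _ ≤ 8 * ∫⁻ y, F y := by
        gcongr
        rw [← lintegral_iUnion (fun b => Metric.isClosed_closedBall.measurableSet)]
        · exact setLIntegral_le_lintegral _ _
        · intro a b hab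
          exact hdisj a.2 b.2 (fun h => hab (Subtype.ext h))

/-- Layer cake formula for finite `ℝ≥0∞`-valued functions. -/
theorem lintegral_rpow_eq_layercake {X : Type*} [MeasurableSpace X] (μ : Measure X)
    {h : X → ℝ≥0∞} (hm : Measurable h) (hfin : ∀ x, h x ≠ ∞) {p : ℝ} (hp : 0 < p) :
    ∫⁻ x, h x ^ p ∂μ = ENNReal.ofReal p *
      ∫⁻ t in Set.Ioi (0 : ℝ), μ {x | ENNReal.ofReal t < h x} * ENNReal.ofReal (t ^ (p - 1)) := by
  have := lintegral_rpow_eq_lintegral_meas_lt_mul μ (f := fun x => (h x).toReal)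
    (Filter.Eventually.of_forall fun _ => ENNReal.toReal_nonneg) hm.ennreal_toReal.aemeasurable hp
  rw [show (∫⁻ x, h x ^ p ∂μ) = ∫⁻ x, ENNReal.ofReal ((h x).toReal ^ p) ∂μ from ?_, this]
  · congr 1
    refine setLIntegral_congr_fun measurableSet_Ioi fun t ht => ?_
    congr 2
    ext x
    simp only [Set.mem_ofPred_eq]
    rw [ENNReal.ofReal_lt_iff_lt_toReal (le_of_lt ht) (hfin x)]
  · refine lintegral_congr fun x => ?_
    rw [← ENNReal.ofReal_rpow_of_nonneg ENNReal.toReal_nonneg hp.le, ENNReal.ofReal_toReal (hfin x)]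

theorem lintegral_Ioi_lt_rpow (a : ℝ≥0∞) (ha : a ≠ ∞) {q : ℝ} (hq : 0 < q) :
    ENNReal.ofReal q * ∫⁻ t in Set.Ioi (0 : ℝ), ({t : ℝ | ENNReal.ofReal t < a}.indicator
      (fun t => ENNReal.ofReal (t ^ (q - 1))) t) = a ^ q := by
  have := lintegral_rpow_eq_layercake (Measure.dirac ()) (h := fun _ => a) measurable_const
    (fun _ => ha) hq
  rw [lintegral_dirac] at this
  rw [this]
  congr 1
  refine lintegral_congr fun t => ?_
  by_cases h : ENNReal.ofReal t < a <;> simp [h]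

/-- Strong type bound for the maximal function of a bounded function. -/
theorem lintegral_hl_rpow_le {p : ℝ} (hp : 1 < p) : ∃ C : ℝ≥0, ∀ F : ℝ → ℝ≥0∞, Measurable F →
    ∀ B : ℝ≥0, (∀ x, F x ≤ B) → ∫⁻ x, hl F x ^ p ≤ C * ∫⁻ x, F x ^ p := by
  refine ⟨(16 * p * 4 ^ (p - 1) / (p - 1)).toNNReal, fun F hF B hB => ?_⟩
  have hp1 : 0 < p - 1 := by linarith
  have hfin : ∀ x, hl F x ≠ ∞ := fun x =>
    ((hl_le_of_ae_le (Filter.Eventually.of_forall hB) x).trans_lt (by finiteness)).ne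
  have hFfin : ∀ x, F x ≠ ∞ := fun x => ((hB x).trans_lt (by finiteness)).ne
  have key : ∀ t : ℝ, 0 < t → volume {x | ENNReal.ofReal t < hl F x} * ENNReal.ofReal (t ^ (p - 1))
      ≤ 16 * ∫⁻ y, F y * ({t : ℝ | ENNReal.ofReal t < 4 * F y}.indicator
        (fun t => ENNReal.ofReal (t ^ (p - 1 - 1))) t) := by
    intro t ht
    set F₁ : ℝ → ℝ≥0∞ := {y | ENNReal.ofReal t < 4 * F y}.indicator F
    set F₂ : ℝ → ℝ≥0∞ := {y | ENNReal.ofReal t < 4 * F y}ᶜ.indicator F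
    have hms : MeasurableSet {y | ENNReal.ofReal t < 4 * F y} :=
      measurableSet_lt measurable_const (hF.const_mul _)
    have hF₂ : ∀ y, F₂ y ≤ ENNReal.ofReal (t / 4) := by
      intro y
      refine Set.indicator_apply_le' (fun hy => ?_) fun _ => zero_le
      simp only [Set.mem_compl_iff, Set.mem_ofPred_eq, not_lt] at hy
      rw [ENNReal.ofReal_div_of_pos (by norm_num)]
      rw [ENNReal.le_div_iff_mul_le (by simp) (by simp)]
      rw [mul_comm]
      simpa using hy
    have hsplit : ∀ x, hl F x ≤ hl F₁ x + ENNReal.ofReal (t / 2) := by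
      intro x
      have hF₁₂ : F = fun y => F₁ y + F₂ y := by
        ext y
        exact (congrFun (Set.indicator_self_add_compl _ F) y).symm
      conv_lhs => rw [hF₁₂]
      refine (hl_add_le (hF.indicator hms) x).trans ?_
      gcongr
      refine (hl_le_of_ae_le (Filter.Eventually.of_forall hF₂) x).trans (le_of_eq ?_)
      rw [← ENNReal.ofReal_ofNat, ← ENNReal.ofReal_mul (by norm_num)]
      congr 1; ring
    have hsub : {x | ENNReal.ofReal t < hl F x} ⊆ {x | ENNReal.ofReal (t / 2) < hl F₁ x} := by
      intro x hx
      by_contra hcon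
      simp only [Set.mem_ofPred_eq, not_lt] at hcon hx
      refine absurd hx (not_lt.2 ((hsplit x).trans ?_))
      refine (add_le_add_left hcon _).trans ?_
      rw [← ENNReal.ofReal_add (by positivity) (by positivity)]
      simp
    have hw := hl_weak F₁ (ENNReal.ofReal (t / 2))
    have ht2 : ENNReal.ofReal (t ^ (p - 1)) =
        2 * ENNReal.ofReal (t ^ (p - 1 - 1)) * ENNReal.ofReal (t / 2) := by
      rw [← ENNReal.ofReal_ofNat, ← ENNReal.ofReal_mul (by norm_num),
        ← ENNReal.ofReal_mul (by positivity)]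
      congr 1
      rw [Real.rpow_sub_one ht.ne' (p - 1)]
      field_simp
    calc _ ≤ volume {x | ENNReal.ofReal (t / 2) < hl F₁ x} * ENNReal.ofReal (t ^ (p - 1)) := by
          gcongr
      _ = 2 * ENNReal.ofReal (t ^ (p - 1 - 1)) *
          (ENNReal.ofReal (t / 2) * volume {x | ENNReal.ofReal (t / 2) < hl F₁ x}) := by
          rw [ht2]; ring
      _ ≤ 2 * ENNReal.ofReal (t ^ (p - 1 - 1)) * (8 * ∫⁻ y, F₁ y) := by gcongr
      _ = 16 * ∫⁻ y, ENNReal.ofReal (t ^ (p - 1 - 1)) * F₁ y := by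
          rw [lintegral_const_mul' _ _ (by finiteness)]; ring
      _ = _ := by
          congr 1
          refine lintegral_congr fun y => ?_
          by_cases h : ENNReal.ofReal t < 4 * F y
          · simp only [F₁, Set.indicator, Set.mem_ofPred_eq, h, if_true]; ring
          · simp only [F₁, Set.indicator, Set.mem_ofPred_eq, h, if_false]; simp
  rw [lintegral_rpow_eq_layercake volume (measurable_hl hF) hfin (by linarith)]
  have hmeas : Measurable fun z : ℝ × ℝ => F z.2 * ({t : ℝ | ENNReal.ofReal t < 4 * F z.2}.indicator
        (fun t => ENNReal.ofReal (t ^ (p - 1 - 1))) z.1) := by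
    refine (hF.comp measurable_snd).mul ?_
    have : (fun z : ℝ × ℝ => ({t : ℝ | ENNReal.ofReal t < 4 * F z.2}.indicator
        (fun t => ENNReal.ofReal (t ^ (p - 1 - 1))) z.1)) =
        {z : ℝ × ℝ | ENNReal.ofReal z.1 < 4 * F z.2}.indicator
          (fun z => ENNReal.ofReal (z.1 ^ (p - 1 - 1))) := by
      ext z; simp [Set.indicator]
    rw [this]
    refine Measurable.indicator (by fun_prop) ?_
    exact measurableSet_lt (by fun_prop) ((hF.comp measurable_snd).const_mul _)
  calc _ ≤ ENNReal.ofReal p * ∫⁻ t in Set.Ioi (0 : ℝ), 16 * ∫⁻ y, F y *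
        ({t : ℝ | ENNReal.ofReal t < 4 * F y}.indicator
        (fun t => ENNReal.ofReal (t ^ (p - 1 - 1))) t) := by
        refine mul_le_mul' le_rfl ?_
        exact setLIntegral_mono' measurableSet_Ioi fun t ht => key t ht
    _ = ENNReal.ofReal p * (16 * ∫⁻ y, F y * ∫⁻ t in Set.Ioi (0 : ℝ),
        ({t : ℝ | ENNReal.ofReal t < 4 * F y}.indicator
        (fun t => ENNReal.ofReal (t ^ (p - 1 - 1))) t)) := by
        rw [lintegral_const_mul' _ _ (by simp), lintegral_lintegral_swap hmeas.aemeasurable]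
        congr 3
        ext y
        rw [lintegral_const_mul' _ _ (hFfin y)]
    _ = ENNReal.ofReal p * (16 * ∫⁻ y, ENNReal.ofReal (4 ^ (p - 1) / (p - 1)) * F y ^ p) := by
        congr 3
        ext y
        have h := lintegral_Ioi_lt_rpow (4 * F y) (ENNReal.mul_ne_top (by simp) (hFfin y)) hp1
        have h' : ∀ I : ℝ≥0∞, ENNReal.ofReal (p - 1) * I = (4 * F y) ^ (p - 1) →
            I = ENNReal.ofReal (1 / (p - 1)) * (4 * F y) ^ (p - 1) := by
          intro I hI
          rw [← hI, ← mul_assoc, ← ENNReal.ofReal_mul (by positivity), one_div_mul_cancel hp1.ne']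
          simp
        have e1 : ENNReal.ofReal (4 ^ (p - 1) / (p - 1)) =
            ENNReal.ofReal (4 ^ (p - 1)) * ENNReal.ofReal (1 / (p - 1)) := by
          rw [← ENNReal.ofReal_mul (by positivity), mul_one_div]
        rw [h' _ h, ENNReal.mul_rpow_of_nonneg _ _ hp1.le, e1]
        have e4 : ENNReal.ofReal (4 ^ (p - 1)) = 4 ^ (p - 1) := by
          rw [← ENNReal.ofReal_rpow_of_nonneg (by norm_num) hp1.le]; simp
        have eF : F y ^ p = F y * F y ^ (p - 1) := by
          have := ENNReal.rpow_add_of_nonneg (x := F y) 1 (p - 1) zero_le_one hp1.le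
          simpa using this
        rw [e4, eF]; ring
    _ = _ := by
        rw [lintegral_const_mul _ (hF.pow_const _), ← mul_assoc, ← mul_assoc]
        congr 1
        rw [← ENNReal.ofReal_ofNat, ← ENNReal.ofReal_mul (by linarith),
          ← ENNReal.ofReal_mul (by positivity)]
        simp only [ENNReal.ofReal]
        congr 2; ring

theorem LqNorm_hl_le {p : ℝ≥0∞} (hp : 1 < p) : ∃ C : ℝ≥0, ∀ F : ℝ → ℝ≥0∞, Measurable F →
    ∀ B : ℝ≥0, (∀ x, F x ≤ B) → LqNorm volume p (hl F) ≤ C * LqNorm volume p F := by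
  by_cases hpt : p = ∞
  · refine ⟨2, fun F hF B hB => ?_⟩
    simp only [LqNorm, hpt, if_true]
    refine essSup_le_of_ae_le _ (Filter.Eventually.of_forall fun x => ?_)
    exact hl_le_of_ae_le (ENNReal.ae_le_essSup F) x
  · have h1 : 1 < p.toReal := by simpa using (ENNReal.toReal_lt_toReal (by simp) hpt).2 hp
    obtain ⟨C, hC⟩ := lintegral_hl_rpow_le h1
    refine ⟨C ^ (1 / p.toReal), fun F hF B hB => ?_⟩
    simp only [LqNorm, hpt, if_false]
    calc _ ≤ (C * ∫⁻ x, F x ^ p.toReal) ^ (1 / p.toReal) := by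
          gcongr
          exact hC F hF B hB
      _ = _ := by
        rw [ENNReal.mul_rpow_of_nonneg _ _ (by positivity),
            ENNReal.coe_rpow_of_nonneg _ (by positivity)]

end Maximal

section Dyadic

/-- The index of the dyadic interval of length `2 ^ (-n)` containing `x`. -/
noncomputable def idx (n : ℤ) (x : ℝ) : ℤ := ⌊(2 : ℝ) ^ n * x⌋

/-- The dyadic interval of length `2 ^ (-n)` with index `j`. -/
def cell (n j : ℤ) : Set ℝ := {x | idx n x = j}

theorem mem_cell_iff {n j : ℤ} {x : ℝ} : x ∈ cell n j ↔ idx n x = j := Iff.rfl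

theorem mem_cell_idx (n : ℤ) (x : ℝ) : x ∈ cell n (idx n x) := rfl

theorem measurable_idx (n : ℤ) : Measurable (idx n) :=
  Int.measurable_floor.comp (measurable_const.mul measurable_id)

theorem measurableSet_cell (n j : ℤ) : MeasurableSet (cell n j) :=
  measurable_idx n (measurableSet_singleton j)

theorem cell_eq_Ico (n j : ℤ) :
    cell n j = Set.Ico ((2 : ℝ) ^ (-n) * j) ((2 : ℝ) ^ (-n) * (j + 1)) := by
  ext x
  have h : (0 : ℝ) < 2 ^ n := by positivity
  rw [mem_cell_iff, idx, Int.floor_eq_iff, Set.mem_Ico, zpow_neg, inv_mul_le_iff₀ h,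
    lt_inv_mul_iff₀ h]

theorem volume_cell (n j : ℤ) : volume (cell n j) = ENNReal.ofReal ((2 : ℝ) ^ (-n)) := by
  rw [cell_eq_Ico, Real.volume_Ico]
  congr 1; ring

theorem dist_lt_of_mem_cell {n j : ℤ} {x y : ℝ} (hx : x ∈ cell n j) (hy : y ∈ cell n j) :
    |x - y| < (2 : ℝ) ^ (-n) := by
  rw [cell_eq_Ico, Set.mem_Ico] at hx hy
  rw [abs_lt]
  constructor <;> nlinarith

theorem idx_eq_of_le {n n' : ℤ} (h : n ≤ n') {x y : ℝ} (hxy : idx n' x = idx n' y) :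
    idx n x = idx n y := by
  obtain ⟨d, rfl⟩ := Int.le.dest h
  have key : ∀ z : ℝ, idx n z = idx (n + d) z / ((2 ^ d : ℕ) : ℤ) := by
    intro z
    have : (2 : ℝ) ^ n * z = (2 : ℝ) ^ (n + d) * z / ((2 ^ d : ℕ) : ℝ) := by
      rw [zpow_add₀ (by norm_num), zpow_natCast]
      push_cast
      field_simp
    rw [idx, this, idx]
    exact Int.floor_div_natCast _ _
  rw [key, key, hxy]

theorem iUnion_cell (n : ℤ) : ⋃ j, cell n j = Set.univ :=
  Set.eq_univ_of_forall fun x => Set.mem_iUnion.2 ⟨idx n x, rfl⟩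

theorem pairwise_disjoint_cell (n : ℤ) : Pairwise (Function.onFun Disjoint (cell n)) := by
  intro i j hij
  refine Set.disjoint_left.2 fun x hx hy => hij ?_
  rw [mem_cell_iff] at hx hy
  rw [← hx, hy]

/-- The maximal dyadic intervals of level at least `m` satisfying `P`. -/
def stopping (P : ℤ → ℤ → Prop) (m : ℤ) : Set (ℤ × ℤ) :=
  {p | m ≤ p.1 ∧ P p.1 p.2 ∧ ∀ x ∈ cell p.1 p.2, ∀ n, m ≤ n → n < p.1 → ¬ P n (idx n x)}

theorem exists_mem_stopping {P : ℤ → ℤ → Prop} {m n : ℤ} (hn : m ≤ n) {x : ℝ}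
    (hP : P n (idx n x)) : ∃ p ∈ stopping P m, x ∈ cell p.1 p.2 := by
  obtain ⟨k, ⟨hk, hPk⟩, hmin⟩ := Int.exists_least_of_bdd (P := fun n => m ≤ n ∧ P n (idx n x))
    ⟨m, fun z hz => hz.1⟩ ⟨n, hn, hP⟩
  refine ⟨(k, idx k x), ⟨hk, hPk, fun y hy l hl hlk hPl => ?_⟩, rfl⟩
  rw [idx_eq_of_le hlk.le (mem_cell_iff.1 hy)] at hPl
  exact absurd (hmin l ⟨hl, hPl⟩) (not_le.2 hlk)

theorem stopping_disjoint (P : ℤ → ℤ → Prop) (m : ℤ) :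
    (stopping P m).PairwiseDisjoint fun p => cell p.1 p.2 := by
  rintro ⟨n, j⟩ ⟨hn, hP, h⟩ ⟨n', j'⟩ ⟨hn', hP', h'⟩ hne
  refine Set.disjoint_left.2 fun x hx hx' => hne ?_
  simp only [mem_cell_iff] at hx hx' hP hP'
  rcases lt_trichotomy n n' with hlt | heq | hlt
  · exact absurd (hx ▸ hP) (h' x hx' n hn hlt)
  · subst heq
    rw [← hx, ← hx']
  · exact absurd (hx' ▸ hP') (h x hx n' hn' hlt)

theorem tsum_stopping_le (P : ℤ → ℤ → Prop) (m : ℤ) (S : Set (ℤ × ℤ)) (hS : S ⊆ stopping P m)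
    (μ : Measure ℝ) {H E : Set ℝ} (hH : MeasurableSet H) (hE : ∀ p ∈ S, cell p.1 p.2 ∩ H ⊆ E) :
    ∑' p : S, μ (cell p.1.1 p.1.2 ∩ H) ≤ μ E := by
  rw [← measure_iUnion]
  · exact measure_mono (Set.iUnion_subset fun p => hE p p.2)
  · intro a b hab
    exact (stopping_disjoint P m (hS a.2) (hS b.2) fun h => hab (Subtype.ext h)).mono
      Set.inter_subset_left Set.inter_subset_left
  · exact fun p => (measurableSet_cell _ _).inter hH

end Dyadic

section GoodLambda

/-- The maximal function attached to constants on the dyadic intervals of level at least `m`. -/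
noncomputable def cmax {V : Type*} (ν : V → ℝ≥0∞) (c : ℤ → ℤ → V) (m : ℤ) (x : ℝ) : ℝ≥0∞ :=
  ⨆ (n : ℤ) (_ : m ≤ n), ν (c n (idx n x))

theorem measurable_cmax {V : Type*} (ν : V → ℝ≥0∞) (c : ℤ → ℤ → V)
    (m : ℤ) : Measurable (cmax ν c m) := by
  refine Measurable.iSup fun n => Measurable.iSup fun _ => ?_
  exact (measurable_from_top (f := fun j => ν (c n j))).comp (measurable_idx n)

variable {V : Type*} [AddCommGroup V]
  {ν : V → ℝ≥0∞} {c : ℤ → ℤ → V} {h : ℝ → V} {A : ℝ → ℝ≥0∞} {m : ℤ} {ε : ℝ≥0∞}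

theorem good_lambda_cell (hν₁ : ∀ a b, ν a ≤ ν b + ν (a - b)) (hν₂ : ∀ a b, ν b ≤ ν a + ν (a - b))
    (hh : Measurable fun x => ν (h x)) (hε : ε ≤ 1 / 2)
    (hosc : ∀ n, m ≤ n → ∀ y, volume {x | x ∈ cell n (idx n y) ∧ A y < ν (h x - c n (idx n y))}
      ≤ ε * ENNReal.ofReal ((2 : ℝ) ^ (-n)))
    {l : ℝ≥0∞} {n j : ℤ} (hmn : m < n)
    (hmin : ∀ x ∈ cell n j, ∀ n', m ≤ n' → n' < n → ν (c n' (idx n' x)) ≤ l) :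
    volume ({x | 3 * l < cmax ν c m x ∧ A x ≤ l} ∩ cell n j) ≤ 4 * ε * volume (cell n j) := by
  rcases Set.eq_empty_or_nonempty ({x | 3 * l < cmax ν c m x ∧ A x ≤ l} ∩ cell n j) with h0 | h0
  · rw [h0]; simp
  obtain ⟨y₀, ⟨-, hy₀⟩, hy₀j⟩ := h0
  set E := {x | 3 * l < cmax ν c m x ∧ A x ≤ l} with hE
  set H := {x | 2 * l < ν (h x)} with hHdef
  have hHm : MeasurableSet H := measurableSet_lt measurable_const hh
  set P : ℤ → ℤ → Prop := fun n j => 3 * l < ν (c n j)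
  set S : Set (ℤ × ℤ) := {p | p ∈ stopping P n ∧ (cell p.1 p.2 ∩ (E ∩ cell n j)).Nonempty}
  have hcov : E ∩ cell n j ⊆ ⋃ p ∈ S, cell p.1 p.2 := by
    rintro x ⟨hx, hxj⟩
    obtain ⟨n', hn'⟩ := lt_iSup_iff.1 hx.1
    obtain ⟨hmn', hlt⟩ := lt_iSup_iff.1 hn'
    have hnn' : n ≤ n' := by
      by_contra hcon
      have h1 := hmin x hxj n' hmn' (not_le.1 hcon)
      have h2 : l ≤ 3 * l := le_mul_of_one_le_left' (by norm_num)
      exact absurd hlt (not_lt.2 (h1.trans h2))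
    obtain ⟨p, hp, hxp⟩ := exists_mem_stopping (P := P) hnn' hlt
    exact Set.mem_biUnion (x := p) ⟨hp, x, hxp, hx, hxj⟩ hxp
  have hhalf : ∀ p ∈ S, volume (cell p.1 p.2) ≤ 2 * volume (cell p.1 p.2 ∩ H) := by
    rintro ⟨n', j'⟩ ⟨⟨hn', hP', -⟩, y', hy', ⟨-, hAy'⟩, -⟩
    simp only at hn' hP' hy' ⊢
    have hd : volume (cell n' j' \ H) ≤ 1 / 2 * volume (cell n' j') := by
      have hj' : idx n' y' = j' := hy'
      have := hosc n' (hmn.le.trans hn') y'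
      rw [hj', ← volume_cell n' j'] at this
      refine (measure_mono ?_).trans (this.trans (by gcongr))
      rintro x ⟨hx, hxH⟩
      refine ⟨hx, hAy'.trans_lt ?_⟩
      by_contra hcon
      rw [not_lt] at hcon
      rw [hHdef, Set.mem_ofPred_eq, not_lt] at hxH
      refine absurd hP' (not_lt.2 ?_)
      calc _ ≤ ν (h x) + ν (h x - c n' j') := hν₂ _ _
        _ ≤ 2 * l + l := by gcongr
        _ = 3 * l := by ring
    have hfin : volume (cell n' j') ≠ ∞ := by rw [volume_cell]; simp
    have h1 := measure_le_inter_add_sdiff volume (cell n' j') H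
    have h2 : volume (cell n' j') = 1 / 2 * volume (cell n' j') + 1 / 2 * volume (cell n' j') := by
      rw [← add_mul, one_div, ENNReal.inv_two_add_inv_two, one_mul]
    have h3 : 1 / 2 * volume (cell n' j') ≤ volume (cell n' j' ∩ H) := by
      have hne : 1 / 2 * volume (cell n' j') ≠ ∞ := by finiteness
      refine (ENNReal.add_le_add_iff_right hne).1 ?_
      rw [← h2]
      exact h1.trans (by gcongr)
    calc volume (cell n' j') = 2 * (1 / 2 * volume (cell n' j')) := by
          rw [← mul_assoc, one_div, ENNReal.mul_inv_cancel (by simp) (by simp), one_mul]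
      _ ≤ _ := by gcongr
  have hHQ : volume (cell n j ∩ H) ≤ 2 * ε * volume (cell n j) := by
    have := hosc (n - 1) (by omega) y₀
    have e : ENNReal.ofReal ((2 : ℝ) ^ (-(n - 1))) = 2 * volume (cell n j) := by
      rw [volume_cell, ← ENNReal.ofReal_ofNat, ← ENNReal.ofReal_mul (by norm_num)]
      congr 1
      rw [neg_sub, sub_eq_add_neg, zpow_add₀ (by norm_num)]; simp
    rw [e] at this
    refine (measure_mono ?_).trans (this.trans (le_of_eq (by ring)))
    rintro x ⟨hx, hxH⟩
    refine ⟨idx_eq_of_le (show n - 1 ≤ n by omega)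
      ((mem_cell_iff.1 hx).trans (mem_cell_iff.1 hy₀j).symm), hy₀.trans_lt ?_⟩
    by_contra hcon
    rw [not_lt] at hcon
    refine absurd (show 2 * l < ν (h x) from hxH) (not_lt.2 ?_)
    calc _ ≤ ν (c (n - 1) (idx (n - 1) y₀)) + ν (h x - c (n - 1) (idx (n - 1) y₀)) := hν₁ _ _
      _ ≤ l + l := by
        gcongr
        exact hmin y₀ hy₀j _ (by omega) (by omega)
      _ = 2 * l := by ring
  have hsub : ∀ p ∈ S, cell p.1 p.2 ∩ H ⊆ cell n j ∩ H := by
    rintro ⟨n', j'⟩ ⟨⟨hn', -, -⟩, y', hy', -, hyn⟩ x ⟨hx, hxH⟩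
    refine ⟨?_, hxH⟩
    have := idx_eq_of_le hn' ((mem_cell_iff.1 hx).trans (mem_cell_iff.1 hy').symm)
    exact this.trans hyn
  calc volume (E ∩ cell n j) ≤ ∑' p : S, volume (cell p.1.1 p.1.2) :=
        (measure_mono hcov).trans (measure_biUnion_le _ S.to_countable _)
    _ ≤ ∑' p : S, 2 * volume (cell p.1.1 p.1.2 ∩ H) := by
        gcongr with p
        exact hhalf p p.2
    _ = 2 * ∑' p : S, volume (cell p.1.1 p.1.2 ∩ H) := ENNReal.tsum_mul_left
    _ ≤ 2 * volume (cell n j ∩ H) := by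
        gcongr
        exact tsum_stopping_le P n S (fun p hp => hp.1) volume hHm hsub
    _ ≤ 2 * (2 * ε * volume (cell n j)) := by gcongr
    _ = _ := by ring

theorem good_lambda (hν₁ : ∀ a b, ν a ≤ ν b + ν (a - b)) (hν₂ : ∀ a b, ν b ≤ ν a + ν (a - b))
    (hh : Measurable fun x => ν (h x)) (hε : ε ≤ 1 / 2)
    (hosc : ∀ n, m ≤ n → ∀ y, volume {x | x ∈ cell n (idx n y) ∧ A y < ν (h x - c n (idx n y))}
      ≤ ε * ENNReal.ofReal ((2 : ℝ) ^ (-n)))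
    (hc : ∀ j, ν (c m j) = 0) (l : ℝ≥0∞) (j₀ : ℤ) :
    volume.restrict (cell m j₀) {x | 3 * l < cmax ν c m x ∧ A x ≤ l} ≤
      4 * ε * volume.restrict (cell m j₀) {x | l < cmax ν c m x} := by
  set E := {x | 3 * l < cmax ν c m x ∧ A x ≤ l} with hE
  set P : ℤ → ℤ → Prop := fun n j => l < ν (c n j)
  set μ := volume.restrict (cell m j₀)
  have hcov : E ⊆ ⋃ p ∈ stopping P m, E ∩ cell p.1 p.2 := by
    intro x hx
    obtain ⟨n', hn'⟩ := lt_iSup_iff.1 hx.1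
    obtain ⟨hmn', hlt⟩ := lt_iSup_iff.1 hn'
    have h2 : l ≤ 3 * l := le_mul_of_one_le_left' (by norm_num)
    obtain ⟨p, hp, hxp⟩ := exists_mem_stopping (P := P) hmn' (h2.trans_lt hlt)
    exact Set.mem_biUnion (x := p) hp ⟨hx, hxp⟩
  have hQ : ∀ p ∈ stopping P m, μ (E ∩ cell p.1 p.2) ≤ 4 * ε * μ (cell p.1 p.2) := by
    rintro ⟨n, j⟩ ⟨hn, hP, hmin⟩
    simp only at hn hP hmin ⊢
    have hmn : m < n := by
      rcases hn.lt_or_eq with h1 | h1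
      · exact h1
      · subst h1
        exact absurd hP (by simp [P, hc])
    rw [Measure.restrict_apply' (measurableSet_cell _ _),
      Measure.restrict_apply' (measurableSet_cell _ _)]
    rcases Set.eq_empty_or_nonempty (cell n j ∩ cell m j₀) with h0 | ⟨z, hz, hz'⟩
    · rw [Set.inter_assoc, h0]; simp
    · have hsub : cell n j ⊆ cell m j₀ := fun x hx =>
        (idx_eq_of_le hn ((mem_cell_iff.1 hx).trans (mem_cell_iff.1 hz).symm)).trans hz'
      rw [Set.inter_assoc, Set.inter_eq_left.2 hsub]
      exact good_lambda_cell hν₁ hν₂ hh hε hosc hmn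
        fun x hx n' h1 h2 => not_lt.1 (hmin x hx n' h1 h2)
  calc μ E ≤ ∑' p : stopping P m, μ (E ∩ cell p.1.1 p.1.2) :=
        (measure_mono hcov).trans (measure_biUnion_le _ (Set.to_countable _) _)
    _ ≤ ∑' p : stopping P m, 4 * ε * μ (cell p.1.1 p.1.2 ∩ Set.univ) := by
        gcongr with p
        simpa using hQ p p.2
    _ = 4 * ε * ∑' p : stopping P m, μ (cell p.1.1 p.1.2 ∩ Set.univ) := ENNReal.tsum_mul_left
    _ ≤ _ := by
        gcongr
        refine tsum_stopping_le P m _ subset_rfl μ MeasurableSet.univ ?_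
        rintro ⟨n, j⟩ ⟨hn, hP, -⟩ x ⟨hx, -⟩
        simp only at hn hP hx
        rw [Set.mem_ofPred_eq]
        refine hP.trans_le ?_
        have : ν (c n (idx n x)) ≤ cmax ν c m x :=
          le_iSup₂ (f := fun (n : ℤ) (_ : m ≤ n) => ν (c n (idx n x))) n hn
        rwa [mem_cell_iff.1 hx] at this

theorem lintegral_cell_cmax_le (hν₁ : ∀ a b, ν a ≤ ν b + ν (a - b))
    (hν₂ : ∀ a b, ν b ≤ ν a + ν (a - b))
    (hh : Measurable fun x => ν (h x)) {σ : ℝ} (hσ : 0 < σ)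
    (hε : ε ≤ 1 / 2) (hεσ : 4 * ε * 3 ^ σ ≤ 1 / 2)
    (hosc : ∀ n, m ≤ n → ∀ y, volume {x | x ∈ cell n (idx n y) ∧ A y < ν (h x - c n (idx n y))}
      ≤ ε * ENNReal.ofReal ((2 : ℝ) ^ (-n)))
    (hc : ∀ j, ν (c m j) = 0) (hA : Measurable A) (hAfin : ∀ x, A x ≠ ∞) (j₀ : ℤ) :
    ∫⁻ x in cell m j₀, cmax ν c m x ^ σ ≤ 2 * 3 ^ σ * ∫⁻ x in cell m j₀, A x ^ σ := by
  set μ := volume.restrict (cell m j₀) with hμ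
  have hcm := measurable_cmax ν c m
  set D : ℕ → ℝ → ℝ≥0∞ := fun R x => min (cmax ν c m x) R with hD
  have hDm : ∀ R, Measurable (D R) := fun R => hcm.min measurable_const
  have hDfin : ∀ R x, D R x ≠ ∞ := fun R x => ((min_le_right _ _).trans_lt (by finiteness)).ne
  have hR : ∀ R : ℕ, ∫⁻ x, D R x ^ σ ∂μ ≤ 2 * 3 ^ σ * ∫⁻ x, A x ^ σ ∂μ := by
    intro R
    have h3 : ∀ x, D R x = 3 * (D R x / 3) := fun x => by
      rw [ENNReal.mul_div_cancel (by simp) (by simp)]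
    have hlt : ∀ t : ℝ, 0 < t → μ {x | ENNReal.ofReal t < D R x / 3} ≤
        4 * ε * μ {x | ENNReal.ofReal t < D R x} + μ {x | ENNReal.ofReal t < A x} := by
      intro t ht
      have hg := good_lambda hν₁ hν₂ hh hε hosc hc (ENNReal.ofReal t) j₀
      by_cases hRt : 3 * ENNReal.ofReal t < R
      · have htR : ENNReal.ofReal t < R := lt_of_le_of_lt (le_mul_of_one_le_left' (by norm_num)) hRt
        have e1 : {x | ENNReal.ofReal t < D R x} = {x | ENNReal.ofReal t < cmax ν c m x} := by
          ext x; simp [D, htR]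
        rw [e1]
        refine le_trans ?_ (add_le_add_left hg _)
        refine (measure_mono ?_).trans (measure_union_le _ _)
        intro x hx
        rw [Set.mem_ofPred_eq, ENNReal.lt_div_iff_mul_lt (by simp) (by simp), mul_comm] at hx
        rcases le_or_gt (A x) (ENNReal.ofReal t) with h1 | h1
        · exact Or.inl ⟨hx.trans_le (min_le_left _ _), h1⟩
        · exact Or.inr h1
      · have : {x | ENNReal.ofReal t < D R x / 3} = ∅ := by
          refine Set.eq_empty_of_forall_notMem fun x hx => hRt ?_
          rw [Set.mem_ofPred_eq, ENNReal.lt_div_iff_mul_lt (by simp) (by simp), mul_comm] at hx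
          exact hx.trans_le (min_le_right _ _)
        rw [this]; simp
    have h1 : ∫⁻ x, (D R x / 3) ^ σ ∂μ ≤ 4 * ε * ∫⁻ x, D R x ^ σ ∂μ + ∫⁻ x, A x ^ σ ∂μ := by
      rw [lintegral_rpow_eq_layercake μ ((hDm R).div_const _)
          (fun x => ENNReal.div_ne_top (hDfin R x) (by simp)) hσ,
        lintegral_rpow_eq_layercake μ (hDm R) (hDfin R) hσ,
        lintegral_rpow_eq_layercake μ hA hAfin hσ, mul_left_comm, ← mul_add]
      refine mul_le_mul' le_rfl ?_
      rw [← lintegral_const_mul' _ _ (ENNReal.mul_ne_top (by simp)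
        (hε.trans_lt (by simp)).ne)]
      have hmeas : Measurable fun t : ℝ => μ {x | ENNReal.ofReal t < A x} *
          ENNReal.ofReal (t ^ (σ - 1)) := by
        refine Measurable.mul (Antitone.measurable fun s t hst => measure_mono fun x hx => ?_)
          (by fun_prop)
        exact lt_of_le_of_lt (ENNReal.ofReal_le_ofReal hst) hx
      rw [← lintegral_add_right _ hmeas]
      refine setLIntegral_mono' measurableSet_Ioi fun t ht => ?_
      calc _ ≤ (4 * ε * μ {x | ENNReal.ofReal t < D R x} + μ {x | ENNReal.ofReal t < A x}) *
            ENNReal.ofReal (t ^ (σ - 1)) := by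
            gcongr
            exact hlt t ht
        _ = _ := by ring
    have hfin : ∫⁻ x, D R x ^ σ ∂μ ≠ ∞ := by
      refine ((lintegral_mono fun x => ENNReal.rpow_le_rpow (min_le_right _ (R : ℝ≥0∞))
        hσ.le).trans_lt ?_).ne
      rw [lintegral_const, hμ, Measure.restrict_apply_univ, volume_cell]
      have : (R : ℝ≥0∞) ^ σ ≠ ∞ := ENNReal.rpow_ne_top_of_nonneg hσ.le (by simp)
      finiteness
    have hc3 : (3 : ℝ≥0∞) ^ σ ≠ ∞ := ENNReal.rpow_ne_top_of_nonneg hσ.le (by simp)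
    have h2 : ∫⁻ x, D R x ^ σ ∂μ = 3 ^ σ * ∫⁻ x, (D R x / 3) ^ σ ∂μ := by
      rw [← lintegral_const_mul' _ _ hc3]
      refine lintegral_congr fun x => ?_
      conv_lhs => rw [h3 x]
      rw [ENNReal.mul_rpow_of_nonneg _ _ hσ.le]
    set I := ∫⁻ x, D R x ^ σ ∂μ
    set a := ∫⁻ x, A x ^ σ ∂μ
    have h4 : I ≤ 1 / 2 * I + 3 ^ σ * a := by
      calc I ≤ 3 ^ σ * (4 * ε * I + a) := h2.trans_le (by gcongr)
        _ = 4 * ε * 3 ^ σ * I + 3 ^ σ * a := by ring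
        _ ≤ _ := by gcongr
    have h5 : I = 1 / 2 * I + 1 / 2 * I := by
      rw [← add_mul, one_div, ENNReal.inv_two_add_inv_two, one_mul]
    have h6 : 1 / 2 * I ≤ 3 ^ σ * a := by
      refine (ENNReal.add_le_add_iff_left (show 1 / 2 * I ≠ ∞ by finiteness)).1 ?_
      rwa [← h5]
    calc I = 2 * (1 / 2 * I) := by
          rw [← mul_assoc, one_div, ENNReal.mul_inv_cancel (by simp) (by simp), one_mul]
      _ ≤ 2 * (3 ^ σ * a) := by gcongr
      _ = _ := by ring
  have hsup : ∀ x, cmax ν c m x ^ σ = ⨆ R, D R x ^ σ := by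
    intro x
    have h1 : cmax ν c m x = ⨆ R, D R x := by
      simp only [D, ← inf_iSup_eq, ENNReal.iSup_natCast]
      simp
    rw [h1, ← ENNReal.orderIsoRpow_apply σ hσ, OrderIso.map_iSup]
    rfl
  simp_rw [hsup]
  rw [lintegral_iSup (fun R => (hDm R).pow_const _)]
  · exact iSup_le hR
  · intro R R' hRR' x
    simp only [D]
    gcongr

/-- Integrated good-`λ` inequality: a function with small dyadic oscillation relative to `A` off
small sets has its associated dyadic maximal function controlled by `A`. -/
theorem lintegral_cmax_le (hν₁ : ∀ a b, ν a ≤ ν b + ν (a - b))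
    (hν₂ : ∀ a b, ν b ≤ ν a + ν (a - b))
    (hh : Measurable fun x => ν (h x)) {σ : ℝ} (hσ : 0 < σ)
    (hε : ε ≤ 1 / 2) (hεσ : 4 * ε * 3 ^ σ ≤ 1 / 2)
    (hosc : ∀ n, m ≤ n → ∀ y, volume {x | x ∈ cell n (idx n y) ∧ A y < ν (h x - c n (idx n y))}
      ≤ ε * ENNReal.ofReal ((2 : ℝ) ^ (-n)))
    (hc : ∀ j, ν (c m j) = 0) (hA : Measurable A) (hAfin : ∀ x, A x ≠ ∞) :
    ∫⁻ x, cmax ν c m x ^ σ ≤ 2 * 3 ^ σ * ∫⁻ x, A x ^ σ := by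
  have key : ∀ g : ℝ → ℝ≥0∞, ∫⁻ x, g x = ∑' j, ∫⁻ x in cell m j, g x := fun g => by
    rw [← lintegral_iUnion (measurableSet_cell m) (pairwise_disjoint_cell m), iUnion_cell,
      Measure.restrict_univ]
  rw [key, key, ← ENNReal.tsum_mul_left]
  exact ENNReal.tsum_le_tsum fun j =>
    lintegral_cell_cmax_le hν₁ hν₂ hh hσ hε hεσ hosc hc hA hAfin j

end GoodLambda

section Weights

/-- An `L¹`-normalized weight at scale `2 ^ (-k)`. -/
noncomputable def wt (k : ℤ) (x : ℝ) : ℝ := 2 ^ k / (1 + 2 ^ k * |x|) ^ 2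

/-- The polynomial growth factor at scale `2 ^ (-k)`. -/
noncomputable def growth (k : ℤ) (x : ℝ) : ℝ := 1 + 2 ^ k * |x|

/-- The weighted average of `F` at scale `2 ^ (-k)` around `x`. -/
noncomputable def wavg (k : ℤ) (F : ℝ → ℝ≥0∞) (x : ℝ) : ℝ≥0∞ :=
  ∫⁻ t, ENNReal.ofReal (wt k (x - t)) * F t

theorem one_le_growth (k : ℤ) (x : ℝ) : 1 ≤ growth k x := by
  have : 0 ≤ (2 : ℝ) ^ k * |x| := by positivity
  unfold growth; linarith

theorem growth_pos (k : ℤ) (x : ℝ) : 0 < growth k x := zero_lt_one.trans_le (one_le_growth k x)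

theorem growth_sub_le (k : ℤ) (x y z : ℝ) :
    growth k (x - z) ≤ growth k (x - y) * growth k (y - z) := by
  have h : |x - z| ≤ |x - y| + |y - z| := abs_sub_le x y z
  have h1 : 0 ≤ (2 : ℝ) ^ k * |x - y| * ((2 : ℝ) ^ k * |y - z|) := by positivity
  have h2 : (0 : ℝ) < 2 ^ k := by positivity
  unfold growth
  nlinarith

theorem growth_mono_left {k j : ℤ} (h : k ≤ j) (x : ℝ) : growth k x ≤ growth j x := by
  unfold growth
  gcongr
  norm_num

theorem continuous_growth (k : ℤ) : Continuous (growth k) := by unfold growth; fun_prop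

theorem wt_eq (k : ℤ) (x : ℝ) : wt k x = 2 ^ k / growth k x ^ 2 := rfl

theorem wt_pos (k : ℤ) (x : ℝ) : 0 < wt k x :=
  div_pos (by positivity) (pow_pos (growth_pos k x) 2)

theorem wt_neg (k : ℤ) (x : ℝ) : wt k (-x) = wt k x := by simp [wt]

theorem continuous_wt (k : ℤ) : Continuous (wt k) := by
  refine continuous_const.div ((continuous_growth k).pow 2) fun x => ?_
  exact (pow_pos (growth_pos k x) 2).ne'

theorem measurable_ofReal_wt (k : ℤ) (x : ℝ) :
    Measurable fun t => ENNReal.ofReal (wt k (x - t)) :=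
  ((continuous_wt k).measurable.comp (measurable_const.sub measurable_id)).ennreal_ofReal

theorem wt_le_growth_mul (k : ℤ) (x y z : ℝ) :
    wt k (y - z) ≤ growth k (x - y) ^ 2 * wt k (x - z) := by
  have h := growth_sub_le k x y z
  have h0 := growth_pos k (x - z)
  have h1 := growth_pos k (y - z)
  rw [wt_eq, wt_eq, ← mul_div_assoc, div_le_div_iff₀ (by positivity) (by positivity)]
  have : growth k (x - z) ^ 2 ≤ (growth k (x - y) * growth k (y - z)) ^ 2 := by gcongr
  nlinarith [show (0 : ℝ) < 2 ^ k by positivity]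

theorem wavg_le_growth_mul (k : ℤ) (F : ℝ → ℝ≥0∞) (x y : ℝ) :
    wavg k F y ≤ ENNReal.ofReal (growth k (x - y)) ^ 2 * wavg k F x := by
  unfold wavg
  rw [← lintegral_const_mul' _ _ (by finiteness)]
  refine lintegral_mono fun t => ?_
  rw [← mul_assoc, ← ENNReal.ofReal_pow (growth_pos _ _).le, ← ENNReal.ofReal_mul (sq_nonneg _)]
  gcongr
  exact wt_le_growth_mul k x y t

theorem growth_le_two {k : ℤ} {x : ℝ} (h : |x| ≤ (2 : ℝ) ^ (-k)) : growth k x ≤ 2 := by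
  have : (2 : ℝ) ^ k * |x| ≤ 2 ^ k * (2 : ℝ) ^ (-k) := by gcongr
  rw [← zpow_add₀ (by norm_num)] at this
  simp only [add_neg_cancel, zpow_zero] at this
  unfold growth; linarith

theorem wavg_le_of_near {k : ℤ} {x y : ℝ} (h : |x - y| ≤ (2 : ℝ) ^ (-k)) (F : ℝ → ℝ≥0∞) :
    wavg k F y ≤ 4 * wavg k F x := by
  refine (wavg_le_growth_mul k F x y).trans ?_
  gcongr
  calc ENNReal.ofReal (growth k (x - y)) ^ 2 ≤ ENNReal.ofReal 2 ^ 2 := by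
        gcongr; exact growth_le_two h
    _ = 4 := by norm_num

theorem wavg_le_hl {F : ℝ → ℝ≥0∞} (hF : Measurable F) (k : ℤ) (x : ℝ) :
    wavg k F x ≤ 8 * hl F x := by
  have hpt : ∀ t, ENNReal.ofReal (wt k (x - t)) * F t ≤
      ∑' l : ℕ, ENNReal.ofReal (4 * 2 ^ k * (1 / 4) ^ l) *
        (Metric.closedBall x ((2 : ℝ) ^ ((l : ℤ) - k))).indicator F t := by
    intro t
    have hk : (0 : ℝ) < 2 ^ k := by positivity
    have hex : ∃ l : ℕ, |x - t| ≤ (2 : ℝ) ^ ((l : ℤ) - k) ∧ wt k (x - t) ≤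
        4 * 2 ^ k * (1 / 4) ^ l := by
      rcases le_or_gt ((2 : ℝ) ^ k * |x - t|) 1 with h | h
      · refine ⟨0, ?_, ?_⟩
        · rw [Nat.cast_zero, zero_sub, zpow_neg]
          exact (le_inv_mul_iff₀ hk).2 h |>.trans_eq (mul_one _)
        · rw [wt_eq, div_le_iff₀ (pow_pos (growth_pos _ _) 2)]
          have h1 : 1 ≤ growth k (x - t) ^ 2 := one_le_pow₀ (one_le_growth k (x - t))
          rw [pow_zero, mul_one]
          nlinarith
      · obtain ⟨n, hn, hn'⟩ := exists_nat_pow_near h.le (by norm_num : (1 : ℝ) < 2)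
        refine ⟨n + 1, ?_, ?_⟩
        · rw [zpow_sub₀ (by norm_num), le_div_iff₀ hk, zpow_natCast, mul_comm]
          exact hn'.le
        · rw [wt_eq, div_le_iff₀ (pow_pos (growth_pos _ _) 2)]
          have h1 : ((2 : ℝ) ^ n) ^ 2 ≤ growth k (x - t) ^ 2 := by
            gcongr; unfold growth; linarith
          have h2 : ((1 : ℝ) / 4) ^ (n + 1) * ((2 : ℝ) ^ n) ^ 2 = 1 / 4 := by
            rw [← pow_mul, mul_comm n 2, pow_mul, pow_succ]
            norm_num
            field_simp
            rw [← mul_pow]; norm_num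
          have h3 : (0 : ℝ) ≤ 4 * 2 ^ k * (1 / 4) ^ (n + 1) := by positivity
          nlinarith [mul_le_mul_of_nonneg_left h1 h3]
    obtain ⟨l, hl1, hl2⟩ := hex
    refine le_trans ?_ (ENNReal.le_tsum l)
    rw [Set.indicator_of_mem (by rwa [Metric.mem_closedBall, dist_comm, Real.dist_eq])]
    gcongr
  calc wavg k F x ≤ ∫⁻ t, ∑' l : ℕ, ENNReal.ofReal (4 * 2 ^ k * (1 / 4) ^ l) *
        (Metric.closedBall x ((2 : ℝ) ^ ((l : ℤ) - k))).indicator F t := lintegral_mono hpt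
    _ = ∑' l : ℕ, ENNReal.ofReal (4 * 2 ^ k * (1 / 4) ^ l) *
        ∫⁻ t in Metric.closedBall x ((2 : ℝ) ^ ((l : ℤ) - k)), F t := by
        rw [lintegral_tsum fun l => ((hF.indicator
          Metric.isClosed_closedBall.measurableSet).const_mul _).aemeasurable]
        refine tsum_congr fun l => ?_
        rw [lintegral_const_mul' _ _ (by finiteness),
          lintegral_indicator Metric.isClosed_closedBall.measurableSet]
    _ ≤ ∑' l : ℕ, ENNReal.ofReal (4 * (1 / 2) ^ l) * hl F x := by
        refine ENNReal.tsum_le_tsum fun l => ?_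
        have := setLIntegral_closedBall_le_hl F x (k - l)
        rw [neg_sub] at this
        refine (mul_le_mul' le_rfl this).trans (le_of_eq ?_)
        rw [← mul_assoc, ← ENNReal.ofReal_mul (by positivity)]
        congr 2
        rw [zpow_sub₀ (by norm_num), zpow_natCast]
        have : ((1 : ℝ) / 4) ^ l * 2 ^ l = (1 / 2) ^ l := by rw [← mul_pow]; norm_num
        rw [← this]
        field_simp
    _ = 8 * hl F x := by
        rw [ENNReal.tsum_mul_right, ← ENNReal.ofReal_tsum_of_nonneg (fun _ => by positivity)
          (summable_geometric_two.mul_left 4), _root_.tsum_mul_left, tsum_geometric_two]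
        norm_num

theorem lintegral_wt_le (k : ℤ) (x : ℝ) : ∫⁻ t, ENNReal.ofReal (wt k (x - t)) ≤ 16 := by
  have := (wavg_le_hl (F := fun _ => 1) measurable_const k x).trans
    (mul_le_mul' le_rfl (hl_le_of_ae_le (Filter.Eventually.of_forall fun _ => le_rfl) x))
  simp only [wavg, mul_one] at this
  exact this.trans_eq (by norm_num)

theorem wavg_le_of_ae_le {F : ℝ → ℝ≥0∞} {c : ℝ≥0∞} (h : ∀ᵐ t, F t ≤ c) (k : ℤ) (x : ℝ) :
    wavg k F x ≤ 16 * c := by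
  calc wavg k F x ≤ ∫⁻ t, ENNReal.ofReal (wt k (x - t)) * c :=
        lintegral_mono_ae (h.mono fun t ht => by gcongr)
    _ = (∫⁻ t, ENNReal.ofReal (wt k (x - t))) * c :=
        lintegral_mul_const _ (measurable_ofReal_wt k x)
    _ ≤ 16 * c := by gcongr; exact lintegral_wt_le k x

theorem wavg_far_le {F : ℝ → ℝ≥0∞} {m k : ℤ} {x : ℝ}
    (h : ∀ t, |x - t| < (2 : ℝ) ^ (-m) → F t = 0) :
    wavg k F x ≤ 4 * ENNReal.ofReal ((2 : ℝ) ^ (m - k)) * wavg m F x := by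
  unfold wavg
  rw [← lintegral_const_mul' _ _ (by finiteness)]
  refine lintegral_mono fun t => ?_
  by_cases ht : |x - t| < (2 : ℝ) ^ (-m)
  · simp [h t ht]
  · rw [← mul_assoc]
    gcongr
    rw [show (4 : ℝ≥0∞) = ENNReal.ofReal 4 by norm_num, ← ENNReal.ofReal_mul (by norm_num),
      ← ENNReal.ofReal_mul (by positivity)]
    refine ENNReal.ofReal_le_ofReal ?_
    rw [wt_eq, wt_eq, ← mul_div_assoc,
      div_le_div_iff₀ (pow_pos (growth_pos _ _) 2) (pow_pos (growth_pos _ _) 2)]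
    have hm : (0 : ℝ) < 2 ^ m := by positivity
    have hk : (0 : ℝ) < 2 ^ k := by positivity
    have e : (2 : ℝ) ^ (m - k) = 2 ^ m / 2 ^ k := zpow_sub₀ (by norm_num) _ _
    have h1 : 1 ≤ (2 : ℝ) ^ m * |x - t| := by
      rw [not_lt, zpow_neg] at ht
      have := mul_le_mul_of_nonneg_left ht hm.le
      rwa [mul_inv_cancel₀ hm.ne'] at this
    have h2 : growth m (x - t) ^ 2 ≤ (2 * (2 ^ m * |x - t|)) ^ 2 := by
      unfold growth
      gcongr
      linarith
    have h3 : (2 ^ k * |x - t|) ^ 2 ≤ growth k (x - t) ^ 2 := by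
      unfold growth
      gcongr
      linarith
    calc (2 : ℝ) ^ k * growth m (x - t) ^ 2 ≤ 2 ^ k * (2 * (2 ^ m * |x - t|)) ^ 2 := by gcongr
      _ = 4 * 2 ^ (m - k) * 2 ^ m * (2 ^ k * |x - t|) ^ 2 := by rw [e]; field_simp; ring
      _ ≤ _ := by gcongr

end Weights

section Bumps

/-- Measurable, integrable and bounded functions. -/
structure Adm (f : ℝ → ℂ) : Prop where
  meas : Measurable f
  int : Integrable f
  bdd : ∃ M : ℝ, ∀ x, ‖f x‖ ≤ M

/-- Continuous functions with quantitative decay and regularity. -/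
structure Bump (C : ℝ≥0) (η : ℝ → ℂ) : Prop where
  cont : Continuous η
  bound : ∀ x, ‖η x‖ ≤ C / (1 + |x|) ^ 6
  lip : ∀ x y, ‖η x - η y‖ ≤ C * |x - y| * (1 / (1 + |x|) ^ 6 + 1 / (1 + |y|) ^ 6)

theorem norm_dil (η : ℝ → ℂ) (k : ℤ) (x : ℝ) : ‖dil η k x‖ = 2 ^ k * ‖η (2 ^ k * x)‖ := by
  simp [dil]

variable {C : ℝ≥0} {η : ℝ → ℂ} {f g : ℝ → ℂ}

theorem growth_eq (k : ℤ) (x : ℝ) : growth k x = 1 + |2 ^ k * x| := by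
  rw [growth, abs_mul, abs_of_pos (by positivity : (0 : ℝ) < 2 ^ k)]

theorem Bump.norm_dil_le (hη : Bump C η) (k : ℤ) (x : ℝ) :
    ‖dil η k x‖ ≤ C * (2 ^ k / growth k x ^ 6) := by
  rw [norm_dil, growth_eq, mul_div_left_comm]
  gcongr
  exact hη.bound _

theorem Bump.norm_dil_le_wt (hη : Bump C η) (k : ℤ) (x : ℝ) :
    ‖dil η k x‖ ≤ C * wt k x := by
  refine (hη.norm_dil_le k x).trans ?_
  have h := one_le_growth k x
  have h' : growth k x ^ 2 ≤ growth k x ^ 6 := pow_le_pow_right₀ h (by norm_num)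
  have h0 := growth_pos k x
  rw [wt_eq]
  gcongr

theorem Bump.norm_dil_sub_le (hη : Bump C η) (k : ℤ) (x y : ℝ) :
    ‖dil η k x - dil η k y‖ ≤
      C * (2 ^ k * |x - y|) * (2 ^ k / growth k x ^ 6 + 2 ^ k / growth k y ^ 6) := by
  have e : ‖dil η k x - dil η k y‖ = 2 ^ k * ‖η (2 ^ k * x) - η (2 ^ k * y)‖ := by
    simp [dil, ← mul_sub]
  rw [e, growth_eq, growth_eq]
  calc _ ≤ 2 ^ k * (C * |2 ^ k * x - 2 ^ k * y| *
        (1 / (1 + |2 ^ k * x|) ^ 6 + 1 / (1 + |2 ^ k * y|) ^ 6)) := by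
        gcongr; exact hη.lip _ _
    _ = _ := by
      rw [← mul_sub, abs_mul, abs_of_pos (by positivity : (0 : ℝ) < 2 ^ k)]
      ring

theorem Bump.norm_dil_sub_le_wt (hη : Bump C η) (k : ℤ) (x y : ℝ) :
    ‖dil η k x - dil η k y‖ ≤ C * (2 ^ k * |x - y|) * (wt k x + wt k y) := by
  refine (hη.norm_dil_sub_le k x y).trans ?_
  have hx : growth k x ^ 2 ≤ growth k x ^ 6 := pow_le_pow_right₀ (one_le_growth k x) (by norm_num)
  have hy : growth k y ^ 2 ≤ growth k y ^ 6 := pow_le_pow_right₀ (one_le_growth k y) (by norm_num)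
  have h0 := growth_pos k x
  have h1 := growth_pos k y
  rw [wt_eq, wt_eq]
  exact mul_le_mul_of_nonneg_left (add_le_add
    (div_le_div_of_nonneg_left (by positivity) (by positivity) hx)
    (div_le_div_of_nonneg_left (by positivity) (by positivity) hy)) (by positivity)

theorem Bump.continuous_dil (hη : Bump C η) (k : ℤ) : Continuous (dil η k) := by
  have := hη.cont
  unfold dil
  fun_prop

theorem Bump.norm_dil_le_const (hη : Bump C η) (k : ℤ) (x : ℝ) : ‖dil η k x‖ ≤ C * 2 ^ k := by
  refine (hη.norm_dil_le_wt k x).trans ?_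
  gcongr
  rw [wt_eq]
  exact div_le_self (by positivity) (one_le_pow₀ (one_le_growth k x))

theorem Bump.integrable_dil (hη : Bump C η) (k : ℤ) : Integrable (dil η k) := by
  refine ⟨(hη.continuous_dil k).aestronglyMeasurable, ?_⟩
  have h : ∀ t, ‖dil η k t‖ₑ ≤ ENNReal.ofReal C * ENNReal.ofReal (wt k (0 - t)) := by
    intro t
    rw [zero_sub, wt_neg, ← ENNReal.ofReal_mul (by positivity), ← ofReal_norm]
    exact ENNReal.ofReal_le_ofReal (hη.norm_dil_le_wt k t)
  refine (lintegral_mono h).trans_lt ?_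
  rw [lintegral_const_mul' _ _ (by finiteness)]
  exact ENNReal.mul_lt_top (by simp) ((lintegral_wt_le k 0).trans_lt (by simp))

theorem Adm.add (hf : Adm f) (hg : Adm g) : Adm fun x => f x + g x := by
  obtain ⟨M, hM⟩ := hf.bdd
  obtain ⟨M', hM'⟩ := hg.bdd
  exact ⟨hf.meas.add hg.meas, hf.int.add hg.int, M + M', fun x =>
    (norm_add_le _ _).trans (add_le_add (hM x) (hM' x))⟩

theorem Adm.sub (hf : Adm f) (hg : Adm g) : Adm fun x => f x - g x := by
  obtain ⟨M, hM⟩ := hf.bdd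
  obtain ⟨M', hM'⟩ := hg.bdd
  exact ⟨hf.meas.sub hg.meas, hf.int.sub hg.int, M + M', fun x =>
    (norm_sub_le _ _).trans (add_le_add (hM x) (hM' x))⟩

theorem Adm.mul (hf : Adm f) (hg : Adm g) : Adm fun x => f x * g x := by
  obtain ⟨M, hM⟩ := hf.bdd
  obtain ⟨M', hM'⟩ := hg.bdd
  refine ⟨hf.meas.mul hg.meas, hg.int.bdd_mul (c := M) hf.meas.aestronglyMeasurable
    (Filter.Eventually.of_forall hM), M * M', fun x => ?_⟩
  rw [norm_mul]
  exact mul_le_mul (hM x) (hM' x) (norm_nonneg _) ((norm_nonneg _).trans (hM x))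

theorem Adm.const_mul (hf : Adm f) (c : ℂ) : Adm fun x => c * f x := by
  obtain ⟨M, hM⟩ := hf.bdd
  refine ⟨hf.meas.const_mul c, hf.int.const_mul c, ‖c‖ * M, fun x => ?_⟩
  rw [norm_mul]
  gcongr
  exact hM x

theorem Adm.indicator (hf : Adm f) {s : Set ℝ} (hs : MeasurableSet s) : Adm (s.indicator f) := by
  obtain ⟨M, hM⟩ := hf.bdd
  exact ⟨hf.meas.indicator hs, hf.int.indicator hs, M, fun x =>
    (norm_indicator_le_norm_self _ _).trans (hM x)⟩

theorem Adm.conj (hf : Adm f) : Adm fun x => starRingEnd ℂ (f x) := by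
  obtain ⟨M, hM⟩ := hf.bdd
  exact ⟨Complex.continuous_conj.measurable.comp hf.meas,
    hf.int.mono (Complex.continuous_conj.measurable.comp hf.meas).aestronglyMeasurable
      (Filter.Eventually.of_forall fun x => by simp), M, fun x => by simpa using hM x⟩

theorem Adm.sum {ι : Type*} {s : Finset ι} {f : ι → ℝ → ℂ} (hf : ∀ i ∈ s, Adm (f i)) :
    Adm fun x => ∑ i ∈ s, f i x := by
  classical
  induction s using Finset.induction_on with
  | empty => exact ⟨by simp, by simp, 0, by simp⟩
  | insert a s ha ih =>
    simp only [Finset.sum_insert ha]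
    exact (hf a (Finset.mem_insert_self _ _)).add
      (ih fun i hi => hf i (Finset.mem_insert_of_mem hi))

theorem Bump.integrable_mul_dil (hη : Bump C η) (k : ℤ) (hf : Adm f) (x : ℝ) :
    Integrable fun t => f t * dil η k (x - t) := by
  refine hf.int.mul_bdd (c := C * 2 ^ k) ?_
    (Filter.Eventually.of_forall fun t => hη.norm_dil_le_const k _)
  exact ((hη.continuous_dil k).comp (by fun_prop)).aestronglyMeasurable

theorem Bump.continuous_conv (hη : Bump C η) (k : ℤ) (hf : Adm f) :
    Continuous (conv f (dil η k)) := by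
  have := BddAbove.continuous_convolution_right_of_integrable (μ := volume)
    (ContinuousLinearMap.mul ℝ ℂ) (f := f) (g := dil η k)
    ⟨C * 2 ^ k, by rintro _ ⟨x, rfl⟩; exact hη.norm_dil_le_const k x⟩ hf.int (hη.continuous_dil k)
  exact this

theorem Bump.norm_conv_le (hη : Bump C η) (k : ℤ) (f : ℝ → ℂ) (u x : ℝ) :
    ‖conv f (dil η k) u‖ₑ ≤
      C * ENNReal.ofReal (growth k (x - u)) ^ 2 * wavg k (fun t => ‖f t‖ₑ) x := by
  refine (enorm_integral_le_lintegral_enorm _).trans ?_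
  unfold wavg
  rw [← lintegral_const_mul' _ _ (by finiteness)]
  refine lintegral_mono fun t => ?_
  rw [enorm_mul, mul_comm ‖f t‖ₑ, ← mul_assoc]
  gcongr
  rw [← ENNReal.ofReal_coe_nnreal, ← ENNReal.ofReal_pow (growth_pos _ _).le,
    ← ENNReal.ofReal_mul (by positivity), ← ENNReal.ofReal_mul (by positivity), ← ofReal_norm]
  refine ENNReal.ofReal_le_ofReal ((hη.norm_dil_le_wt k _).trans ?_)
  rw [mul_assoc]
  gcongr
  exact wt_le_growth_mul k x u t

theorem Bump.adm_conv (hη : Bump C η) (k : ℤ) (hf : Adm f) : Adm (conv f (dil η k)) := by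
  refine ⟨(hη.continuous_conv k hf).measurable,
    (hf.int.integrable_convolution (ContinuousLinearMap.mul ℝ ℂ) (hη.integrable_dil k)),
    (∫ t, ‖f t‖) * (C * 2 ^ k), fun x => ?_⟩
  refine (norm_integral_le_integral_norm _).trans ?_
  rw [← integral_mul_const]
  refine integral_mono (hη.integrable_mul_dil k hf x).norm (hf.int.norm.mul_const _) fun t => ?_
  simp only [norm_mul]
  gcongr
  exact hη.norm_dil_le_const k _

theorem Bump.conv_add (hη : Bump C η) (k : ℤ) (hf : Adm f) (hg : Adm g) (x : ℝ) :
    conv (fun t => f t + g t) (dil η k) x = conv f (dil η k) x + conv g (dil η k) x := by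
  unfold conv
  rw [← integral_add (hη.integrable_mul_dil k hf x) (hη.integrable_mul_dil k hg x)]
  simp [add_mul]

theorem conv_const_mul (c : ℂ) (f u : ℝ → ℂ) (x : ℝ) :
    conv (fun t => c * f t) u x = c * conv f u x := by
  unfold conv
  rw [← integral_const_mul]
  simp [mul_assoc]

/-- Two-point bound for a function `U` which is small near `x` and near `y` at scale `2 ^ (-k)`. -/
theorem Bump.norm_conv_le_of_growth (hη : Bump C η) (k : ℤ) {U : ℝ → ℂ} {x : ℝ} {a : ℝ≥0∞}
    (hU : ∀ u, ‖U u‖ₑ ≤ ENNReal.ofReal (growth k (x - u)) ^ 4 * a) :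
    ‖conv U (dil η k) x‖ₑ ≤ 16 * C * a := by
  refine (enorm_integral_le_lintegral_enorm _).trans ?_
  calc ∫⁻ t, ‖U t * dil η k (x - t)‖ₑ ≤ ∫⁻ t, ENNReal.ofReal (wt k (x - t)) * (C * a) := by
        refine lintegral_mono fun t => ?_
        rw [enorm_mul]
        refine (mul_le_mul' (hU t) le_rfl).trans ?_
        rw [mul_right_comm, ← mul_assoc]
        refine mul_le_mul' ?_ le_rfl
        rw [← ENNReal.ofReal_coe_nnreal, ← ENNReal.ofReal_pow (growth_pos _ _).le,
          ← ENNReal.ofReal_mul (wt_pos _ _).le, ← ofReal_norm,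
          ← ENNReal.ofReal_mul (pow_nonneg (growth_pos _ _).le _)]
        refine ENNReal.ofReal_le_ofReal ?_
        refine (mul_le_mul_of_nonneg_left (hη.norm_dil_le k _)
          (pow_nonneg (growth_pos _ _).le _)).trans (le_of_eq ?_)
        rw [wt_eq]
        have := (growth_pos k (x - t)).ne'
        field_simp
    _ = (∫⁻ t, ENNReal.ofReal (wt k (x - t))) * (C * a) :=
        lintegral_mul_const _ (measurable_ofReal_wt k x)
    _ ≤ 16 * (C * a) := by gcongr; exact lintegral_wt_le k x
    _ = _ := by ring

theorem Bump.norm_conv_sub_le_of_growth (hη : Bump C η) (k : ℤ) {U : ℝ → ℂ} (hUa : Adm U)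
    {x y : ℝ} {a : ℝ≥0∞}
    (hU : ∀ u, ‖U u‖ₑ ≤ ENNReal.ofReal (growth k (x - u)) ^ 4 * a)
    (hU' : ∀ u, ‖U u‖ₑ ≤ ENNReal.ofReal (growth k (y - u)) ^ 4 * a) :
    ‖conv U (dil η k) x - conv U (dil η k) y‖ₑ ≤
      32 * C * ENNReal.ofReal (2 ^ k * |x - y|) * a := by
  unfold conv
  rw [← integral_sub (hη.integrable_mul_dil k hUa x) (hη.integrable_mul_dil k hUa y)]
  refine (enorm_integral_le_lintegral_enorm _).trans ?_
  have key : ∀ z t, (∀ u, ‖U u‖ₑ ≤ ENNReal.ofReal (growth k (z - u)) ^ 4 * a) →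
      ‖U t‖ₑ * ENNReal.ofReal (2 ^ k / growth k (z - t) ^ 6) ≤
        ENNReal.ofReal (wt k (z - t)) * a := by
    intro z t hz
    refine (mul_le_mul' (hz t) le_rfl).trans (le_of_eq ?_)
    rw [mul_right_comm]
    congr 1
    rw [← ENNReal.ofReal_pow (growth_pos _ _).le,
      ← ENNReal.ofReal_mul (pow_nonneg (growth_pos _ _).le _), wt_eq]
    congr 1
    have := (growth_pos k (z - t)).ne'
    field_simp
  calc _ ≤ ∫⁻ t, C * ENNReal.ofReal (2 ^ k * |x - y|) *
        (ENNReal.ofReal (wt k (x - t)) * a + ENNReal.ofReal (wt k (y - t)) * a) := by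
        refine lintegral_mono fun t => ?_
        rw [← mul_sub, enorm_mul]
        have h1 : ‖dil η k (x - t) - dil η k (y - t)‖ₑ ≤ C * ENNReal.ofReal (2 ^ k * |x - y|) *
            (ENNReal.ofReal (2 ^ k / growth k (x - t) ^ 6) +
              ENNReal.ofReal (2 ^ k / growth k (y - t) ^ 6)) := by
          have p1 := growth_pos k (x - t)
          have p2 := growth_pos k (y - t)
          rw [← ENNReal.ofReal_add (by positivity) (by positivity), ← ENNReal.ofReal_coe_nnreal,
            ← ENNReal.ofReal_mul (by positivity), ← ENNReal.ofReal_mul (by positivity),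
            ← ofReal_norm]
          refine ENNReal.ofReal_le_ofReal ((hη.norm_dil_sub_le k _ _).trans_eq ?_)
          rw [sub_sub_sub_cancel_right]
        calc _ ≤ ‖U t‖ₑ * _ := mul_le_mul' le_rfl h1
          _ = C * ENNReal.ofReal (2 ^ k * |x - y|) *
            (‖U t‖ₑ * ENNReal.ofReal (2 ^ k / growth k (x - t) ^ 6) +
              ‖U t‖ₑ * ENNReal.ofReal (2 ^ k / growth k (y - t) ^ 6)) := by ring
          _ ≤ _ := by
            exact mul_le_mul' le_rfl (add_le_add (key x t hU) (key y t hU'))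
    _ ≤ C * ENNReal.ofReal (2 ^ k * |x - y|) * (16 * a + 16 * a) := by
        rw [lintegral_const_mul' _ _ (by finiteness),
          lintegral_add_left ((measurable_ofReal_wt k x).mul_const _),
          lintegral_mul_const _ (measurable_ofReal_wt k x),
          lintegral_mul_const _ (measurable_ofReal_wt k y)]
        gcongr
        · exact lintegral_wt_le k x
        · exact lintegral_wt_le k y
    _ = _ := by ring

end Bumps

/-- A single frequency-localized piece of a paraproduct. -/
noncomputable def tripiece (η₁ η₂ η₃ : ℝ → ℂ) (k : ℤ) (f g : ℝ → ℂ) : ℝ → ℂ :=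
  conv (fun y => conv f (dil η₁ k) y * conv g (dil η₂ k) y) (dil η₃ k)

/-- A truncated paraproduct built from three bump functions. -/
noncomputable def tripara (η₁ η₂ η₃ : ℝ → ℂ) (Λ : Finset ℤ) (f g : ℝ → ℂ) (x : ℝ) : ℂ :=
  ∑ k ∈ Λ, tripiece η₁ η₂ η₃ k f g x

section LTwo

variable {C C₁ C₂ C₃ : ℝ≥0} {η η₁ η₂ η₃ : ℝ → ℂ} {u v f g : ℝ → ℂ}

theorem Bump.comp_neg (hη : Bump C η) : Bump C fun x => η (-x) := by
  refine ⟨hη.cont.comp continuous_neg, fun x => by simpa using hη.bound (-x), fun x y => ?_⟩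
  have := hη.lip (-x) (-y)
  rwa [abs_neg, abs_neg, ← neg_sub', abs_neg] at this

theorem dil_comp_neg (η : ℝ → ℂ) (k : ℤ) (x : ℝ) : dil (fun x => η (-x)) k x = dil η k (-x) := by
  simp [dil]

theorem integral_dil (η : ℝ → ℂ) (k : ℤ) : ∫ x, dil η k x = ∫ x, η x := by
  unfold dil
  rw [integral_const_mul, Measure.integral_comp_mul_left, abs_of_pos (by positivity),
    Complex.real_smul, ← mul_assoc]
  push_cast
  rw [mul_inv_cancel₀ (zpow_ne_zero _ two_ne_zero), one_mul]

theorem Bump.integral_mul_conv (hη : Bump C η) (k : ℤ) (hu : Adm u) (hv : Adm v) :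
    ∫ x, v x * conv u (dil η k) x = ∫ x, u x * conv v (dil (fun x => η (-x)) k) x := by
  have hInt : Integrable (Function.uncurry fun x t => v x * (u t * dil η k (x - t)))
      (volume.prod volume) := by
    have h := hu.int.convolution_integrand (ContinuousLinearMap.mul ℝ ℂ) (hη.integrable_dil k)
    obtain ⟨M, hM⟩ := hv.bdd
    exact h.bdd_mul (c := M) (hv.meas.comp measurable_fst).aestronglyMeasurable
      (Filter.Eventually.of_forall fun p => hM p.1)
  calc ∫ x, v x * conv u (dil η k) x = ∫ x, ∫ t, v x * (u t * dil η k (x - t)) := by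
        simp only [conv, integral_const_mul]
    _ = ∫ t, ∫ x, v x * (u t * dil η k (x - t)) := integral_integral_swap hInt
    _ = _ := by
        refine integral_congr_ae (Filter.Eventually.of_forall fun t => ?_)
        simp only [conv]
        rw [← integral_const_mul]
        refine integral_congr_ae (Filter.Eventually.of_forall fun x => ?_)
        simp only [dil_comp_neg, neg_sub]
        ring

theorem Adm.lintegral_sq_ne_top (hu : Adm u) : ∫⁻ x, ‖u x‖ₑ ^ 2 ≠ ∞ := by
  obtain ⟨M, hM⟩ := hu.bdd
  have h : ∀ x, ‖u x‖ₑ ^ 2 ≤ ENNReal.ofReal M * ‖u x‖ₑ := fun x => by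
    rw [sq]
    gcongr
    rw [← ofReal_norm]
    exact ENNReal.ofReal_le_ofReal (hM x)
  refine ((lintegral_mono h).trans_lt ?_).ne
  rw [lintegral_const_mul' _ _ (by finiteness)]
  exact ENNReal.mul_lt_top (by simp) hu.int.2

theorem Adm.lintegral_sq_le (hu : Adm u) :
    ∫⁻ x, ‖u x‖ₑ ^ 2 ≤ ‖∫ x, u x * starRingEnd ℂ (u x)‖ₑ := by
  have e : ∀ x, u x * starRingEnd ℂ (u x) = ((‖u x‖ ^ 2 : ℝ) : ℂ) := fun x => by
    rw [Complex.mul_conj, Complex.normSq_eq_norm_sq]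
  simp only [e]
  rw [integral_complex_ofReal, ← ofReal_norm, Complex.norm_real,
    Real.norm_of_nonneg (integral_nonneg fun x => by positivity),
    ofReal_integral_eq_lintegral_ofReal]
  · refine lintegral_mono fun x => ?_
    rw [ENNReal.ofReal_pow (norm_nonneg _), ofReal_norm]
  · have := (hu.mul hu.conj).int.norm
    refine this.congr (Filter.Eventually.of_forall fun x => ?_)
    simp [e, sq]
  · exact Filter.Eventually.of_forall fun x => by positivity

theorem Bump.norm_conv_sub_le (hη : Bump C η) (k : ℤ) (hu : Adm u) (x y : ℝ) :
    ‖conv u (dil η k) x - conv u (dil η k) y‖ₑ ≤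
      2 * C * ENNReal.ofReal (2 ^ k * |x - y|) * ENNReal.ofReal (growth k (y - x)) ^ 2 *
        wavg k (fun t => ‖u t‖ₑ) y := by
  unfold conv
  rw [← integral_sub (hη.integrable_mul_dil k hu x) (hη.integrable_mul_dil k hu y)]
  refine (enorm_integral_le_lintegral_enorm _).trans ?_
  unfold wavg
  rw [← lintegral_const_mul' _ _ (by finiteness)]
  refine lintegral_mono fun t => ?_
  rw [← mul_sub, enorm_mul, mul_comm ‖u t‖ₑ, ← mul_assoc]
  refine mul_le_mul' ?_ le_rfl
  rw [← ENNReal.ofReal_coe_nnreal, ← ENNReal.ofReal_pow (growth_pos _ _).le,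
    show (2 : ℝ≥0∞) = ENNReal.ofReal 2 by norm_num, ← ENNReal.ofReal_mul (by positivity),
    ← ENNReal.ofReal_mul (by positivity), ← ENNReal.ofReal_mul (by positivity),
    ← ENNReal.ofReal_mul (mul_nonneg (by positivity) (sq_nonneg _)), ← ofReal_norm]
  refine ENNReal.ofReal_le_ofReal ((hη.norm_dil_sub_le_wt k _ _).trans ?_)
  have h1 := wt_le_growth_mul k y x t
  have h2 : wt k (y - t) ≤ growth k (y - x) ^ 2 * wt k (y - t) :=
    le_mul_of_one_le_left (wt_pos _ _).le (one_le_pow₀ (one_le_growth _ _))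
  have h3 : 0 ≤ C * (2 ^ k * |x - y|) := by positivity
  rw [sub_sub_sub_cancel_right]
  nlinarith [mul_le_mul_of_nonneg_left (add_le_add h1 h2) h3]

theorem Bump.norm_conv_conv_le (hη : Bump C η) (h0 : ∫ x, η x = 0) {j k : ℤ} (hkj : k ≤ j)
    {w : ℝ → ℂ} (hw : Adm w) {b : ℝ} {a : ℝ≥0∞}
    (h : ∀ x, ‖w x - w b‖ₑ ≤ ENNReal.ofReal (2 ^ k * |x - b|) *
      ENNReal.ofReal (growth k (b - x)) ^ 2 * a) :
    ‖conv w (dil η j) b‖ₑ ≤ 16 * C * ENNReal.ofReal ((2 : ℝ) ^ (k - j)) * a := by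
  have e : conv w (dil η j) b = ∫ t, (w t - w b) * dil η j (b - t) := by
    have h1 : ∫ t, w b * dil η j (b - t) = 0 := by
      rw [integral_const_mul, integral_sub_left_eq_self (dil η j) volume b, integral_dil, h0,
          mul_zero]
    have h2 : Integrable fun t => w b * dil η j (b - t) :=
      ((hη.integrable_dil j).comp_sub_left b).const_mul _
    rw [conv, ← sub_zero (∫ t, w t * dil η j (b - t)), ← h1,
      ← integral_sub (hη.integrable_mul_dil j hw b) h2]
    simp only [sub_mul]
  rw [e]
  refine (enorm_integral_le_lintegral_enorm _).trans ?_
  calc _ ≤ ∫⁻ t, C * ENNReal.ofReal ((2 : ℝ) ^ (k - j)) * a * ENNReal.ofReal (wt j (b - t)) := by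
        refine lintegral_mono fun t => ?_
        rw [enorm_mul]
        refine (mul_le_mul' (h t) le_rfl).trans ?_
        rw [mul_right_comm, mul_right_comm _ a]
        refine mul_le_mul' ?_ le_rfl
        rw [← ENNReal.ofReal_coe_nnreal, ← ENNReal.ofReal_pow (growth_pos _ _).le,
          ← ENNReal.ofReal_mul (by positivity), ← ENNReal.ofReal_mul (by positivity),
          ← ENNReal.ofReal_mul (by positivity), ← ofReal_norm,
          ← ENNReal.ofReal_mul (mul_nonneg (by positivity) (sq_nonneg _))]
        refine ENNReal.ofReal_le_ofReal ?_
        have p1 := growth_pos j (b - t)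
        have p2 := growth_pos k (b - t)
        have h1 : growth k (b - t) ≤ growth j (b - t) := growth_mono_left hkj _
        have h2 : 2 ^ k * |t - b| ≤ 2 ^ (k - j) * growth j (b - t) := by
          unfold growth
          rw [zpow_sub₀ (by norm_num), abs_sub_comm, mul_add]
          have : (2 : ℝ) ^ k / 2 ^ j * (2 ^ j * |b - t|) = 2 ^ k * |b - t| := by field_simp
          rw [this]
          have : (0 : ℝ) ≤ 2 ^ k / 2 ^ j * 1 := by positivity
          linarith
        have h3 : growth j (b - t) ^ 3 ≤ growth j (b - t) ^ 4 :=
          pow_le_pow_right₀ (one_le_growth _ _) (by norm_num)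
        calc _ ≤ (2 ^ (k - j) * growth j (b - t)) * growth j (b - t) ^ 2 *
              (C * (2 ^ j / growth j (b - t) ^ 6)) := by
              gcongr
              exact hη.norm_dil_le j _
          _ = C * 2 ^ (k - j) * (2 ^ j / growth j (b - t) ^ 6 * growth j (b - t) ^ 3) := by ring
          _ ≤ C * 2 ^ (k - j) * (2 ^ j / growth j (b - t) ^ 6 * growth j (b - t) ^ 4) := by gcongr
          _ = _ := by
              rw [wt_eq]
              field_simp
    _ = C * ENNReal.ofReal ((2 : ℝ) ^ (k - j)) * a * ∫⁻ t, ENNReal.ofReal (wt j (b - t)) :=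
        lintegral_const_mul _ (measurable_ofReal_wt j b)
    _ ≤ C * ENNReal.ofReal ((2 : ℝ) ^ (k - j)) * a * 16 := by
        gcongr; exact lintegral_wt_le j b
    _ = _ := by ring

theorem lintegral_mul_wavg_le (k : ℤ) {F G : ℝ → ℝ≥0∞} (hF : Measurable F) (hG : Measurable G) :
    ∫⁻ b, F b * wavg k G b ≤ 16 * (∫⁻ b, F b ^ 2) + 16 * ∫⁻ b, G b ^ 2 := by
  have hw : Measurable fun p : ℝ × ℝ => ENNReal.ofReal (wt k (p.1 - p.2)) :=
    ((continuous_wt k).measurable.comp (measurable_fst.sub measurable_snd)).ennreal_ofReal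
  have key : ∀ a b : ℝ≥0∞, a * b ≤ a ^ 2 + b ^ 2 := fun a b => by
    rcases le_total a b with h | h
    · calc a * b ≤ b * b := by gcongr
        _ ≤ _ := by rw [← sq]; exact le_add_self
    · calc a * b ≤ a * a := by gcongr
        _ ≤ _ := by rw [← sq]; exact le_self_add
  calc ∫⁻ b, F b * wavg k G b
      ≤ ∫⁻ b, ((∫⁻ t, ENNReal.ofReal (wt k (b - t)) * F b ^ 2) +
          ∫⁻ t, ENNReal.ofReal (wt k (b - t)) * G t ^ 2) := by
        refine lintegral_mono fun b => ?_
        unfold wavg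
        rw [← lintegral_add_left ((measurable_ofReal_wt k b).mul_const _),
          ← lintegral_const_mul (f := fun t => ENNReal.ofReal (wt k (b - t)) * G t) _
            ((measurable_ofReal_wt k b).mul hG)]
        refine lintegral_mono fun t => ?_
        rw [mul_left_comm, ← mul_add]
        gcongr
        exact key _ _
    _ = (∫⁻ b, ∫⁻ t, ENNReal.ofReal (wt k (b - t)) * F b ^ 2) +
          ∫⁻ b, ∫⁻ t, ENNReal.ofReal (wt k (b - t)) * G t ^ 2 := by
        refine lintegral_add_left ?_ _
        exact Measurable.lintegral_prod_right' (f := fun p : ℝ × ℝ =>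
          ENNReal.ofReal (wt k (p.1 - p.2)) * F p.1 ^ 2)
          (hw.mul ((hF.comp measurable_fst).pow_const 2))
    _ = (∫⁻ b, ∫⁻ t, ENNReal.ofReal (wt k (b - t)) * F b ^ 2) +
          ∫⁻ t, ∫⁻ b, ENNReal.ofReal (wt k (t - b)) * G t ^ 2 := by
        congr 1
        rw [lintegral_lintegral_swap
          (hw.mul ((hG.comp measurable_snd).pow_const 2)).aemeasurable]
        refine lintegral_congr fun t => lintegral_congr fun b => ?_
        rw [← wt_neg, neg_sub]
    _ ≤ _ := by
        have : ∀ H : ℝ → ℝ≥0∞, Measurable H →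
            ∫⁻ b, ∫⁻ t, ENNReal.ofReal (wt k (b - t)) * H b ^ 2 ≤ 16 * ∫⁻ b, H b ^ 2 := by
          intro H hH
          rw [← lintegral_const_mul _ (hH.pow_const 2)]
          refine lintegral_mono fun b => ?_
          rw [lintegral_mul_const _ (measurable_ofReal_wt k b)]
          gcongr
          exact lintegral_wt_le k b
        exact add_le_add (this F hF) (this G hG)

theorem Bump.norm_integral_conv_mul_conv_le (hη : Bump C η) (h0 : ∫ x, η x = 0) {j k : ℤ}
    (hkj : k ≤ j) (hu : Adm u) (hv : Adm v) :
    ‖∫ x, conv u (dil η j) x * starRingEnd ℂ (conv v (dil η k) x)‖ₑ ≤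
      512 * C ^ 2 * ENNReal.ofReal ((2 : ℝ) ^ (k - j)) *
        ((∫⁻ x, ‖u x‖ₑ ^ 2) + ∫⁻ x, ‖v x‖ₑ ^ 2) := by
  have hw := (hη.adm_conv k hv).conj
  have e : ∫ x, conv u (dil η j) x * starRingEnd ℂ (conv v (dil η k) x) =
      ∫ x, u x * conv (fun x => starRingEnd ℂ (conv v (dil η k) x)) (dil (fun x => η (-x)) j) x :=
          by
    rw [← hη.integral_mul_conv j hu hw]
    simp only [mul_comm]
  rw [e]
  refine (enorm_integral_le_lintegral_enorm _).trans ?_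
  have h0' : ∫ x, η (-x) = 0 := by rw [integral_neg_eq_self η volume, h0]
  have hc : ∀ z : ℂ, ‖starRingEnd ℂ z‖ₑ = ‖z‖ₑ := fun z => by
    rw [← ofReal_norm, ← ofReal_norm, RCLike.norm_conj]
  calc _ ≤ ∫⁻ x, 32 * C ^ 2 * ENNReal.ofReal ((2 : ℝ) ^ (k - j)) *
        (‖u x‖ₑ * wavg k (fun t => ‖v t‖ₑ) x) := by
        refine lintegral_mono fun b => ?_
        rw [enorm_mul]
        have := hη.comp_neg.norm_conv_conv_le h0' hkj hw (b := b)
          (a := 2 * C * wavg k (fun t => ‖v t‖ₑ) b) (fun x => by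
            rw [← map_sub, hc]
            exact (hη.norm_conv_sub_le k hv x b).trans_eq (by ring))
        exact (mul_le_mul' le_rfl this).trans_eq (by ring)
    _ = 32 * C ^ 2 * ENNReal.ofReal ((2 : ℝ) ^ (k - j)) *
        ∫⁻ x, (‖u x‖ₑ * wavg k (fun t => ‖v t‖ₑ) x) := lintegral_const_mul' _ _ (by finiteness)
    _ ≤ 32 * C ^ 2 * ENNReal.ofReal ((2 : ℝ) ^ (k - j)) *
        (16 * (∫⁻ x, ‖u x‖ₑ ^ 2) + 16 * ∫⁻ x, ‖v x‖ₑ ^ 2) := by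
        exact mul_le_mul' le_rfl (lintegral_mul_wavg_le k hu.meas.enorm hv.meas.enorm)
    _ = _ := by ring

theorem exists_sum_geometric_le {δ : ℝ} (hδ : 0 < δ) :
    ∃ c : ℝ≥0, ∀ (n : ℤ) (Λ : Finset ℤ),
      ∑ k ∈ Λ, ENNReal.ofReal ((2 : ℝ) ^ (-|k - n|)) ^ δ ≤ c := by
  set r : ℝ := (2⁻¹ : ℝ) ^ δ with hr
  have hr0 : 0 ≤ r := by positivity
  have hr1 : r < 1 := Real.rpow_lt_one (by norm_num) (by norm_num) hδ
  have hg := summable_geometric_of_lt_one hr0 hr1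
  have hs : Summable fun k : ℤ => r ^ k.natAbs :=
    Summable.of_nat_of_neg (by simpa using hg) (by simpa using hg)
  refine ⟨Real.toNNReal (∑' k : ℤ, r ^ k.natAbs), fun n Λ => ?_⟩
  have e : ∀ k : ℤ, ENNReal.ofReal ((2 : ℝ) ^ (-|k - n|)) ^ δ =
      ENNReal.ofReal (r ^ (k - n).natAbs) := fun k => by
    rw [ENNReal.ofReal_rpow_of_nonneg (by positivity) hδ.le, Int.abs_eq_natAbs, zpow_neg,
      zpow_natCast, ← inv_pow, hr, ← Real.rpow_natCast, ← Real.rpow_natCast,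
      ← Real.rpow_mul (by norm_num), ← Real.rpow_mul (by norm_num), mul_comm δ]
  simp only [e]
  rw [← ENNReal.ofReal_sum_of_nonneg fun k _ => by positivity, ENNReal.ofNNReal_toNNReal]
  refine ENNReal.ofReal_le_ofReal ?_
  have h1 := ((Equiv.subRight n).summable_iff (f := fun k : ℤ => r ^ k.natAbs)).2 hs
  have h2 := (Equiv.subRight n).tsum_eq fun k : ℤ => r ^ k.natAbs
  refine (h1.sum_le_tsum Λ fun k _ => by simp only [Function.comp]; positivity).trans ?_
  exact h2.le

theorem Bump.exists_lintegral_sum_conv_sq_le (hη : Bump C η) (h0 : ∫ x, η x = 0) :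
    ∃ K : ℝ≥0, ∀ (Λ : Finset ℤ) (u : ℤ → ℝ → ℂ), (∀ k, Adm (u k)) →
      ∫⁻ x, ‖∑ k ∈ Λ, conv (u k) (dil η k) x‖ₑ ^ 2 ≤ K * ∑ k ∈ Λ, ∫⁻ x, ‖u k x‖ₑ ^ 2 := by
  obtain ⟨c, hc⟩ := exists_sum_geometric_le one_pos
  simp only [ENNReal.rpow_one] at hc
  refine ⟨512 * C ^ 2 * (c + c), fun Λ u hu => ?_⟩
  have hw : ∀ k ∈ Λ, Adm (conv (u k) (dil η k)) := fun k _ => hη.adm_conv k (hu k)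
  have hpair : ∀ j k, ‖∫ x, conv (u j) (dil η j) x * starRingEnd ℂ (conv (u k) (dil η k) x)‖ₑ ≤
      512 * C ^ 2 * ENNReal.ofReal ((2 : ℝ) ^ (-|k - j|)) *
        ((∫⁻ x, ‖u j x‖ₑ ^ 2) + ∫⁻ x, ‖u k x‖ₑ ^ 2) := by
    intro j k
    rcases le_total k j with h | h
    · rw [abs_of_nonpos (by omega), neg_neg]
      exact hη.norm_integral_conv_mul_conv_le h0 h (hu j) (hu k)
    · rw [abs_of_nonneg (by omega), neg_sub, add_comm]
      refine le_trans (le_of_eq ?_) (hη.norm_integral_conv_mul_conv_le h0 h (hu k) (hu j))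
      have : ∀ z : ℂ, ‖starRingEnd ℂ z‖ₑ = ‖z‖ₑ := fun z => by
        rw [← ofReal_norm, ← ofReal_norm, RCLike.norm_conj]
      rw [← this, ← integral_conj]
      simp [mul_comm]
  refine (Adm.sum hw).lintegral_sq_le.trans ?_
  have e : ∫ x, (∑ k ∈ Λ, conv (u k) (dil η k) x) *
      starRingEnd ℂ (∑ k ∈ Λ, conv (u k) (dil η k) x) =
      ∑ j ∈ Λ, ∑ k ∈ Λ, ∫ x, conv (u j) (dil η j) x * starRingEnd ℂ (conv (u k) (dil η k) x) := by
    simp only [map_sum, Finset.sum_mul_sum]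
    rw [integral_finsetSum]
    · refine Finset.sum_congr rfl fun j hj => integral_finsetSum _ fun k hk => ?_
      exact ((hw j hj).mul (hw k hk).conj).int
    · exact fun j hj => integrable_finsetSum _ fun k hk => ((hw j hj).mul (hw k hk).conj).int
  rw [e]
  refine (enorm_sum_le _ _).trans ?_
  set A : ℤ → ℝ≥0∞ := fun k => ∫⁻ x, ‖u k x‖ₑ ^ 2
  calc _ ≤ ∑ j ∈ Λ, ∑ k ∈ Λ, 512 * C ^ 2 * ENNReal.ofReal ((2 : ℝ) ^ (-|k - j|)) * (A j + A k) :=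
        Finset.sum_le_sum fun j _ => (enorm_sum_le _ _).trans
          (Finset.sum_le_sum fun k _ => hpair j k)
    _ = 512 * C ^ 2 * ((∑ j ∈ Λ, ∑ k ∈ Λ, ENNReal.ofReal ((2 : ℝ) ^ (-|k - j|)) * A j) +
        ∑ j ∈ Λ, ∑ k ∈ Λ, ENNReal.ofReal ((2 : ℝ) ^ (-|k - j|)) * A k) := by
        simp only [← Finset.sum_add_distrib, Finset.mul_sum, mul_add, mul_assoc]
    _ ≤ 512 * C ^ 2 * ((∑ j ∈ Λ, c * A j) + ∑ k ∈ Λ, c * A k) := by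
        refine mul_le_mul' le_rfl (add_le_add ?_ ?_)
        · refine Finset.sum_le_sum fun j _ => ?_
          rw [← Finset.sum_mul]
          exact mul_le_mul' (hc _ _) le_rfl
        · rw [Finset.sum_comm]
          refine Finset.sum_le_sum fun j _ => ?_
          rw [← Finset.sum_mul]
          simp only [abs_sub_comm j]
          exact mul_le_mul' (hc _ _) le_rfl
    _ = _ := by
        rw [← Finset.mul_sum]
        push_cast
        ring

theorem Bump.exists_sum_lintegral_conv_sq_le (hη : Bump C η) (h0 : ∫ x, η x = 0) :
    ∃ K : ℝ≥0, ∀ (Λ : Finset ℤ) (g : ℝ → ℂ), Adm g →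
      ∑ k ∈ Λ, ∫⁻ x, ‖conv g (dil η k) x‖ₑ ^ 2 ≤ K * ∫⁻ x, ‖g x‖ₑ ^ 2 := by
  have h0' : ∫ x, η (-x) = 0 := by rw [integral_neg_eq_self η volume, h0]
  obtain ⟨K, hK⟩ := hη.comp_neg.exists_lintegral_sum_conv_sq_le h0'
  refine ⟨2 * (2 * (K + 1)), fun Λ g hg => ?_⟩
  have hv : ∀ k, Adm (conv g (dil η k)) := fun k => hη.adm_conv k hg
  set S := ∑ k ∈ Λ, ∫⁻ x, ‖conv g (dil η k) x‖ₑ ^ 2 with hS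
  have hSfin : S ≠ ∞ := ENNReal.sum_ne_top.2 fun k _ => (hv k).lintegral_sq_ne_top
  have hc : ∀ z : ℂ, ‖starRingEnd ℂ z‖ₑ = ‖z‖ₑ := fun z => by
    rw [← ofReal_norm, ← ofReal_norm, RCLike.norm_conj]
  set G : ℝ → ℂ := fun x => ∑ k ∈ Λ,
    conv (fun x => starRingEnd ℂ (conv g (dil η k) x)) (dil (fun x => η (-x)) k) x with hG
  have hGa : Adm G := Adm.sum fun k _ => hη.comp_neg.adm_conv k (hv k).conj
  have hGS : ∫⁻ x, ‖G x‖ₑ ^ 2 ≤ K * S := by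
    refine (hK Λ _ fun k => (hv k).conj).trans_eq ?_
    simp only [hc, hS]
  have key : ∀ a b : ℝ≥0∞, a * b ≤ (2 * (K + 1)) * a ^ 2 + (2 * (K + 1 : ℝ≥0∞))⁻¹ * b ^ 2 := by
    intro a b
    set L : ℝ≥0∞ := 2 * (K + 1)
    have hL0 : L ≠ 0 := by positivity
    have hLt : L ≠ ∞ := by finiteness
    rcases le_total b (L * a) with h | h
    · calc a * b ≤ a * (L * a) := by gcongr
        _ = L * a ^ 2 := by ring
        _ ≤ _ := le_self_add
    · calc a * b = L⁻¹ * (L * a) * b := by rw [← mul_assoc, ENNReal.inv_mul_cancel hL0 hLt, one_mul]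
        _ ≤ L⁻¹ * b * b := by gcongr
        _ = L⁻¹ * b ^ 2 := by ring
        _ ≤ _ := le_add_self
  have h1 : S ≤ ∫⁻ x, ‖g x‖ₑ * ‖G x‖ₑ := by
    have e1 : ∀ k ∈ Λ, ∫ x, g x *
        conv (fun x => starRingEnd ℂ (conv g (dil η k) x)) (dil (fun x => η (-x)) k) x =
        (((∫⁻ x, ‖conv g (dil η k) x‖ₑ ^ 2).toReal : ℝ) : ℂ) := by
      intro k _
      rw [← hη.integral_mul_conv k hg (hv k).conj]
      have e2 : ∀ x, starRingEnd ℂ (conv g (dil η k) x) * conv g (dil η k) x =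
          ((‖conv g (dil η k) x‖ ^ 2 : ℝ) : ℂ) := fun x => by
        rw [mul_comm, Complex.mul_conj, Complex.normSq_eq_norm_sq]
      simp only [e2]
      rw [integral_complex_ofReal, integral_eq_lintegral_of_nonneg_ae]
      · congr 2
        refine lintegral_congr fun x => ?_
        rw [ENNReal.ofReal_pow (norm_nonneg _), ofReal_norm]
      · exact Filter.Eventually.of_forall fun x => by positivity
      · exact ((hv k).meas.norm.pow_const 2).aestronglyMeasurable
    have e3 : ∫ x, g x * G x = ((S.toReal : ℝ) : ℂ) := by
      simp only [hG, Finset.mul_sum]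
      rw [integral_finsetSum _ fun k _ => (hg.mul (hη.comp_neg.adm_conv k (hv k).conj)).int,
        Finset.sum_congr rfl e1, hS,
        ENNReal.toReal_sum fun k _ => (hv k).lintegral_sq_ne_top, Complex.ofReal_sum]
    calc S = ‖∫ x, g x * G x‖ₑ := by
          rw [e3, ← ofReal_norm, Complex.norm_real, Real.norm_of_nonneg toReal_nonneg,
            ENNReal.ofReal_toReal hSfin]
      _ ≤ ∫⁻ x, ‖g x * G x‖ₑ := enorm_integral_le_lintegral_enorm _
      _ = _ := by simp only [enorm_mul]
  have h2 : S ≤ 2 * (K + 1) * (∫⁻ x, ‖g x‖ₑ ^ 2) + S / 2 := by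
    calc S ≤ ∫⁻ x, (2 * (K + 1)) * ‖g x‖ₑ ^ 2 + (2 * (K + 1 : ℝ≥0∞))⁻¹ * ‖G x‖ₑ ^ 2 :=
          h1.trans (lintegral_mono fun x => key _ _)
      _ = 2 * (K + 1) * (∫⁻ x, ‖g x‖ₑ ^ 2) + (2 * (K + 1 : ℝ≥0∞))⁻¹ * ∫⁻ x, ‖G x‖ₑ ^ 2 := by
          rw [lintegral_add_left ((hg.meas.enorm.pow_const 2).const_mul _),
            lintegral_const_mul _ (hg.meas.enorm.pow_const 2),
            lintegral_const_mul _ (hGa.meas.enorm.pow_const 2)]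
      _ ≤ 2 * (K + 1) * (∫⁻ x, ‖g x‖ₑ ^ 2) + (2 * (K + 1 : ℝ≥0∞))⁻¹ * ((K + 1) * S) := by
          refine add_le_add le_rfl (mul_le_mul' le_rfl (hGS.trans ?_))
          exact mul_le_mul' le_self_add le_rfl
      _ = _ := by
          congr 1
          rw [ENNReal.mul_inv (by simp) (by simp), ← mul_assoc, mul_assoc (2 : ℝ≥0∞)⁻¹,
            ENNReal.inv_mul_cancel (by positivity) (by finiteness), mul_one, mul_comm,
            ENNReal.div_eq_inv_mul, mul_comm]
  have h3 : S / 2 ≤ 2 * (K + 1) * ∫⁻ x, ‖g x‖ₑ ^ 2 := by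
    rw [← ENNReal.add_halves S] at h2
    have hne : S / 2 ≠ ∞ := (ENNReal.div_lt_top hSfin two_ne_zero).ne
    rw [ENNReal.add_halves S] at h2
    nth_rewrite 1 [← ENNReal.add_halves S] at h2
    exact (ENNReal.add_le_add_iff_right hne).1 h2
  calc S = 2 * (S / 2) := (ENNReal.mul_div_cancel two_ne_zero (by simp)).symm
    _ ≤ 2 * (2 * (K + 1) * ∫⁻ x, ‖g x‖ₑ ^ 2) := by gcongr
    _ = _ := by push_cast; ring

/-- The paraproduct maps `L^∞ × L²` to `L²`. -/
theorem exists_tripara_LqNorm_two_le (h₁ : Bump C₁ η₁) (h₂ : Bump C₂ η₂) (h₃ : Bump C₃ η₃)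
    (h₂0 : ∫ x, η₂ x = 0) (h₃0 : ∫ x, η₃ x = 0) :
    ∃ K : ℝ≥0, ∀ (Λ : Finset ℤ) (f g : ℝ → ℂ), Adm f → Adm g →
      LqNorm volume 2 (fun x => ‖tripara η₁ η₂ η₃ Λ f g x‖ₑ) ≤
        K * LqNorm volume ∞ (fun x => ‖f x‖ₑ) * LqNorm volume 2 fun x => ‖g x‖ₑ := by
  obtain ⟨K, hK⟩ := h₃.exists_lintegral_sum_conv_sq_le h₃0
  obtain ⟨K', hK'⟩ := h₂.exists_sum_lintegral_conv_sq_le h₂0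
  refine ⟨NNReal.sqrt (K * K') * (16 * C₁), fun Λ f g hf hg => ?_⟩
  set M := essSup (fun x => ‖f x‖ₑ) volume with hM
  have hfM : ∀ k x, ‖conv f (dil η₁ k) x‖ₑ ≤ C₁ * (16 * M) := fun k x => by
    refine (h₁.norm_conv_le k f x x).trans ?_
    have := wavg_le_of_ae_le (ENNReal.ae_le_essSup fun x => ‖f x‖ₑ) k x
    simpa [growth] using mul_le_mul' (le_refl (C₁ : ℝ≥0∞)) this
  have h1 : ∫⁻ x, ‖tripara η₁ η₂ η₃ Λ f g x‖ₑ ^ 2 ≤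
      K * K' * (C₁ * (16 * M)) ^ 2 * ∫⁻ x, ‖g x‖ₑ ^ 2 := by
    refine (hK Λ _ fun k => (h₁.adm_conv k hf).mul (h₂.adm_conv k hg)).trans ?_
    calc _ ≤ (K : ℝ≥0∞) * ∑ k ∈ Λ, (C₁ * (16 * M)) ^ 2 * ∫⁻ x, ‖conv g (dil η₂ k) x‖ₑ ^ 2 := by
          refine mul_le_mul' le_rfl (Finset.sum_le_sum fun k _ => ?_)
          rw [← lintegral_const_mul _ ((h₂.adm_conv k hg).meas.enorm.pow_const 2)]
          refine lintegral_mono fun x => ?_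
          rw [enorm_mul, mul_pow]
          gcongr
          exact hfM k x
      _ = K * (C₁ * (16 * M)) ^ 2 * ∑ k ∈ Λ, ∫⁻ x, ‖conv g (dil η₂ k) x‖ₑ ^ 2 := by
          rw [← Finset.mul_sum, mul_assoc]
      _ ≤ K * (C₁ * (16 * M)) ^ 2 * (K' * ∫⁻ x, ‖g x‖ₑ ^ 2) := mul_le_mul' le_rfl (hK' Λ g hg)
      _ = _ := by ring
  have e2 : (2 : ℝ≥0∞).toReal = 2 := rfl
  simp only [LqNorm, if_true, if_neg ENNReal.ofNat_ne_top, e2, ENNReal.rpow_two]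
  refine (ENNReal.rpow_le_rpow h1 (by norm_num)).trans (le_of_eq ?_)
  rw [ENNReal.mul_rpow_of_nonneg _ _ (by norm_num), ENNReal.mul_rpow_of_nonneg _ _ (by norm_num),
    ← ENNReal.rpow_two (_ * _), ← ENNReal.rpow_mul]
  congr 1
  rw [← ENNReal.coe_mul, ← ENNReal.coe_rpow_of_nonneg _ (by norm_num), ← NNReal.sqrt_eq_rpow,
    mul_one_div_cancel (by norm_num), ENNReal.rpow_one]
  push_cast
  ring

end LTwo

section ConvBound

variable {C C₁ C₂ C₃ : ℝ≥0} {η η₁ η₂ η₃ : ℝ → ℂ} {t r r₁ r₂ : ℝ≥0∞} {N : ℕ} {k : ℤ} {x : ℝ}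
  {α β : ℝ≥0∞} {f g : ℕ → ℝ → ℂ}

/-- A vector-valued bound for `f ∗ η_k` near `x`, with polynomial growth at scale `2 ^ (-k)`. -/
def ConvBound (t : ℝ≥0∞) (N : ℕ) (η : ℝ → ℂ) (k : ℤ) (x : ℝ) (f : ℕ → ℝ → ℂ) (α : ℝ≥0∞) : Prop :=
  ∃ a : ℕ → ℝ≥0∞,
    (∀ i u, ‖conv (f i) (dil η k) u‖ₑ ≤ ENNReal.ofReal (growth k (x - u)) ^ 2 * a i) ∧
      ellN t N a ≤ α

theorem ConvBound.mono (h : ConvBound t N η k x f α) (hαβ : α ≤ β) : ConvBound t N η k x f β := by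
  obtain ⟨a, ha, ha'⟩ := h
  exact ⟨a, ha, ha'.trans hαβ⟩

theorem Bump.convBound (hη : Bump C η) (ht : 1 ≤ t) (hf : ∀ i, Measurable (f i)) (N : ℕ) (k : ℤ)
    (x : ℝ) : ConvBound t N η k x f (C * wavg k (fun y => ellN t N fun i => ‖f i y‖ₑ) x) := by
  refine ⟨fun i => C * wavg k (fun y => ‖f i y‖ₑ) x, fun i u =>
    (hη.norm_conv_le k (f i) u x).trans_eq (by ring), ?_⟩
  have ht0 : t ≠ 0 := (one_pos.trans_le ht).ne'
  refine (ellN_const_mul_le ht0 (by simp) _).trans (mul_le_mul' le_rfl ?_)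
  unfold wavg
  refine (ellN_lintegral_le ht fun i => (measurable_ofReal_wt k x).mul (hf i).enorm).trans ?_
  exact lintegral_mono fun y => ellN_const_mul_le ht0 (by simp) _

theorem ConvBound.ellN_tripiece_le (h₃ : Bump C₃ η₃) (hr0 : r ≠ 0) (hr : r ≠ ∞)
    (hH : r⁻¹ = r₁⁻¹ + r₂⁻¹) (hf : ConvBound r₁ N η₁ k x f α) (hg : ConvBound r₂ N η₂ k x g β) :
    ellN r N (fun i => ‖tripiece η₁ η₂ η₃ k (f i) (g i) x‖ₑ) ≤ 16 * C₃ * (α * β) := by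
  obtain ⟨a, ha, ha'⟩ := hf
  obtain ⟨b, hb, hb'⟩ := hg
  calc _ ≤ ellN r N (fun i => 16 * C₃ * (a i * b i)) := by
        refine ellN_mono fun i => h₃.norm_conv_le_of_growth k fun u => ?_
        rw [enorm_mul]
        exact (mul_le_mul' (ha i u) (hb i u)).trans_eq (by ring)
    _ ≤ 16 * C₃ * ellN r N (fun i => a i * b i) :=
        ellN_const_mul_le hr0 (by finiteness) _
    _ ≤ _ := mul_le_mul' le_rfl ((ellN_mul_le hr0 hr hH a b).trans (mul_le_mul' ha' hb'))

theorem ConvBound.ellN_tripiece_sub_le (h₁ : Bump C₁ η₁) (h₂ : Bump C₂ η₂) (h₃ : Bump C₃ η₃)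
    (hr0 : r ≠ 0) (hr : r ≠ ∞) (hH : r⁻¹ = r₁⁻¹ + r₂⁻¹) (hfa : ∀ i, Adm (f i))
    (hga : ∀ i, Adm (g i)) (hf : ConvBound r₁ N η₁ k x f α) (hg : ConvBound r₂ N η₂ k x g β)
    {y : ℝ} (hxy : |x - y| ≤ (2 : ℝ) ^ (-k)) :
    ellN r N (fun i => ‖tripiece η₁ η₂ η₃ k (f i) (g i) x - tripiece η₁ η₂ η₃ k (f i) (g i) y‖ₑ) ≤
      512 * C₃ * ENNReal.ofReal (2 ^ k * |x - y|) * (α * β) := by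
  obtain ⟨a, ha, ha'⟩ := hf
  obtain ⟨b, hb, hb'⟩ := hg
  calc _ ≤ ellN r N (fun i => 512 * C₃ * ENNReal.ofReal (2 ^ k * |x - y|) * (a i * b i)) := by
        refine ellN_mono fun i => ?_
        have hU : ∀ u, ‖conv (f i) (dil η₁ k) u * conv (g i) (dil η₂ k) u‖ₑ ≤
            ENNReal.ofReal (growth k (x - u)) ^ 4 * (a i * b i) := fun u => by
          rw [enorm_mul]
          exact (mul_le_mul' (ha i u) (hb i u)).trans_eq (by ring)
        refine (h₃.norm_conv_sub_le_of_growth k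
          ((h₁.adm_conv k (hfa i)).mul (h₂.adm_conv k (hga i))) (a := 16 * (a i * b i))
          (fun u => (hU u).trans ?_) fun u => (hU u).trans ?_).trans_eq (by ring)
        · exact mul_le_mul' le_rfl (le_mul_of_one_le_left' (by norm_num))
        · rw [← mul_assoc _ (16 : ℝ≥0∞)]
          refine mul_le_mul' ?_ le_rfl
          have h1 : growth k (x - u) ≤ 2 * growth k (y - u) :=
            (growth_sub_le k x y u).trans
              (mul_le_mul_of_nonneg_right (growth_le_two hxy) (growth_pos _ _).le)
          calc ENNReal.ofReal (growth k (x - u)) ^ 4 ≤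
              ENNReal.ofReal (2 * growth k (y - u)) ^ 4 := by
                gcongr
            _ = _ := by
                rw [ENNReal.ofReal_mul (by norm_num), mul_pow, mul_comm]
                norm_num
    _ ≤ 512 * C₃ * ENNReal.ofReal (2 ^ k * |x - y|) * ellN r N (fun i => a i * b i) :=
        ellN_const_mul_le hr0 (by finiteness) _
    _ ≤ _ := mul_le_mul' le_rfl ((ellN_mul_le hr0 hr hH a b).trans (mul_le_mul' ha' hb'))

end ConvBound

section SelectedAverages

variable {S : Set (ℤ × ℤ)} {u : ℝ → ℂ} {p : ℤ × ℤ} {x : ℝ}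

open Classical in
/-- The function `u` with its values replaced by averages on the selected dyadic intervals. -/
noncomputable def selAvg (S : Set (ℤ × ℤ)) (u : ℝ → ℂ) (x : ℝ) : ℂ :=
  if h : ∃ p ∈ S, x ∈ cell p.1 p.2 then
    (2 : ℂ) ^ h.choose.1 * ∫ t in cell h.choose.1 h.choose.2, u t
  else u x

theorem selAvg_of_mem (hS : S.PairwiseDisjoint fun p => cell p.1 p.2) (u : ℝ → ℂ) (hp : p ∈ S)
    (hx : x ∈ cell p.1 p.2) : selAvg S u x = (2 : ℂ) ^ p.1 * ∫ t in cell p.1 p.2, u t := by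
  have h : ∃ p ∈ S, x ∈ cell p.1 p.2 := ⟨p, hp, hx⟩
  have : h.choose = p := by
    by_contra hne
    exact Set.disjoint_left.1 (hS h.choose_spec.1 hp hne) h.choose_spec.2 hx
  rw [selAvg, dif_pos h, this]

theorem selAvg_of_forall_notMem (u : ℝ → ℂ) (hx : ∀ p ∈ S, x ∉ cell p.1 p.2) :
    selAvg S u x = u x := dif_neg fun ⟨p, hp, hx'⟩ => hx p hp hx'

theorem measurable_selAvg (hS : S.PairwiseDisjoint fun p => cell p.1 p.2) (hu : Measurable u) :
    Measurable (selAvg S u) := by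
  intro A hA
  have e : selAvg S u ⁻¹' A = (u ⁻¹' A ∩ (⋃ p ∈ S, cell p.1 p.2)ᶜ) ∪
      ⋃ p ∈ {p ∈ S | (2 : ℂ) ^ p.1 * (∫ t in cell p.1 p.2, u t) ∈ A}, cell p.1 p.2 := by
    ext x
    by_cases hx : ∃ p ∈ S, x ∈ cell p.1 p.2
    · obtain ⟨p, hp, hxp⟩ := hx
      have h1 : x ∈ ⋃ p ∈ S, cell p.1 p.2 := Set.mem_biUnion hp hxp
      simp only [Set.mem_preimage, selAvg_of_mem hS u hp hxp, Set.mem_union, Set.mem_inter_iff,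
        Set.mem_compl_iff, h1, not_true_eq_false, and_false, false_or]
      refine ⟨fun h => Set.mem_biUnion (show p ∈ {p ∈ S | _} from ⟨hp, h⟩) hxp, fun h => ?_⟩
      simp only [Set.mem_iUnion] at h
      obtain ⟨q, ⟨hq, hqA⟩, hxq⟩ := h
      have : q = p := by
        by_contra hne
        exact Set.disjoint_left.1 (hS hq hp hne) hxq hxp
      exact this ▸ hqA
    · have h1 : x ∉ ⋃ p ∈ S, cell p.1 p.2 := by simpa using hx
      have h2 : x ∉ ⋃ p ∈ {p ∈ S | (2 : ℂ) ^ p.1 * (∫ t in cell p.1 p.2, u t) ∈ A},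
          cell p.1 p.2 := fun h => h1 (Set.biUnion_mono (fun q hq => hq.1) (fun _ _ => le_rfl) h)
      have h3 : selAvg S u x = u x := dif_neg hx
      simp only [Set.mem_preimage, h3, Set.mem_union, Set.mem_inter_iff, Set.mem_compl_iff, h1,
        not_false_eq_true, and_true, h2, or_false]
  rw [e]
  refine ((hu hA).inter (MeasurableSet.biUnion (Set.to_countable _)
    fun p _ => measurableSet_cell _ _).compl).union ?_
  exact MeasurableSet.biUnion (Set.to_countable _) fun p _ => measurableSet_cell _ _

theorem volume_real_cell (n j : ℤ) : volume.real (cell n j) = (2 : ℝ) ^ (-n) := by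
  rw [Measure.real, volume_cell, ENNReal.toReal_ofReal (by positivity)]

theorem norm_selAvg_le (hS : S.PairwiseDisjoint fun p => cell p.1 p.2) {M : ℝ}
    (hM : ∀ x, ‖u x‖ ≤ M) (x : ℝ) : ‖selAvg S u x‖ ≤ M := by
  by_cases hx : ∃ p ∈ S, x ∈ cell p.1 p.2
  · obtain ⟨p, hp, hxp⟩ := hx
    rw [selAvg_of_mem hS u hp hxp, norm_mul, norm_zpow, Complex.norm_ofNat]
    have h1 := norm_setIntegral_le_of_norm_le_const (μ := volume) (s := cell p.1 p.2) (f := u)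
      (C := M) (by simp [volume_cell]) fun x _ => hM x
    rw [volume_real_cell] at h1
    calc (2 : ℝ) ^ p.1 * _ ≤ 2 ^ p.1 * (M * 2 ^ (-p.1)) := by gcongr
      _ = M * (2 ^ p.1 * 2 ^ (-p.1)) := by ring
      _ = M := by rw [← zpow_add₀ (by norm_num)]; simp
  · rw [selAvg, dif_neg hx]
    exact hM x

theorem setIntegral_sub_selAvg (hS : S.PairwiseDisjoint fun p => cell p.1 p.2)
    (hu : Integrable u) (hp : p ∈ S) :
    ∫ t in cell p.1 p.2, (u t - selAvg S u t) = 0 := by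
  have e : ∀ t ∈ cell p.1 p.2, u t - selAvg S u t =
      u t - (2 : ℂ) ^ p.1 * ∫ t in cell p.1 p.2, u t :=
    fun t ht => by rw [selAvg_of_mem hS u hp ht]
  rw [setIntegral_congr_fun (measurableSet_cell _ _) e,
    integral_sub hu.integrableOn (integrableOn_const (by simp [volume_cell])),
    setIntegral_const, volume_real_cell, Complex.real_smul, ← mul_assoc]
  push_cast
  rw [← zpow_add₀ two_ne_zero]
  simp

theorem enorm_selAvg_le (hS : S.PairwiseDisjoint fun p => cell p.1 p.2) (hp : p ∈ S)
    (hx : x ∈ cell p.1 p.2) :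
    ‖selAvg S u x‖ₑ ≤ ENNReal.ofReal (2 ^ p.1) * ∫⁻ t in cell p.1 p.2, ‖u t‖ₑ := by
  rw [selAvg_of_mem hS u hp hx, enorm_mul]
  refine mul_le_mul' (le_of_eq ?_) (enorm_integral_le_lintegral_enorm _)
  rw [← ofReal_norm, norm_zpow, Complex.norm_ofNat]

theorem setLIntegral_sub_selAvg_le (hS : S.PairwiseDisjoint fun p => cell p.1 p.2)
    (hu : Measurable u) (hp : p ∈ S) :
    ∫⁻ t in cell p.1 p.2, ‖u t - selAvg S u t‖ₑ ≤ 2 * ∫⁻ t in cell p.1 p.2, ‖u t‖ₑ := by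
  calc _ ≤ ∫⁻ t in cell p.1 p.2, (‖u t‖ₑ +
        ENNReal.ofReal (2 ^ p.1) * ∫⁻ t in cell p.1 p.2, ‖u t‖ₑ) :=
        setLIntegral_mono' (measurableSet_cell _ _) fun t ht =>
          enorm_sub_le.trans (add_le_add le_rfl (enorm_selAvg_le hS hp ht))
    _ = _ := by
        rw [lintegral_add_left hu.enorm, setLIntegral_const, volume_cell, mul_right_comm,
          ← ENNReal.ofReal_mul (by positivity), ← zpow_add₀ (by norm_num)]
        simp [two_mul]

theorem ellN_selAvg_le {t : ℝ≥0∞} (ht : 1 ≤ t) {N : ℕ} {u : ℕ → ℝ → ℂ}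
    (hS : S.PairwiseDisjoint fun p => cell p.1 p.2) (hu : ∀ i, Measurable (u i)) (hp : p ∈ S)
    (hx : x ∈ cell p.1 p.2) :
    ellN t N (fun i => ‖selAvg S (u i) x‖ₑ) ≤
      ENNReal.ofReal (2 ^ p.1) * ∫⁻ y in cell p.1 p.2, ellN t N fun i => ‖u i y‖ₑ := by
  have ht0 : t ≠ 0 := (one_pos.trans_le ht).ne'
  refine (ellN_mono fun i => enorm_selAvg_le hS hp hx).trans ?_
  refine (ellN_const_mul_le ht0 (by simp) _).trans (mul_le_mul' le_rfl ?_)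
  exact ellN_lintegral_le ht fun i => (hu i).enorm

end SelectedAverages

section BadPart

variable {C : ℝ≥0} {η : ℝ → ℂ} {n j k : ℤ} {x : ℝ}

/-- The size at `z` of the tail of a mean-zero piece living at scale `2 ^ (-n)`, seen at scale
`2 ^ (-k)`. -/
noncomputable def tail (k n : ℤ) (z : ℝ) : ℝ := min 1 ((2 : ℝ) ^ (k - n)) * wt k z

theorem tail_pos (k n : ℤ) (z : ℝ) : 0 < tail k n z :=
  mul_pos (lt_min one_pos (by positivity)) (wt_pos k z)

theorem continuous_tail (k n : ℤ) : Continuous (tail k n) :=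
  continuous_const.mul (continuous_wt k)

theorem left_mem_cell (n j : ℤ) : (2 : ℝ) ^ (-n) * j ∈ cell n j := by
  rw [cell_eq_Ico]
  refine ⟨le_rfl, ?_⟩
  gcongr
  exact lt_add_one _

theorem wt_le_of_abs_le {c t : ℝ} (h : |x - c| ≤ 2 * |x - t|) (k : ℤ) :
    wt k (x - t) ≤ 4 * wt k (x - c) := by
  have h1 : growth k (x - c) ≤ 2 * growth k (x - t) := by
    unfold growth
    have : (2 : ℝ) ^ k * |x - c| ≤ 2 ^ k * (2 * |x - t|) := by gcongr
    linarith
  have p1 := growth_pos k (x - c)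
  have p2 := growth_pos k (x - t)
  rw [wt_eq, wt_eq, ← mul_div_assoc, div_le_div_iff₀ (by positivity) (by positivity)]
  calc (2 : ℝ) ^ k * growth k (x - c) ^ 2 ≤ 2 ^ k * (2 * growth k (x - t)) ^ 2 := by gcongr
    _ = _ := by ring

theorem Bump.norm_setIntegral_mul_dil_le (hη : Bump C η) {b : ℝ → ℂ} (hb : Adm b)
    (h0 : ∫ t in cell n j, b t = 0) (hx : ∀ t ∈ cell n j, (2 : ℝ) ^ (-n) ≤ |x - t|) (k : ℤ)
    (y : ℝ) :
    ‖∫ t in cell n j, b t * dil η k (y - t)‖ₑ ≤ 5 * C * ENNReal.ofReal (growth k (x - y)) ^ 2 *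
      ENNReal.ofReal (tail k n (x - (2 : ℝ) ^ (-n) * j)) * ∫⁻ t in cell n j, ‖b t‖ₑ := by
  set c := (2 : ℝ) ^ (-n) * j with hc
  have hcm : c ∈ cell n j := left_mem_cell n j
  have hw : ∀ t ∈ cell n j, wt k (x - t) ≤ 4 * wt k (x - c) := fun t ht => by
    refine wt_le_of_abs_le ?_ k
    have h1 := dist_lt_of_mem_cell ht hcm
    have h2 := hx t ht
    have h3 := abs_sub_le x t c
    linarith
  have hg : ∀ t ∈ cell n j, wt k (y - t) ≤ 4 * (growth k (x - y) ^ 2 * wt k (x - c)) :=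
    fun t ht => (wt_le_growth_mul k x y t).trans (by
      have := mul_le_mul_of_nonneg_left (hw t ht) (sq_nonneg (growth k (x - y)))
      linarith)
  have key : ∀ κ : ℝ, 0 ≤ κ → ∀ v : ℝ → ℂ,
      (∫ t in cell n j, b t * dil η k (y - t)) = ∫ t in cell n j, b t * v t →
      (∀ t ∈ cell n j, ‖v t‖ ≤ 5 * C * growth k (x - y) ^ 2 * (κ * wt k (x - c))) →
      ‖∫ t in cell n j, b t * dil η k (y - t)‖ₑ ≤ 5 * C * ENNReal.ofReal (growth k (x - y)) ^ 2 *
        ENNReal.ofReal (κ * wt k (x - c)) * ∫⁻ t in cell n j, ‖b t‖ₑ := by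
    intro κ hκ v hv hvle
    rw [hv]
    refine (enorm_integral_le_lintegral_enorm _).trans ?_
    rw [← lintegral_const_mul' _ _ (by finiteness)]
    refine setLIntegral_mono' (measurableSet_cell n j) fun t ht => ?_
    rw [enorm_mul, mul_comm]
    refine mul_le_mul' ?_ le_rfl
    rw [← ofReal_norm, ← ENNReal.ofReal_coe_nnreal, ← ENNReal.ofReal_pow (growth_pos _ _).le,
      show (5 : ℝ≥0∞) = ENNReal.ofReal 5 by norm_num, ← ENNReal.ofReal_mul (by positivity),
      ← ENNReal.ofReal_mul (by positivity), ← ENNReal.ofReal_mul (by positivity)]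
    exact ENNReal.ofReal_le_ofReal (hvle t ht)
  have hC : (0 : ℝ) ≤ C := C.2
  have hgw : 0 ≤ growth k (x - y) ^ 2 * wt k (x - c) := mul_nonneg (sq_nonneg _) (wt_pos _ _).le
  unfold tail
  rcases le_total 1 ((2 : ℝ) ^ (k - n)) with h | h
  · rw [min_eq_left h]
    refine key 1 zero_le_one _ rfl fun t ht => (hη.norm_dil_le_wt k _).trans ?_
    nlinarith [mul_le_mul_of_nonneg_left (hg t ht) hC, mul_nonneg hC hgw]
  · rw [min_eq_right h]
    refine key _ (by positivity) (fun t => dil η k (y - t) - dil η k (y - c)) ?_ fun t ht => ?_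
    · have h1 : ∫ t in cell n j, b t * dil η k (y - c) = 0 := by
        rw [integral_mul_const, h0, zero_mul]
      rw [← sub_zero (∫ t in cell n j, b t * dil η k (y - t)), ← h1, ← integral_sub
        (hη.integrable_mul_dil k hb y).integrableOn (hb.int.mul_const _).integrableOn]
      simp only [mul_sub]
    · refine (hη.norm_dil_sub_le_wt k _ _).trans ?_
      have h1 : 2 ^ k * |y - t - (y - c)| ≤ (2 : ℝ) ^ (k - n) := by
        rw [show y - t - (y - c) = c - t by ring, sub_eq_add_neg k, zpow_add₀ (by norm_num)]
        gcongr
        exact (dist_lt_of_mem_cell hcm ht).le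
      have h2 : wt k (y - t) + wt k (y - c) ≤ 5 * (growth k (x - y) ^ 2 * wt k (x - c)) := by
        have := hg t ht
        have := wt_le_growth_mul k x y c
        linarith
      calc C * (2 ^ k * |y - t - (y - c)|) * (wt k (y - t) + wt k (y - c))
          ≤ C * (2 : ℝ) ^ (k - n) * (5 * (growth k (x - y) ^ 2 * wt k (x - c))) := by
            have := (wt_pos k (y - t)).le
            have := (wt_pos k (y - c)).le
            gcongr
        _ = _ := by ring

theorem Bump.convBound_sub_selAvg (hη : Bump C η) {t : ℝ≥0∞} (ht : 1 ≤ t) (N : ℕ)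
    {S : Set (ℤ × ℤ)} (hS : S.PairwiseDisjoint fun p => cell p.1 p.2) {u : ℕ → ℝ → ℂ}
    (hu : ∀ i, Adm (u i)) (hsu : ∀ i, Adm (selAvg S (u i)))
    (hx : ∀ p ∈ S, ∀ t ∈ cell p.1 p.2, (2 : ℝ) ^ (-p.1) ≤ |x - t|) (k : ℤ) :
    ConvBound t N η k x (fun i y => u i y - selAvg S (u i) y)
      (10 * C * ∑' p : S, ENNReal.ofReal (tail k p.1.1 (x - (2 : ℝ) ^ (-p.1.1) * p.1.2)) *
        ∫⁻ y in cell p.1.1 p.1.2, ellN t N fun i => ‖u i y‖ₑ) := by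
  have ht0 : t ≠ 0 := (one_pos.trans_le ht).ne'
  have hb : ∀ i, Adm fun y => u i y - selAvg S (u i) y := fun i => (hu i).sub (hsu i)
  set T : S → ℝ≥0∞ := fun p => ENNReal.ofReal (tail k p.1.1 (x - (2 : ℝ) ^ (-p.1.1) * p.1.2))
  refine ⟨fun i => 10 * C * ∑' p : S, T p * ∫⁻ y in cell p.1.1 p.1.2, ‖u i y‖ₑ, fun i y => ?_, ?_⟩
  · have hcell : ∀ p : S, ‖∫ t in cell p.1.1 p.1.2, (u i t - selAvg S (u i) t) * dil η k (y - t)‖ₑ ≤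
        ENNReal.ofReal (growth k (x - y)) ^ 2 *
          (10 * C * (T p * ∫⁻ y in cell p.1.1 p.1.2, ‖u i y‖ₑ)) := fun p => by
      refine (hη.norm_setIntegral_mul_dil_le (hb i) (setIntegral_sub_selAvg hS (hu i).int p.2)
        (hx p p.2) k y).trans ?_
      refine (mul_le_mul' le_rfl (setLIntegral_sub_selAvg_le hS (hu i).meas p.2)).trans_eq ?_
      ring
    have e : conv (fun y => u i y - selAvg S (u i) y) (dil η k) y =
        ∑' p : S, ∫ t in cell p.1.1 p.1.2, (u i t - selAvg S (u i) t) * dil η k (y - t) := by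
      rw [← integral_iUnion (fun p : S => measurableSet_cell _ _)
        (fun a b hab => hS a.2 b.2 fun h => hab (Subtype.ext h))
        (hη.integrable_mul_dil k (hb i) y).integrableOn]
      refine (setIntegral_eq_integral_of_forall_compl_eq_zero fun z hz => ?_).symm
      simp only [Set.mem_iUnion, not_exists] at hz
      show (u i z - selAvg S (u i) z) * _ = 0
      rw [selAvg_of_forall_notMem _ fun p hp => hz ⟨p, hp⟩, sub_self, zero_mul]
    rw [e]
    refine enorm_tsum_le_tsum_enorm.trans ((ENNReal.tsum_le_tsum hcell).trans_eq ?_)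
    rw [ENNReal.tsum_mul_left, ENNReal.tsum_mul_left]
  · refine (ellN_const_mul_le ht0 (by finiteness) _).trans (mul_le_mul' le_rfl ?_)
    have hT : ∀ p, T p ≠ ∞ := fun p => ENNReal.ofReal_ne_top
    have e : ∀ F : ℝ → ℝ≥0∞, Measurable F → ∑' p : S, T p * ∫⁻ y in cell p.1.1 p.1.2, F y =
        ∫⁻ y, ∑' p : S, T p * (cell p.1.1 p.1.2).indicator F y := fun F hF => by
      rw [lintegral_tsum fun p =>
        ((hF.indicator (measurableSet_cell _ _)).const_mul _).aemeasurable]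
      refine tsum_congr fun p => ?_
      rw [lintegral_const_mul' _ _ (hT p), lintegral_indicator (measurableSet_cell _ _)]
    have hF : Measurable fun y => ellN t N fun i => ‖u i y‖ₑ :=
      measurable_ellN fun i => (hu i).meas.enorm
    rw [e _ hF, show (fun i => ∑' p : S, T p * ∫⁻ y in cell p.1.1 p.1.2, ‖u i y‖ₑ) = fun i =>
      ∫⁻ y, ∑' p : S, T p * (cell p.1.1 p.1.2).indicator (fun y => ‖u i y‖ₑ) y from
      funext fun i => e _ (hu i).meas.enorm]
    refine (ellN_lintegral_le ht fun i => ?_).trans (lintegral_mono fun y => ?_)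
    · exact Measurable.tsum fun p =>
        ((hu i).meas.enorm.indicator (measurableSet_cell _ _)).const_mul _
    by_cases hy : ∃ p : S, y ∈ cell p.1.1 p.1.2
    · obtain ⟨p, hp⟩ := hy
      have h1 : ∀ F : ℝ → ℝ≥0∞, ∑' p : S, T p * (cell p.1.1 p.1.2).indicator F y = T p * F y :=
        fun F => by
          rw [tsum_eq_single p, Set.indicator_of_mem hp]
          intro q hq
          rw [Set.indicator_of_notMem, mul_zero]
          exact fun hyq => hq (Subtype.ext (hS.elim_set q.2 p.2 y hyq hp))
      simp only [h1]
      exact ellN_const_mul_le ht0 (hT p) _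
    · push Not at hy
      have h1 : ∀ F : ℝ → ℝ≥0∞, ∑' p : S, T p * (cell p.1.1 p.1.2).indicator F y = 0 :=
        fun F => by simp [hy]
      simp only [h1, ellN_zero ht0, le_refl]

end BadPart

section TailIntegral

theorem exists_lintegral_growth_rpow_le {ρ : ℝ} (hρ : 1 / 2 < ρ) :
    ∃ c : ℝ≥0, ∀ (l : ℤ) (x₀ : ℝ),
      ∫⁻ x, ENNReal.ofReal ((growth l (x - x₀) ^ 2)⁻¹) ^ ρ ≤ c * ENNReal.ofReal (2 ^ (-l)) := by
  set G : ℝ → ℝ≥0∞ := fun z => ENNReal.ofReal (((1 + |z|) ^ 2)⁻¹) ^ ρ with hG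
  have hGm : Measurable G := by
    have : Measurable fun z : ℝ => ((1 + |z|) ^ 2)⁻¹ := by fun_prop
    exact (ENNReal.measurable_ofReal.comp this).pow_const ρ
  have hfin : ∫⁻ z, G z < ∞ := by
    have h := finite_integral_one_add_norm (E := ℝ) (μ := volume) (r := 2 * ρ)
      (by simp; linarith)
    refine lt_of_le_of_lt (lintegral_mono fun z => ?_) h
    have h0 : 0 < 1 + |z| := by positivity
    rw [hG]
    simp only [Real.norm_eq_abs]
    rw [ENNReal.ofReal_rpow_of_nonneg (by positivity) (by linarith), ← Real.rpow_natCast,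
      ← Real.rpow_neg h0.le, ← Real.rpow_mul h0.le]
    norm_num
  refine ⟨(∫⁻ z, G z).toNNReal, fun l x₀ => ?_⟩
  rw [ENNReal.coe_toNNReal hfin.ne]
  have h2 : (0 : ℝ) < 2 ^ l := by positivity
  have e : ∀ x, ENNReal.ofReal ((growth l (x - x₀) ^ 2)⁻¹) ^ ρ = G (2 ^ l * (x - x₀)) := fun x => by
    rw [growth_eq]
  simp_rw [e]
  rw [lintegral_sub_right_eq_self (fun x => G (2 ^ l * x)) x₀]
  have h3 : ∫⁻ z, G z = ENNReal.ofReal (2 ^ l) * ∫⁻ x, G (2 ^ l * x) := by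
    conv_lhs => rw [← Real.smul_map_volume_mul_left h2.ne']
    rw [lintegral_smul_measure, lintegral_map hGm (measurable_const_mul _), abs_of_pos h2,
      smul_eq_mul]
  rw [h3, mul_right_comm, ← ENNReal.ofReal_mul h2.le, ← zpow_add₀ (by norm_num)]
  simp

theorem exists_setLIntegral_tail_rpow_le {ρ : ℝ} (hρ : 1 / 2 < ρ) (hρ' : ρ ≤ 1) :
    ∃ K : ℝ≥0, ∀ (n : ℤ) (Λ : Finset ℤ) (c : ℝ),
      ∫⁻ x in {x | (2 : ℝ) ^ (-n) ≤ |x - c|}, ∑ k ∈ Λ,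
        (ENNReal.ofReal (tail k n (x - c)) * ENNReal.ofReal (2 ^ (-n))) ^ ρ ≤
        K * ENNReal.ofReal (2 ^ (-n)) := by
  have hρ0 : 0 < ρ := by linarith
  obtain ⟨c₁, hc₁⟩ := exists_lintegral_growth_rpow_le hρ
  obtain ⟨c₂, hc₂⟩ := exists_sum_geometric_le (δ := 2 * ρ - 1) (by linarith)
  refine ⟨4 * c₁ * c₂, fun n Λ c => ?_⟩
  have hS : MeasurableSet {x : ℝ | (2 : ℝ) ^ (-n) ≤ |x - c|} :=
    measurableSet_le measurable_const (by fun_prop)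
  have hm : ∀ k, Measurable fun x : ℝ =>
      (ENNReal.ofReal (tail k n (x - c)) * ENNReal.ofReal (2 ^ (-n))) ^ ρ := fun k => by
    have h1 := ((continuous_tail k n).comp (continuous_id.sub continuous_const :
      Continuous fun x : ℝ => x - c)).measurable
    exact ((ENNReal.measurable_ofReal.comp h1).mul_const _).pow_const ρ
  rw [lintegral_finsetSum _ fun k _ => hm k]
  have main : ∀ k, ∫⁻ x in {x | (2 : ℝ) ^ (-n) ≤ |x - c|},
      (ENNReal.ofReal (tail k n (x - c)) * ENNReal.ofReal (2 ^ (-n))) ^ ρ ≤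
      4 * c₁ * ENNReal.ofReal (2 ^ (-n)) * ENNReal.ofReal (2 ^ (-|k - n|)) ^ (2 * ρ - 1) := by
    intro k
    have step : ∀ (l : ℤ) (κ : ℝ), 0 ≤ κ → (∀ z : ℝ, (2 : ℝ) ^ (-n) ≤ |z| →
        tail k n z * 2 ^ (-n) ≤ κ * (growth l z ^ 2)⁻¹) →
        ∫⁻ x in {x | (2 : ℝ) ^ (-n) ≤ |x - c|},
          (ENNReal.ofReal (tail k n (x - c)) * ENNReal.ofReal (2 ^ (-n))) ^ ρ ≤
          ENNReal.ofReal κ ^ ρ * (c₁ * ENNReal.ofReal (2 ^ (-l))) := by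
      intro l κ hκ h
      refine (setLIntegral_mono' hS fun x hx => ?_).trans ((setLIntegral_le_lintegral _ _).trans
        ((lintegral_const_mul' _ _ (ENNReal.rpow_ne_top_of_nonneg hρ0.le
          ENNReal.ofReal_ne_top)).trans_le (mul_le_mul' le_rfl (hc₁ l c))))
      rw [← ENNReal.mul_rpow_of_nonneg _ _ hρ0.le, ← ENNReal.ofReal_mul hκ,
        ← ENNReal.ofReal_mul (tail_pos _ _ _).le]
      exact ENNReal.rpow_le_rpow (ENNReal.ofReal_le_ofReal (h _ hx)) hρ0.le
    rcases le_or_gt n k with hk | hk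
    · have hkn : (1 : ℝ) ≤ 2 ^ (k - n) := one_le_zpow₀ (by norm_num) (by omega)
      refine (step n (4 * 2 ^ (-(k - n))) (by positivity) fun z hz => ?_).trans ?_
      · have h1 : 2 ^ (k - n) * growth n z ≤ 2 * growth k z := by
          have h2 : (2 : ℝ) ^ k * |z| = 2 ^ (k - n) * (2 ^ n * |z|) := by
            rw [← mul_assoc, ← zpow_add₀ (by norm_num)]; simp
          have h3 : (1 : ℝ) ≤ 2 ^ n * |z| := by
            calc (1 : ℝ) = 2 ^ n * 2 ^ (-n) := by rw [← zpow_add₀ (by norm_num)]; simp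
              _ ≤ _ := by gcongr
          unfold growth
          rw [h2]
          nlinarith
        have p1 := growth_pos n z
        have p2 := growth_pos k z
        have hpow : (2 : ℝ) ^ k * 2 ^ (-n) = 2 ^ (k - n) := by
          rw [← zpow_add₀ (by norm_num)]; rfl
        unfold tail
        rw [min_eq_left hkn, one_mul, wt_eq, div_mul_eq_mul_div, hpow, zpow_neg, ← div_eq_mul_inv,
          ← div_eq_mul_inv, div_div, div_le_div_iff₀ (by positivity) (by positivity)]
        calc (2 : ℝ) ^ (k - n) * (2 ^ (k - n) * growth n z ^ 2) =
            (2 ^ (k - n) * growth n z) ^ 2 := by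
              ring
          _ ≤ (2 * growth k z) ^ 2 := by gcongr
          _ = _ := by ring
      · rw [abs_of_nonneg (by omega : 0 ≤ k - n), ENNReal.ofReal_mul (by norm_num),
          ENNReal.mul_rpow_of_nonneg _ _ hρ0.le]
        have h4 : ENNReal.ofReal 4 ^ ρ ≤ 4 := by
          rw [show ENNReal.ofReal 4 = 4 by norm_num]
          calc (4 : ℝ≥0∞) ^ ρ ≤ 4 ^ (1 : ℝ) :=
                ENNReal.rpow_le_rpow_of_exponent_le (by norm_num) hρ'
            _ = 4 := ENNReal.rpow_one 4
        have h5 : ENNReal.ofReal (2 ^ (-(k - n))) ^ ρ ≤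
            ENNReal.ofReal (2 ^ (-(k - n))) ^ (2 * ρ - 1) := by
          refine ENNReal.rpow_le_rpow_of_exponent_ge ?_ (by linarith)
          rw [← ENNReal.ofReal_one]
          refine ENNReal.ofReal_le_ofReal ?_
          rw [zpow_neg]
          exact inv_le_one_of_one_le₀ hkn
        refine (mul_le_mul' (mul_le_mul' h4 h5) le_rfl).trans_eq ?_
        ring
    · refine (step k (2 ^ (k - n) * 2 ^ (k - n)) (by positivity) fun z _ => ?_).trans ?_
      · have hkn : (2 : ℝ) ^ (k - n) ≤ 1 := zpow_le_one_of_nonpos₀ (by norm_num) (by omega)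
        unfold tail
        rw [min_eq_right hkn, wt_eq]
        refine le_of_eq ?_
        rw [show (2 : ℝ) ^ (k - n) * 2 ^ (k - n) = 2 ^ (k - n) * (2 ^ k * 2 ^ (-n)) by
          rw [← zpow_add₀ (by norm_num : (2 : ℝ) ≠ 0) k]; rfl]
        field_simp
      · rw [abs_of_neg (by omega : k - n < 0), neg_neg]
        set a := ENNReal.ofReal (2 ^ (k - n)) with ha
        have ha0 : a ≠ 0 := (ENNReal.ofReal_pos.mpr (by positivity)).ne'
        have h1 : ENNReal.ofReal (2 ^ (k - n) * 2 ^ (k - n)) ^ ρ = a ^ (2 * ρ - 1) * a := by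
          rw [ENNReal.ofReal_mul (by positivity), ENNReal.mul_rpow_of_nonneg _ _ hρ0.le, ← ha,
            ← ENNReal.rpow_add _ _ ha0 ENNReal.ofReal_ne_top]
          nth_rw 3 [← ENNReal.rpow_one a]
          rw [← ENNReal.rpow_add _ _ ha0 ENNReal.ofReal_ne_top]
          congr 1
          ring
        have h2 : a * ENNReal.ofReal (2 ^ (-k)) = ENNReal.ofReal (2 ^ (-n)) := by
          rw [ha, ← ENNReal.ofReal_mul (by positivity), ← zpow_add₀ (by norm_num)]
          congr 2
          ring
        rw [h1, ← h2]
        calc a ^ (2 * ρ - 1) * a * (c₁ * ENNReal.ofReal (2 ^ (-k))) =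
            1 * (c₁ * (a * ENNReal.ofReal (2 ^ (-k))) * a ^ (2 * ρ - 1)) := by ring
          _ ≤ 4 * (c₁ * (a * ENNReal.ofReal (2 ^ (-k))) * a ^ (2 * ρ - 1)) := by
            gcongr; norm_num
          _ = _ := by ring
  refine (Finset.sum_le_sum fun k _ => main k).trans ?_
  rw [← Finset.mul_sum]
  refine (mul_le_mul' le_rfl (hc₂ n Λ)).trans_eq ?_
  push_cast
  ring

end TailIntegral

section StoppingCells

/-- The maximal dyadic intervals of length at most `2 ^ (-m)` on which the mean of `F`
exceeds `B`. -/
def czCells (B : ℝ≥0) (F : ℝ → ℝ≥0∞) (m : ℤ) : Set (ℤ × ℤ) :=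
  stopping (fun n j => B * ENNReal.ofReal (2 ^ (-n)) < ∫⁻ t in cell n j, F t) m

variable {B : ℝ≥0} {F : ℝ → ℝ≥0∞} {m : ℤ}

theorem czCells_disjoint (B : ℝ≥0) (F : ℝ → ℝ≥0∞) (m : ℤ) :
    (czCells B F m).PairwiseDisjoint fun p => cell p.1 p.2 := stopping_disjoint _ m

theorem lt_setLIntegral_of_mem_czCells {p : ℤ × ℤ} (hp : p ∈ czCells B F m) :
    B * ENNReal.ofReal (2 ^ (-p.1)) < ∫⁻ t in cell p.1 p.2, F t := hp.2.1

theorem lt_of_mem_czCells (hF : ∫⁻ t, F t ≤ B * ENNReal.ofReal (2 ^ (-m))) {p : ℤ × ℤ}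
    (hp : p ∈ czCells B F m) : m < p.1 := by
  refine lt_of_le_of_ne hp.1 fun h => ?_
  have h1 := lt_setLIntegral_of_mem_czCells hp
  rw [← h] at h1
  exact absurd (h1.trans_le ((setLIntegral_le_lintegral _ _).trans hF)) (lt_irrefl _)

theorem setLIntegral_le_of_mem_czCells (hF : ∫⁻ t, F t ≤ B * ENNReal.ofReal (2 ^ (-m)))
    {p : ℤ × ℤ} (hp : p ∈ czCells B F m) :
    ∫⁻ t in cell p.1 p.2, F t ≤ 2 * B * ENNReal.ofReal (2 ^ (-p.1)) := by
  have hm := lt_of_mem_czCells hF hp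
  set x := (2 : ℝ) ^ (-p.1) * p.2
  have hx : x ∈ cell p.1 p.2 := left_mem_cell _ _
  have h := hp.2.2 x hx (p.1 - 1) (by omega) (by omega)
  simp only [not_lt] at h
  have hsub : cell p.1 p.2 ⊆ cell (p.1 - 1) (idx (p.1 - 1) x) := fun z hz =>
    idx_eq_of_le (by omega : p.1 - 1 ≤ p.1) (hz.trans hx.symm)
  refine (lintegral_mono_set hsub).trans (h.trans_eq ?_)
  rw [show (2 : ℝ) ^ (-(p.1 - 1)) = 2 * 2 ^ (-p.1) by
    rw [neg_sub, sub_eq_add_neg, zpow_add₀ (by norm_num), zpow_one],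
    ENNReal.ofReal_mul (by norm_num), ENNReal.ofReal_ofNat]
  ring

theorem tsum_czCells_le (B : ℝ≥0) (F : ℝ → ℝ≥0∞) (m : ℤ) :
    ∑' p : czCells B F m, B * ENNReal.ofReal (2 ^ (-p.1.1)) ≤ ∫⁻ t, F t := by
  calc _ ≤ ∑' p : czCells B F m, ∫⁻ t in cell p.1.1 p.1.2, F t :=
        ENNReal.tsum_le_tsum fun p => (lt_setLIntegral_of_mem_czCells p.2).le
    _ = ∫⁻ t in ⋃ p : czCells B F m, cell p.1.1 p.1.2, F t :=
        (lintegral_iUnion (fun p : czCells B F m => measurableSet_cell _ _)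
          (fun a b hab => czCells_disjoint B F m a.2 b.2 fun h => hab (Subtype.ext h)) _).symm
    _ ≤ _ := setLIntegral_le_lintegral _ _

theorem le_abs_sub_of_mem_czCells {x : ℝ} (hx : 2 * hl F x ≤ B) {p : ℤ × ℤ}
    (hp : p ∈ czCells B F m) {t : ℝ} (ht : t ∈ cell p.1 p.2) : (2 : ℝ) ^ (-p.1) ≤ |x - t| := by
  by_contra! h
  have e : (2 : ℝ) ^ (-(p.1 - 1)) = 2 * 2 ^ (-p.1) := by
    rw [neg_sub, sub_eq_add_neg, zpow_add₀ (by norm_num), zpow_one]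
  have hsub : cell p.1 p.2 ⊆ Metric.closedBall x ((2 : ℝ) ^ (-(p.1 - 1))) := fun z hz => by
    rw [Metric.mem_closedBall, Real.dist_eq, abs_sub_comm, e]
    have h1 := dist_lt_of_mem_cell ht hz
    have h2 := abs_sub_le x t z
    linarith
  have h1 : ∫⁻ t in cell p.1 p.2, F t ≤ B * ENNReal.ofReal (2 ^ (-p.1)) :=
    calc _ ≤ ENNReal.ofReal (2 ^ (-(p.1 - 1))) * hl F x :=
          (lintegral_mono_set hsub).trans (setLIntegral_closedBall_le_hl F x _)
      _ = ENNReal.ofReal (2 ^ (-p.1)) * (2 * hl F x) := by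
          rw [e, ENNReal.ofReal_mul (by norm_num), ENNReal.ofReal_ofNat]; ring
      _ ≤ ENNReal.ofReal (2 ^ (-p.1)) * B := by gcongr
      _ = _ := mul_comm _ _
  exact absurd (lt_setLIntegral_of_mem_czCells hp) (not_lt.2 h1)

theorem ae_le_of_forall_notMem_czCells (hFm : Measurable F) (hF : ∫⁻ t, F t ≠ ∞) :
    ∀ᵐ x, (∀ p ∈ czCells B F m, x ∉ cell p.1 p.2) → F x ≤ B := by
  filter_upwards [(IsUnifLocDoublingMeasure.vitaliFamily (volume : Measure ℝ)
    1).ae_tendsto_lintegral_div' hFm hF] with x hx hxS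
  set δ : ℕ → ℝ := fun n => (2 : ℝ) ^ (-(n : ℤ)) / 2 with hδ
  set w : ℕ → ℝ := fun n => (2 : ℝ) ^ (-(n : ℤ)) * (idx n x + 1 / 2) with hw
  have hδ0 : ∀ n, 0 < δ n := fun n => by positivity
  have hball : ∀ n : ℕ, Metric.closedBall (w n) (δ n) =
      Set.Icc ((2 : ℝ) ^ (-(n : ℤ)) * idx n x) ((2 : ℝ) ^ (-(n : ℤ)) * (idx n x + 1)) := fun n => by
    rw [Real.closedBall_eq_Icc]
    congr 1 <;> simp only [hw, hδ] <;> ring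
  have hmem : ∀ n : ℕ, x ∈ Metric.closedBall (w n) (1 * δ n) := fun n => by
    rw [one_mul, hball]
    have := mem_cell_idx n x
    rw [cell_eq_Ico] at this
    exact Set.Ico_subset_Icc_self this
  have hlim : Filter.Tendsto δ Filter.atTop (nhdsWithin 0 (Set.Ioi 0)) := by
    refine tendsto_nhdsWithin_iff.2 ⟨?_, Filter.Eventually.of_forall hδ0⟩
    have h1 : Filter.Tendsto (fun n : ℕ => ((1 / 2 : ℝ)) ^ n / 2) Filter.atTop (nhds (0 / 2)) :=
      (_root_.tendsto_pow_atTop_nhds_zero_of_lt_one (by norm_num) (by norm_num)).div_const 2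
    rw [zero_div] at h1
    refine h1.congr fun n => ?_
    simp [hδ]
  refine le_of_tendsto (hx.comp (IsUnifLocDoublingMeasure.tendsto_closedBall_filterAt volume w δ hlim
    (Filter.Eventually.of_forall hmem))) ?_
  filter_upwards [Filter.eventually_ge_atTop m.toNat] with n hn
  have hn' : m ≤ n := by omega
  have h1 : ∫⁻ t in cell n (idx n x), F t ≤ B * ENNReal.ofReal (2 ^ (-(n : ℤ))) := by
    by_contra! h
    obtain ⟨p, hp, hxp⟩ := exists_mem_stopping
      (P := fun n j => B * ENNReal.ofReal (2 ^ (-n)) < ∫⁻ t in cell n j, F t) hn' h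
    exact hxS p hp hxp
  simp only [Function.comp]
  have hvol : volume (Metric.closedBall (w n) (δ n)) = ENNReal.ofReal (2 ^ (-(n : ℤ))) := by
    rw [Real.volume_closedBall]
    congr 1
    simp only [hδ]
    ring
  rw [hvol]
  refine ENNReal.div_le_of_le_mul ?_
  rw [hball, setLIntegral_congr Ico_ae_eq_Icc.symm, ← cell_eq_Ico]
  exact h1

theorem rpow_sum_le_sum_rpow {ι : Type*} {ρ : ℝ} (hρ : 0 < ρ) (hρ' : ρ ≤ 1) (s : Finset ι)
    (a : ι → ℝ≥0∞) : (∑ i ∈ s, a i) ^ ρ ≤ ∑ i ∈ s, a i ^ ρ := by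
  classical
  induction s using Finset.induction_on with
  | empty => simp [hρ]
  | insert k s hk ih =>
    rw [Finset.sum_insert hk, Finset.sum_insert hk]
    exact (ENNReal.rpow_add_le_add_rpow _ _ hρ.le hρ').trans (by gcongr)

theorem rpow_tsum_le {ι : Type*} {ρ : ℝ} (hρ : 0 < ρ) (hρ' : ρ ≤ 1) (a : ι → ℝ≥0∞) :
    (∑' i, a i) ^ ρ ≤ ∑' i, a i ^ ρ := by
  rw [← ENNReal.le_rpow_inv_iff hρ, ENNReal.tsum_eq_iSup_sum]
  refine iSup_le fun s => ?_
  rw [ENNReal.le_rpow_inv_iff hρ]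
  exact (rpow_sum_le_sum_rpow hρ hρ' s a).trans (ENNReal.sum_le_tsum s)

end StoppingCells

section CalderonZygmund

/-- A splitting `f = ff + fb + fg` adapted to the dyadic interval of generation `m` around `y`:
`ff` lives far away, `fg` is bounded by a multiple of `B`, and `fb` consists of mean-zero pieces
whose averages against `η` are controlled by `β` off the small exceptional set `E`. -/
structure CZDecomp (C B K : ℝ≥0) (ρ : ℝ) (η : ℝ → ℂ) (t p₀ : ℝ≥0∞) (N : ℕ) (m : ℤ) (y : ℝ)
    (f ff fb fg : ℕ → ℝ → ℂ) (E : Set ℝ) (β : ℤ → ℝ → ℝ≥0∞) : Prop where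
  adm_far : ∀ i, Adm (ff i)
  adm_bad : ∀ i, Adm (fb i)
  adm_good : ∀ i, Adm (fg i)
  eq_add : ∀ i x, f i x = ff i x + (fb i x + fg i x)
  measurableSet : MeasurableSet E
  measure_le : B * volume E ≤ 32 * ENNReal.ofReal (2 ^ (-m))
  far : ∀ k, ∀ x ∈ cell m (idx m y),
    ConvBound t N η k x ff (C * (128 * ENNReal.ofReal (2 ^ (m - k))))
  near : ∀ k, ∀ x ∉ E, ConvBound t N η k x (fun i x => fb i x + fg i x) (C * (4 * B))
  measurable_bad : ∀ k, Measurable (β k)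
  bad : ∀ k, ∀ x ∉ E, ConvBound t N η k x fb (C * β k x)
  bad_le : ∀ Λ : Finset ℤ, ∫⁻ x in Eᶜ, ∑ k ∈ Λ, β k x ^ ρ ≤ K * ENNReal.ofReal (2 ^ (-m))
  good : ∀ k x, ConvBound t N η k x fg (C * (32 * B))
  good_norm_le : LqNorm volume p₀ (fun x => ellN t N fun i => ‖fg i x‖ₑ) ≤
    2 * B * (8 * ENNReal.ofReal (2 ^ (-m))) ^ (1 / p₀.toReal)

theorem LqNorm_le_of_ae_le {p : ℝ≥0∞} (hp : p ≠ 0) {F : ℝ → ℝ≥0∞} {c v : ℝ≥0∞} {s : Set ℝ}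
    (h : ∀ᵐ x, F x ≤ c) (h0 : ∀ x ∉ s, F x = 0) (hs : volume s ≤ v) (hms : MeasurableSet s) :
    LqNorm volume p F ≤ c * v ^ (1 / p.toReal) := by
  unfold LqNorm
  split_ifs with hpt
  · simp only [hpt, ENNReal.toReal_top, _root_.div_zero, ENNReal.rpow_zero, mul_one]
    exact essSup_le_of_ae_le c h
  · have hp0 : 0 < p.toReal := ENNReal.toReal_pos hp hpt
    have h1 : ∫⁻ x, F x ^ p.toReal ≤ c ^ p.toReal * v := by
      calc ∫⁻ x, F x ^ p.toReal ≤ ∫⁻ x, s.indicator (fun _ => c ^ p.toReal) x := by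
            refine lintegral_mono_ae (h.mono fun x hx => ?_)
            by_cases hxs : x ∈ s
            · rw [Set.indicator_of_mem hxs]
              exact ENNReal.rpow_le_rpow hx hp0.le
            · rw [h0 x hxs, ENNReal.zero_rpow_of_pos hp0]
              exact zero_le
        _ = c ^ p.toReal * volume s := lintegral_indicator_const hms _
        _ ≤ _ := by gcongr
    calc _ ≤ (c ^ p.toReal * v) ^ (1 / p.toReal) := ENNReal.rpow_le_rpow h1 (by positivity)
      _ = _ := by
        rw [ENNReal.mul_rpow_of_nonneg _ _ (by positivity), ← ENNReal.rpow_mul,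
          mul_one_div_cancel hp0.ne', ENNReal.rpow_one]

theorem Adm.of_bounded {f : ℝ → ℂ} (hf : Measurable f) {M : ℝ} (hM : ∀ x, ‖f x‖ ≤ M) {s : Set ℝ}
    (hs : volume s ≠ ∞) (h0 : ∀ x ∉ s, f x = 0) : Adm f := by
  refine ⟨hf, ?_, M, hM⟩
  have h1 : IntegrableOn f s := Measure.integrableOn_of_bounded (M := M) hs
    hf.aestronglyMeasurable (Filter.Eventually.of_forall hM)
  exact (integrableOn_iff_integrable_of_support_subset fun x hx => by
    by_contra hxs; exact hx (h0 x hxs)).1 h1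

theorem exists_czDecomp {ρ : ℝ} (hρ : 1 / 2 < ρ) (hρ' : ρ ≤ 1) {B : ℝ≥0} (hB : 2 ≤ B) :
    ∃ K : ℝ≥0, ∀ {C : ℝ≥0} {η : ℝ → ℂ} (_ : Bump C η) {t p₀ : ℝ≥0∞} (_ : 1 ≤ t) (_ : p₀ ≠ 0)
      (N : ℕ) (m : ℤ) (y : ℝ) (f : ℕ → ℝ → ℂ) (_ : ∀ i, Adm (f i))
      (_ : hl (fun x => ellN t N fun i => ‖f i x‖ₑ) y ≤ 1),
      ∃ ff fb fg E β, CZDecomp C B K ρ η t p₀ N m y f ff fb fg E β := by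
  have hρ0 : 0 < ρ := by linarith
  obtain ⟨K₀, hK₀⟩ := exists_setLIntegral_tail_rpow_le hρ hρ'
  refine ⟨40 * B * K₀, fun {C η} hη {t p₀} ht hp₀ N m y f hf hy => ?_⟩
  have ht0 : t ≠ 0 := (one_pos.trans_le ht).ne'
  set J := Metric.closedBall y ((2 : ℝ) ^ (-(m - 1))) with hJ
  have hJm : MeasurableSet J := measurableSet_closedBall
  have e2 : (2 : ℝ) ^ (-(m - 1)) = 2 * 2 ^ (-m) := by
    rw [neg_sub, sub_eq_add_neg, zpow_add₀ (by norm_num), zpow_one]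
  have e3 : (2 : ℝ) ^ (-(m - 2)) = 4 * 2 ^ (-m) := by
    rw [neg_sub, sub_eq_add_neg, zpow_add₀ (by norm_num)]; norm_num
  have hpos : (0 : ℝ) < 2 ^ (-m) := by positivity
  set F : ℝ → ℝ≥0∞ := fun x => ellN t N fun i => ‖f i x‖ₑ with hF
  set u : ℕ → ℝ → ℂ := fun i => J.indicator (f i) with hu
  set F' : ℝ → ℝ≥0∞ := fun x => ellN t N fun i => ‖u i x‖ₑ with hF'
  set ff : ℕ → ℝ → ℂ := fun i => Jᶜ.indicator (f i) with hff
  set Ff : ℝ → ℝ≥0∞ := fun x => ellN t N fun i => ‖ff i x‖ₑ with hFf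
  have hua : ∀ i, Adm (u i) := fun i => (hf i).indicator hJm
  have hffa : ∀ i, Adm (ff i) := fun i => (hf i).indicator hJm.compl
  have hF'm : Measurable F' := measurable_ellN fun i => (hua i).meas.enorm
  have hFfm : Measurable Ff := measurable_ellN fun i => (hffa i).meas.enorm
  have hF'J : ∀ x ∉ J, F' x = 0 := fun x hx => by
    simp only [hF', hu, Set.indicator_of_notMem hx, enorm_zero]
    exact ellN_zero ht0
  have hFfJ : ∀ x ∈ J, Ff x = 0 := fun x hx => by
    simp only [hFf, hff, Set.indicator_of_notMem (Set.notMem_compl_iff.2 hx), enorm_zero]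
    exact ellN_zero ht0
  have hF'F : ∀ x, F' x ≤ J.indicator F x := fun x => by
    by_cases hx : x ∈ J
    · simp only [hF', hu, Set.indicator_of_mem hx]; exact le_rfl
    · rw [hF'J x hx]; exact zero_le
  have hFfF : ∀ x, Ff x ≤ F x := fun x => ellN_mono fun i => by
    by_cases hx : x ∈ Jᶜ
    · simp only [hff, Set.indicator_of_mem hx]; exact le_rfl
    · simp only [hff, Set.indicator_of_notMem hx, enorm_zero]; exact zero_le
  have hInt : ∫⁻ x, F' x ≤ 2 * ENNReal.ofReal (2 ^ (-m)) :=
    calc _ ≤ ∫⁻ x, J.indicator F x := lintegral_mono hF'F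
      _ = ∫⁻ x in J, F x := lintegral_indicator hJm _
      _ ≤ ENNReal.ofReal (2 ^ (-(m - 1))) * hl F y := setLIntegral_closedBall_le_hl F y _
      _ ≤ ENNReal.ofReal (2 ^ (-(m - 1))) * 1 := by gcongr
      _ = _ := by rw [e2, ENNReal.ofReal_mul (by norm_num), ENNReal.ofReal_ofNat, mul_one]
  have hB' : (2 : ℝ≥0∞) ≤ B := by exact_mod_cast hB
  have hIntB : ∫⁻ x, F' x ≤ B * ENNReal.ofReal (2 ^ (-m)) := hInt.trans (by gcongr)
  set S := czCells B F' m with hS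
  have hSd : S.PairwiseDisjoint fun p => cell p.1 p.2 := czCells_disjoint B F' m
  set fg : ℕ → ℝ → ℂ := fun i => selAvg S (u i) with hfg
  set Fg : ℝ → ℝ≥0∞ := fun x => ellN t N fun i => ‖fg i x‖ₑ with hFg
  have hsupp : ∀ x ∉ Metric.closedBall y ((2 : ℝ) ^ (-(m - 2))), x ∉ J ∧
      ∀ p ∈ S, x ∉ cell p.1 p.2 := by
    intro x hx
    rw [Metric.mem_closedBall, Real.dist_eq, not_le, e3] at hx
    refine ⟨fun hxJ => ?_, fun p hp hxp => ?_⟩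
    · rw [hJ, Metric.mem_closedBall, Real.dist_eq, e2] at hxJ
      linarith
    · have h1 := lt_setLIntegral_of_mem_czCells hp
      have h2 : ∫⁻ t in cell p.1 p.2, F' t = 0 := by
        refine (setLIntegral_congr_fun (measurableSet_cell _ _) fun z hz => hF'J z fun hzJ =>
            ?_).trans
          (by simp)
        rw [hJ, Metric.mem_closedBall, Real.dist_eq, e2] at hzJ
        have h3 := dist_lt_of_mem_cell hxp hz
        have h4 : (2 : ℝ) ^ (-p.1) ≤ 2 ^ (-m) :=
          zpow_le_zpow_right₀ (by norm_num) (by have := lt_of_mem_czCells hIntB hp; omega)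
        have h5 := abs_sub_le x z y
        linarith
      rw [h2] at h1
      exact absurd h1 _root_.not_lt_zero
  have hfg0 : ∀ x ∉ Metric.closedBall y ((2 : ℝ) ^ (-(m - 2))), ∀ i, fg i x = 0 := fun x hx i => by
    simp only [hfg]
    rw [selAvg_of_forall_notMem _ (hsupp x hx).2]
    exact Set.indicator_of_notMem (hsupp x hx).1 _
  have hvol : volume (Metric.closedBall y ((2 : ℝ) ^ (-(m - 2)))) ≤
      8 * ENNReal.ofReal (2 ^ (-m)) := by
    rw [Real.volume_closedBall, e3, ← mul_assoc, ENNReal.ofReal_mul (by norm_num)]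
    norm_num
  have hfga : ∀ i, Adm (fg i) := fun i => by
    obtain ⟨M, hM⟩ := (hua i).bdd
    exact Adm.of_bounded (measurable_selAvg hSd (hua i).meas) (norm_selAvg_le hSd hM)
      measure_closedBall_lt_top.ne fun x hx => hfg0 x hx i
  have hFgB : ∀ᵐ x, Fg x ≤ 2 * B := by
    filter_upwards [ae_le_of_forall_notMem_czCells (B := B) (m := m) hF'm
      (hIntB.trans_lt (by finiteness)).ne] with x hx
    by_cases h : ∃ p ∈ S, x ∈ cell p.1 p.2
    · obtain ⟨p, hp, hxp⟩ := h
      refine (ellN_selAvg_le ht hSd (fun i => (hua i).meas) hp hxp).trans ?_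
      refine (mul_le_mul' le_rfl (setLIntegral_le_of_mem_czCells hIntB hp)).trans_eq ?_
      rw [mul_left_comm, ← ENNReal.ofReal_mul (by positivity), ← zpow_add₀ (by norm_num)]
      simp
    · push Not at h
      have : Fg x = F' x := by simp only [hFg, hF', hfg, selAvg_of_forall_notMem _ h]
      rw [this]
      exact (hx h).trans (le_mul_of_one_le_left' (by norm_num))
  set E := {x | ((B / 2 : ℝ≥0) : ℝ≥0∞) < hl F' x} with hE
  have hxE : ∀ x ∉ E, 2 * hl F' x ≤ B := fun x hx => by
    have h1 : hl F' x ≤ ((B / 2 : ℝ≥0) : ℝ≥0∞) := not_lt.1 hx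
    calc 2 * hl F' x ≤ 2 * ((B / 2 : ℝ≥0) : ℝ≥0∞) := by gcongr
      _ = B := by rw [← ENNReal.coe_ofNat, ← ENNReal.coe_mul, mul_div_cancel₀ _ two_ne_zero]
  have hsep : ∀ x ∉ E, ∀ p ∈ S, ∀ t ∈ cell p.1 p.2, (2 : ℝ) ^ (-p.1) ≤ |x - t| :=
    fun x hx p hp t ht => le_abs_sub_of_mem_czCells (hxE x hx) hp ht
  have hconvg : ∀ k x, ConvBound t N η k x fg (C * (32 * B)) := fun k x =>
    (hη.convBound ht (fun i => (hfga i).meas) N k x).mono (mul_le_mul' le_rfl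
      ((wavg_le_of_ae_le hFgB k x).trans_eq (by ring)))
  have hEm : MeasurableSet E := measurableSet_lt measurable_const (measurable_hl hF'm)
  have htm : ∀ k (p : S), Measurable fun x =>
      ENNReal.ofReal (tail k p.1.1 (x - (2 : ℝ) ^ (-p.1.1) * p.1.2)) *
        ENNReal.ofReal (2 ^ (-p.1.1)) := fun k p =>
    (ENNReal.measurable_ofReal.comp ((continuous_tail k p.1.1).comp
      (continuous_id.sub continuous_const)).measurable).mul_const _
  refine ⟨ff, fun i x => u i x - fg i x, fg, E, fun k x => 20 * B * ∑' p : S,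
    ENNReal.ofReal (tail k p.1.1 (x - (2 : ℝ) ^ (-p.1.1) * p.1.2)) *
      ENNReal.ofReal (2 ^ (-p.1.1)), ?_⟩
  exact {
    adm_far := hffa
    adm_bad := fun i => (hua i).sub (hfga i)
    adm_good := hfga
    eq_add := fun i x => by
      rw [sub_add_cancel, add_comm]
      exact (Set.indicator_self_add_compl_apply J (f i) x).symm
    measurableSet := hEm
    measure_le := by
      have h1 := hl_weak F' ((B / 2 : ℝ≥0) : ℝ≥0∞)
      have h2 : (B : ℝ≥0∞) = 2 * ((B / 2 : ℝ≥0) : ℝ≥0∞) := by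
        rw [← ENNReal.coe_ofNat, ← ENNReal.coe_mul, mul_div_cancel₀ _ two_ne_zero]
      rw [h2, mul_assoc]
      calc _ ≤ 2 * (8 * (2 * ENNReal.ofReal (2 ^ (-m)))) := by
            refine mul_le_mul' le_rfl (h1.trans (mul_le_mul' le_rfl hInt))
        _ = _ := by ring
    far := fun k x hx => by
      refine (hη.convBound ht (fun i => (hffa i).meas) N k x).mono (mul_le_mul' le_rfl ?_)
      have hxy : |x - y| < (2 : ℝ) ^ (-m) := dist_lt_of_mem_cell hx (mem_cell_idx m y)
      calc wavg k Ff x ≤ 4 * ENNReal.ofReal (2 ^ (m - k)) * wavg m Ff x := by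
            refine wavg_far_le fun t ht => hFfJ t ?_
            rw [hJ, Metric.mem_closedBall, Real.dist_eq, e2]
            have := abs_sub_le t x y
            rw [abs_sub_comm t x] at this
            linarith
        _ ≤ 4 * ENNReal.ofReal (2 ^ (m - k)) * (4 * (8 * 1)) := by
            refine mul_le_mul' le_rfl ((wavg_le_of_near (by rw [abs_sub_comm]; exact hxy.le)
                Ff).trans
              (mul_le_mul' le_rfl ((wavg_le_hl hFfm m y).trans (mul_le_mul' le_rfl ?_))))
            exact (hl_mono hFfF y).trans hy
        _ = _ := by ring
    near := fun k x hx => by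
      simp only [sub_add_cancel]
      refine (hη.convBound ht (fun i => (hua i).meas) N k x).mono (mul_le_mul' le_rfl ?_)
      calc wavg k F' x ≤ 8 * hl F' x := wavg_le_hl hF'm k x
        _ = 4 * (2 * hl F' x) := by ring
        _ ≤ _ := mul_le_mul' le_rfl (hxE x hx)
    measurable_bad := fun k => (Measurable.tsum fun p => htm k p).const_mul _
    bad := fun k x hx => by
      refine (hη.convBound_sub_selAvg ht N hSd hua hfga (hsep x hx) k).mono ?_
      rw [mul_comm 10, mul_assoc]
      refine mul_le_mul' le_rfl ?_
      rw [← ENNReal.tsum_mul_left, ← ENNReal.tsum_mul_left]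
      refine ENNReal.tsum_le_tsum fun p => ?_
      calc _ ≤ 10 * (ENNReal.ofReal (tail k p.1.1 (x - (2 : ℝ) ^ (-p.1.1) * p.1.2)) *
            (2 * B * ENNReal.ofReal (2 ^ (-p.1.1)))) :=
            mul_le_mul' le_rfl (mul_le_mul' le_rfl (setLIntegral_le_of_mem_czCells hIntB p.2))
        _ = _ := by ring
    bad_le := fun Λ => by
      have h20 : ((20 * B : ℝ≥0∞)) ^ ρ ≤ 20 * B := by
        calc ((20 * B : ℝ≥0∞)) ^ ρ ≤ (20 * B) ^ (1 : ℝ) := by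
              refine ENNReal.rpow_le_rpow_of_exponent_le ?_ hρ'
              calc (1 : ℝ≥0∞) ≤ 20 * 2 := by norm_num
                _ ≤ _ := by gcongr
          _ = _ := ENNReal.rpow_one _
      calc _ ≤ ∫⁻ x in Eᶜ, 20 * B * ∑' p : S, ∑ k ∈ Λ,
            (ENNReal.ofReal (tail k p.1.1 (x - (2 : ℝ) ^ (-p.1.1) * p.1.2)) *
              ENNReal.ofReal (2 ^ (-p.1.1))) ^ ρ := by
            refine lintegral_mono fun x => ?_
            rw [Summable.tsum_finsetSum fun _ _ => ENNReal.summable, Finset.mul_sum]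
            refine Finset.sum_le_sum fun k _ => ?_
            rw [ENNReal.mul_rpow_of_nonneg _ _ hρ0.le]
            exact mul_le_mul' h20 (rpow_tsum_le hρ0 hρ' _)
        _ = 20 * B * ∑' p : S, ∫⁻ x in Eᶜ, ∑ k ∈ Λ,
            (ENNReal.ofReal (tail k p.1.1 (x - (2 : ℝ) ^ (-p.1.1) * p.1.2)) *
              ENNReal.ofReal (2 ^ (-p.1.1))) ^ ρ := by
            rw [lintegral_const_mul' _ _ (by finiteness), lintegral_tsum]
            exact fun p => (Finset.measurable_fun_sum _ fun k _ =>
              (htm k p).pow_const ρ).aemeasurable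
        _ ≤ 20 * B * ∑' p : S, K₀ * (B * ENNReal.ofReal (2 ^ (-p.1.1))) := by
            refine mul_le_mul' le_rfl (ENNReal.tsum_le_tsum fun p => ?_)
            refine (lintegral_mono_set fun x hx => ?_).trans ((hK₀ p.1.1 Λ _).trans ?_)
            · exact hsep x hx p.1 p.2 _ (left_mem_cell _ _)
            · exact mul_le_mul' le_rfl (le_mul_of_one_le_left'
                ((by norm_num : (1 : ℝ≥0∞) ≤ 2).trans hB'))
        _ ≤ 20 * B * (K₀ * (2 * ENNReal.ofReal (2 ^ (-m)))) := by
            rw [ENNReal.tsum_mul_left]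
            exact mul_le_mul' le_rfl (mul_le_mul' le_rfl ((tsum_czCells_le B F' m).trans hInt))
        _ ≤ _ := by
            push_cast
            exact le_of_eq (by ring)
    good := hconvg
    good_norm_le := LqNorm_le_of_ae_le hp₀ hFgB (fun x hx => by
      simp only [hfg0 x hx, enorm_zero]; exact ellN_zero ht0) hvol measurableSet_closedBall }

end CalderonZygmund

section Bilinear

variable {C C' : ℝ≥0} {η η₁ η₂ η₃ : ℝ → ℂ} {f f' g g' : ℝ → ℂ}

theorem Bump.mono (hη : Bump C η) (h : C ≤ C') : Bump C' η := by
  have h' : (C : ℝ) ≤ C' := h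
  refine ⟨hη.cont, fun x => (hη.bound x).trans (by gcongr), fun x y =>
      (hη.lip x y).trans (by gcongr)⟩

theorem Bump.continuous_tripara (h₁ : Bump C η₁) (h₂ : Bump C η₂) (h₃ : Bump C η₃) (Λ : Finset ℤ)
    (hf : Adm f) (hg : Adm g) : Continuous (tripara η₁ η₂ η₃ Λ f g) :=
  continuous_finsetSum _ fun k _ =>
    h₃.continuous_conv k ((h₁.adm_conv k hf).mul (h₂.adm_conv k hg))

theorem Bump.tripiece_add_left (h₁ : Bump C η₁) (h₂ : Bump C η₂) (h₃ : Bump C η₃) (k : ℤ)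
    (hf : Adm f) (hf' : Adm f') (hg : Adm g) (x : ℝ) :
    tripiece η₁ η₂ η₃ k (fun t => f t + f' t) g x =
      tripiece η₁ η₂ η₃ k f g x + tripiece η₁ η₂ η₃ k f' g x := by
  unfold tripiece
  rw [← h₃.conv_add k ((h₁.adm_conv k hf).mul (h₂.adm_conv k hg))
    ((h₁.adm_conv k hf').mul (h₂.adm_conv k hg))]
  simp only [h₁.conv_add k hf hf', add_mul]

theorem Bump.tripiece_add_right (h₁ : Bump C η₁) (h₂ : Bump C η₂) (h₃ : Bump C η₃) (k : ℤ)
    (hf : Adm f) (hg : Adm g) (hg' : Adm g') (x : ℝ) :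
    tripiece η₁ η₂ η₃ k f (fun t => g t + g' t) x =
      tripiece η₁ η₂ η₃ k f g x + tripiece η₁ η₂ η₃ k f g' x := by
  unfold tripiece
  rw [← h₃.conv_add k ((h₁.adm_conv k hf).mul (h₂.adm_conv k hg))
    ((h₁.adm_conv k hf).mul (h₂.adm_conv k hg'))]
  simp only [h₂.conv_add k hg hg', mul_add]

theorem tripiece_const_mul (k : ℤ) (a b : ℂ) (f g : ℝ → ℂ) (x : ℝ) :
    tripiece η₁ η₂ η₃ k (fun t => a * f t) (fun t => b * g t) x =
      a * b * tripiece η₁ η₂ η₃ k f g x := by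
  unfold tripiece
  rw [← conv_const_mul]
  simp only [conv_const_mul, mul_mul_mul_comm]

theorem tripara_const_mul (Λ : Finset ℤ) (a b : ℂ) (f g : ℝ → ℂ) (x : ℝ) :
    tripara η₁ η₂ η₃ Λ (fun t => a * f t) (fun t => b * g t) x =
      a * b * tripara η₁ η₂ η₃ Λ f g x := by
  simp only [tripara, tripiece_const_mul, Finset.mul_sum]

theorem Bump.tripiece_split (h₁ : Bump C η₁) (h₂ : Bump C η₂) (h₃ : Bump C η₃) (k : ℤ)
    {ff fb fg gf gb gg : ℝ → ℂ} (hff : Adm ff) (hfb : Adm fb) (hfg : Adm fg)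
    (hgf : Adm gf) (hgb : Adm gb) (hgg : Adm gg)
    (hf : ∀ x, f x = ff x + (fb x + fg x)) (hg : ∀ x, g x = gf x + (gb x + gg x)) (x : ℝ) :
    tripiece η₁ η₂ η₃ k f g x =
      (tripiece η₁ η₂ η₃ k ff gf x + tripiece η₁ η₂ η₃ k ff (fun t => gb t + gg t) x +
        tripiece η₁ η₂ η₃ k (fun t => fb t + fg t) gf x) +
      (tripiece η₁ η₂ η₃ k fb (fun t => gb t + gg t) x + tripiece η₁ η₂ η₃ k fg gb x) +
      tripiece η₁ η₂ η₃ k fg gg x := by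
  obtain rfl : f = fun t => ff t + (fb t + fg t) := funext hf
  obtain rfl : g = fun t => gf t + (gb t + gg t) := funext hg
  rw [h₁.tripiece_add_left h₂ h₃ k hff (hfb.add hfg) (hgf.add (hgb.add hgg)),
    h₁.tripiece_add_right h₂ h₃ k hff hgf (hgb.add hgg),
    h₁.tripiece_add_right h₂ h₃ k (hfb.add hfg) hgf (hgb.add hgg),
    h₁.tripiece_add_left h₂ h₃ k hfb hfg (hgb.add hgg),
    h₁.tripiece_add_right h₂ h₃ k hfg hgb hgg]
  ring

end Bilinear

section Modulus

/-- The subadditive modulus `v ↦ ‖v‖_{ℓ^r}^{min(1,r)}` of a finite complex sequence. -/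
noncomputable def modulus (r : ℝ≥0∞) (N : ℕ) (v : ℕ → ℂ) : ℝ≥0∞ :=
  ellN r N (fun i => ‖v i‖ₑ) ^ rhoOf r

variable {r : ℝ≥0∞} {N : ℕ}

theorem modulus_add_le (hr : r ≠ 0) (hr' : r ≠ ∞) (v w : ℕ → ℂ) :
    modulus r N (fun i => v i + w i) ≤ modulus r N v + modulus r N w := by
  refine le_trans (ENNReal.rpow_le_rpow (ellN_mono fun i => ?_) (rhoOf_pos hr hr').le)
    (ellN_rpow_add_le hr hr' _ _)
  exact enorm_add_le _ _

theorem modulus_sum_le (hr : r ≠ 0) (hr' : r ≠ ∞) {ι : Type*} (s : Finset ι) (v : ι → ℕ → ℂ) :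
    modulus r N (fun i => ∑ k ∈ s, v k i) ≤ ∑ k ∈ s, modulus r N (v k) := by
  refine le_trans (ENNReal.rpow_le_rpow (ellN_mono fun i => ?_) (rhoOf_pos hr hr').le)
    (ellN_rpow_sum_le hr hr' s fun k i => ‖v k i‖ₑ)
  exact enorm_sum_le _ _

theorem modulus_neg (v : ℕ → ℂ) : modulus r N (fun i => -v i) = modulus r N v := by
  simp [modulus]

theorem modulus_le_of_sub (hr : r ≠ 0) (hr' : r ≠ ∞) (v w : ℕ → ℂ) :
    modulus r N v ≤ modulus r N w + modulus r N (v - w) := by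
  refine le_trans (le_of_eq ?_) (modulus_add_le hr hr' w (v - w))
  simp

theorem modulus_le_of_sub' (hr : r ≠ 0) (hr' : r ≠ ∞) (v w : ℕ → ℂ) :
    modulus r N w ≤ modulus r N v + modulus r N (v - w) := by
  refine le_trans (modulus_le_of_sub hr hr' w v) (le_of_eq ?_)
  rw [← modulus_neg (w - v)]
  congr 2
  funext i
  simp

theorem modulus_const_mul_le (hr : r ≠ 0) (hr' : r ≠ ∞) (c : ℂ) (v : ℕ → ℂ) :
    modulus r N (fun i => c * v i) ≤ ‖c‖ₑ ^ rhoOf r * modulus r N v := by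
  unfold modulus
  simp only [enorm_mul]
  rw [← ENNReal.mul_rpow_of_nonneg _ _ (rhoOf_pos hr hr').le]
  exact ENNReal.rpow_le_rpow (ellN_const_mul_le hr enorm_ne_top _) (rhoOf_pos hr hr').le

end Modulus

section Pointwise

variable {C B K : ℝ≥0} {η₁ η₂ η₃ : ℝ → ℂ} {r r₁ r₂ : ℝ≥0∞} {N : ℕ}

theorem ConvBound.modulus_tripiece_le (h₃ : Bump C η₃) (hr0 : r ≠ 0) (hr : r ≠ ∞)
    (hH : r⁻¹ = r₁⁻¹ + r₂⁻¹) {k : ℤ} {x : ℝ} {f g : ℕ → ℝ → ℂ} {α β : ℝ≥0∞}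
    (hf : ConvBound r₁ N η₁ k x f α) (hg : ConvBound r₂ N η₂ k x g β) :
    modulus r N (fun i => tripiece η₁ η₂ η₃ k (f i) (g i) x) ≤ (16 * C * (α * β)) ^ rhoOf r :=
  ENNReal.rpow_le_rpow (hf.ellN_tripiece_le h₃ hr0 hr hH hg) (rhoOf_pos hr0 hr).le

theorem ofReal_two_zpow_le_one {n : ℤ} (h : n ≤ 0) : ENNReal.ofReal ((2 : ℝ) ^ n) ≤ 1 := by
  rw [← ENNReal.ofReal_one]
  exact ENNReal.ofReal_le_ofReal (zpow_le_one_of_nonpos₀ one_le_two h)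

theorem CZDecomp.modulus_high_le (h₁ : Bump C η₁) (h₂ : Bump C η₂) (h₃ : Bump C η₃) (hr0 : r ≠ 0)
    (hr : r ≠ ∞) (hH : r⁻¹ = r₁⁻¹ + r₂⁻¹) {p₀ q₀ : ℝ≥0∞} {m : ℤ} {x y : ℝ}
    {f ff fb fg g gf gb gg : ℕ → ℝ → ℂ} {E E' : Set ℝ} {β β' : ℤ → ℝ → ℝ≥0∞}
    (Df : CZDecomp C B K (rhoOf r) η₁ r₁ p₀ N m y f ff fb fg E β)
    (Dg : CZDecomp C B K (rhoOf r) η₂ r₂ q₀ N m y g gf gb gg E' β')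
    (hx : x ∈ cell m (idx m y)) (hxE : x ∉ E) (hxE' : x ∉ E') (Λ : Finset ℤ)
    (hΛ : ∀ k ∈ Λ, m < k) :
    modulus r N (fun i => tripara η₁ η₂ η₃ Λ (f i) (g i) x) ≤
      ∑ k ∈ Λ, 3 * ((16 * C * (C * C * (128 * (128 + 4 * B)))) ^ rhoOf r *
        ENNReal.ofReal (2 ^ (m - k)) ^ rhoOf r) +
      (16 * C * (C * C * (32 * B))) ^ rhoOf r *
        (∑ k ∈ Λ, β k x ^ rhoOf r + ∑ k ∈ Λ, β' k x ^ rhoOf r) +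
      modulus r N (fun i => tripara η₁ η₂ η₃ Λ (fg i) (gg i) x) := by
  have hρ := rhoOf_pos hr0 hr
  have e : (fun i => tripara η₁ η₂ η₃ Λ (f i) (g i) x) = fun i =>
      ∑ k ∈ Λ, ((tripiece η₁ η₂ η₃ k (ff i) (gf i) x +
        tripiece η₁ η₂ η₃ k (ff i) (fun t => gb i t + gg i t) x +
        tripiece η₁ η₂ η₃ k (fun t => fb i t + fg i t) (gf i) x) +
      (tripiece η₁ η₂ η₃ k (fb i) (fun t => gb i t + gg i t) x +
        tripiece η₁ η₂ η₃ k (fg i) (gb i) x)) + tripara η₁ η₂ η₃ Λ (fg i) (gg i) x := by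
    funext i
    simp only [tripara]
    rw [← Finset.sum_add_distrib]
    exact Finset.sum_congr rfl fun k _ => h₁.tripiece_split h₂ h₃ k (Df.adm_far i)
      (Df.adm_bad i) (Df.adm_good i) (Dg.adm_far i) (Dg.adm_bad i) (Dg.adm_good i)
      (Df.eq_add i) (Dg.eq_add i) x
  rw [e]
  refine (modulus_add_le hr0 hr _ _).trans (add_le_add ?_ le_rfl)
  refine (modulus_sum_le hr0 hr _ _).trans ?_
  rw [mul_add (_ ^ rhoOf r), Finset.mul_sum, Finset.mul_sum, ← Finset.sum_add_distrib,
      ← Finset.sum_add_distrib]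
  refine Finset.sum_le_sum fun k hk => ?_
  have hle : ENNReal.ofReal ((2 : ℝ) ^ (m - k)) ≤ 1 :=
    ofReal_two_zpow_le_one (by have := hΛ k hk; omega)
  set δ := ENNReal.ofReal ((2 : ℝ) ^ (m - k)) with hδ
  have b1 := (Df.far k x hx).modulus_tripiece_le h₃ hr0 hr hH (Dg.far k x hx)
  have b2 := (Df.far k x hx).modulus_tripiece_le h₃ hr0 hr hH (Dg.near k x hxE')
  have b3 := (Df.near k x hxE).modulus_tripiece_le h₃ hr0 hr hH (Dg.far k x hx)
  have b4 := (Df.bad k x hxE).modulus_tripiece_le h₃ hr0 hr hH (Dg.near k x hxE')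
  have b5 := (Df.good k x).modulus_tripiece_le h₃ hr0 hr hH (Dg.bad k x hxE')
  refine (modulus_add_le hr0 hr _ _).trans (add_le_add ?_ ?_)
  · refine (modulus_add_le hr0 hr _ _).trans ?_
    refine (add_le_add (modulus_add_le hr0 hr _ _) le_rfl).trans ?_
    rw [← ENNReal.mul_rpow_of_nonneg _ _ hρ.le]
    rw [show (3 : ℝ≥0∞) = 1 + 1 + 1 by norm_num, add_mul, add_mul, one_mul]
    refine add_le_add (add_le_add (b1.trans ?_) (b2.trans ?_)) (b3.trans ?_) <;>
      refine ENNReal.rpow_le_rpow ?_ hρ.le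
    · calc (16 * C * (C * (128 * δ) * (C * (128 * δ))) : ℝ≥0∞)
          = 16 * C * (C * C * (128 * 128)) * δ * δ := by ring
        _ ≤ 16 * C * (C * C * (128 * (128 + 4 * B))) * δ * 1 := by
            refine mul_le_mul' (mul_le_mul' (mul_le_mul' le_rfl (mul_le_mul' le_rfl
              (mul_le_mul' le_rfl le_self_add))) le_rfl) hle
        _ = _ := mul_one _
    · calc (16 * C * (C * (128 * δ) * (C * (4 * B))) : ℝ≥0∞)
          = 16 * C * (C * C * (128 * (4 * B))) * δ := by ring
        _ ≤ 16 * C * (C * C * (128 * (128 + 4 * B))) * δ :=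
            mul_le_mul' (mul_le_mul' le_rfl (mul_le_mul' le_rfl
              (mul_le_mul' le_rfl le_add_self))) le_rfl
    · calc (16 * C * (C * (4 * B) * (C * (128 * δ))) : ℝ≥0∞)
          = 16 * C * (C * C * (128 * (4 * B))) * δ := by ring
        _ ≤ 16 * C * (C * C * (128 * (128 + 4 * B))) * δ :=
            mul_le_mul' (mul_le_mul' le_rfl (mul_le_mul' le_rfl
              (mul_le_mul' le_rfl le_add_self))) le_rfl
  · refine (modulus_add_le hr0 hr _ _).trans ?_
    rw [← ENNReal.mul_rpow_of_nonneg _ _ hρ.le, ← ENNReal.mul_rpow_of_nonneg _ _ hρ.le]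
    refine add_le_add (b4.trans ?_) (b5.trans ?_) <;> refine ENNReal.rpow_le_rpow ?_ hρ.le
    · calc (16 * C * (C * β k x * (C * (4 * B))) : ℝ≥0∞)
          = 16 * C * (C * C * (4 * B)) * β k x := by ring
        _ ≤ 16 * C * (C * C * (32 * B)) * β k x :=
            mul_le_mul' (mul_le_mul' le_rfl (mul_le_mul' le_rfl
              (mul_le_mul' (by norm_num) le_rfl))) le_rfl
    · exact le_of_eq (by ring)

theorem Bump.modulus_low_le (h₁ : Bump C η₁) (h₂ : Bump C η₂) (h₃ : Bump C η₃) (hr0 : r ≠ 0)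
    (hr : r ≠ ∞) (hr₁ : 1 ≤ r₁) (hr₂ : 1 ≤ r₂) (hH : r⁻¹ = r₁⁻¹ + r₂⁻¹) {m : ℤ} {x x' y : ℝ}
    {f g : ℕ → ℝ → ℂ} (hf : ∀ i, Adm (f i)) (hg : ∀ i, Adm (g i))
    (hfy : hl (fun x => ellN r₁ N fun i => ‖f i x‖ₑ) y ≤ 1)
    (hgy : hl (fun x => ellN r₂ N fun i => ‖g i x‖ₑ) y ≤ 1)
    (hx : x ∈ cell m (idx m y)) (hx' : x' ∈ cell m (idx m y)) (Λ : Finset ℤ)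
    (hΛ : ∀ k ∈ Λ, k ≤ m) :
    modulus r N (fun i => tripara η₁ η₂ η₃ Λ (f i) (g i) x - tripara η₁ η₂ η₃ Λ (f i) (g i) x') ≤
      ∑ k ∈ Λ, (512 * C * (C * 32 * (C * 32))) ^ rhoOf r *
        ENNReal.ofReal (2 ^ (k - m)) ^ rhoOf r := by
  have hρ := rhoOf_pos hr0 hr
  simp only [tripara, ← Finset.sum_sub_distrib]
  refine (modulus_sum_le hr0 hr _ _).trans (Finset.sum_le_sum fun k hk => ?_)
  rw [← ENNReal.mul_rpow_of_nonneg _ _ hρ.le]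
  refine ENNReal.rpow_le_rpow ?_ hρ.le
  have hmk : (2 : ℝ) ^ (-m) ≤ 2 ^ (-k) :=
    zpow_le_zpow_right₀ one_le_two (by have := hΛ k hk; omega)
  have key : ∀ {t : ℝ≥0∞} {η : ℝ → ℂ} {u : ℕ → ℝ → ℂ}, Bump C η → 1 ≤ t → (∀ i, Adm (u i)) →
      hl (fun x => ellN t N fun i => ‖u i x‖ₑ) y ≤ 1 → ConvBound t N η k x u (C * 32) := by
    intro t η u hη ht hu huy
    refine (hη.convBound ht (fun i => (hu i).meas) N k x).mono (mul_le_mul' le_rfl ?_)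
    refine (wavg_le_of_near (x := y) ?_ _).trans ((mul_le_mul' le_rfl (wavg_le_hl
      (measurable_ellN fun i => (hu i).meas.enorm) k y)).trans ?_)
    · exact ((dist_lt_of_mem_cell (mem_cell_idx m y) hx).le).trans hmk
    · refine (mul_le_mul' le_rfl (mul_le_mul' le_rfl huy)).trans (by norm_num)
  refine (ConvBound.ellN_tripiece_sub_le h₁ h₂ h₃ hr0 hr hH hf hg (key h₁ hr₁ hf hfy)
    (key h₂ hr₂ hg hgy) ((dist_lt_of_mem_cell hx hx').le.trans hmk)).trans ?_
  calc (512 * C * ENNReal.ofReal (2 ^ k * |x - x'|) * (C * 32 * (C * 32)) : ℝ≥0∞)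
      = 512 * C * (C * 32 * (C * 32)) * ENNReal.ofReal (2 ^ k * |x - x'|) := by ring
    _ ≤ _ := by
      refine mul_le_mul' le_rfl (ENNReal.ofReal_le_ofReal ?_)
      rw [sub_eq_add_neg k m, zpow_add₀ two_ne_zero]
      exact mul_le_mul_of_nonneg_left (dist_lt_of_mem_cell hx hx').le (by positivity)

end Pointwise

/-- The `L^p(ℓ^{r₁}) × L^q(ℓ^{r₂}) → L^s(ℓ^r)` bound for truncated paraproducts of length `N`
sequences, with constant `C`, uniformly over the truncation. -/
def VectorBound (η₁ η₂ η₃ : ℝ → ℂ) (r₁ r₂ r p q s : ℝ≥0∞) (C : ℝ≥0) (N : ℕ) : Prop :=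
  ∀ (Λ : Finset ℤ) (f g : ℕ → ℝ → ℂ), (∀ i, Adm (f i)) → (∀ i, Adm (g i)) →
    LqNorm volume s (fun x => ellN r N fun i => ‖tripara η₁ η₂ η₃ Λ (f i) (g i) x‖ₑ) ≤
      C * LqNorm volume p (fun x => ellN r₁ N fun i => ‖f i x‖ₑ) *
        LqNorm volume q (fun x => ellN r₂ N fun i => ‖g i x‖ₑ)

theorem le_mul_of_div_mul_le {b ε : ℝ≥0} (hε : 0 < ε) {v w : ℝ≥0∞}
    (h : ((b + 1) / ε : ℝ≥0) * v ≤ b * w) : v ≤ ε * w := by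
  set a : ℝ≥0 := (b + 1) / ε with ha
  have ha0 : a ≠ 0 := by positivity
  have hab : a⁻¹ * b ≤ ε := by
    rw [ha, inv_div, div_mul_eq_mul_div]
    refine div_le_of_le_mul₀ (by positivity) (by positivity) ?_
    exact mul_le_mul' le_rfl le_self_add
  calc v = ((a⁻¹ * a : ℝ≥0) : ℝ≥0∞) * v := by rw [inv_mul_cancel₀ ha0]; simp
    _ = (a⁻¹ : ℝ≥0) * (a * v) := by push_cast [mul_assoc]; rfl
    _ ≤ (a⁻¹ : ℝ≥0) * (b * w) := mul_le_mul' le_rfl h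
    _ = ((a⁻¹ * b : ℝ≥0) : ℝ≥0∞) * w := by push_cast [mul_assoc]; rfl
    _ ≤ ε * w := by gcongr

section Oscillation

variable {C B K C₀ : ℝ≥0} {η₁ η₂ η₃ : ℝ → ℂ} {r r₁ r₂ p₀ q₀ s₀ : ℝ≥0∞} {N : ℕ}

theorem VectorBound.lintegral_good_le (H : VectorBound η₁ η₂ η₃ r₁ r₂ r p₀ q₀ s₀ C₀ N)
    (hs0 : s₀ ≠ 0) (hs : s₀ ≠ ∞) (hHs : s₀⁻¹ = p₀⁻¹ + q₀⁻¹) {B : ℝ≥0} {v : ℝ≥0∞}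
    (hv0 : v ≠ 0) (hv : v ≠ ∞) {f g : ℕ → ℝ → ℂ} (hf : ∀ i, Adm (f i)) (hg : ∀ i, Adm (g i))
    (hfB : LqNorm volume p₀ (fun x => ellN r₁ N fun i => ‖f i x‖ₑ) ≤ 2 * B * v ^ (1 / p₀.toReal))
    (hgB : LqNorm volume q₀ (fun x => ellN r₂ N fun i => ‖g i x‖ₑ) ≤ 2 * B * v ^ (1 / q₀.toReal))
    (Λ : Finset ℤ) :
    ∫⁻ x, (ellN r N fun i => ‖tripara η₁ η₂ η₃ Λ (f i) (g i) x‖ₑ) ^ s₀.toReal ≤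
      ((4 * C₀ * B ^ 2) ^ s₀.toReal : ℝ≥0) * v := by
  have hs' : 0 < s₀.toReal := ENNReal.toReal_pos hs0 hs
  have h := (H Λ f g hf hg).trans (mul_le_mul' (mul_le_mul' le_rfl hfB) hgB)
  rw [LqNorm, if_neg hs] at h
  have h' := ENNReal.rpow_le_rpow h hs'.le
  rw [← ENNReal.rpow_mul, one_div_mul_cancel hs'.ne', ENNReal.rpow_one] at h'
  refine h'.trans (le_of_eq ?_)
  have e : ((C₀ : ℝ≥0∞) * (2 * B * v ^ (1 / p₀.toReal)) * (2 * B * v ^ (1 / q₀.toReal))) =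
      ((4 * C₀ * B ^ 2 : ℝ≥0) : ℝ≥0∞) * v ^ (1 / s₀.toReal) := by
    rw [holder_toReal hs0 hHs, ENNReal.rpow_add _ _ hv0 hv]
    push_cast
    ring
  rw [e, ENNReal.mul_rpow_of_nonneg _ _ hs'.le, ← ENNReal.rpow_mul, one_div_mul_cancel hs'.ne',
    ENNReal.rpow_one, ENNReal.coe_rpow_of_nonneg _ hs'.le]

theorem volume_lt_le_of_lintegral_le {G : ℝ → ℝ≥0∞} (hG : AEMeasurable G) {b ε : ℝ≥0} (hε : 0 < ε)
    {w : ℝ≥0∞} (h : ∫⁻ x, G x ≤ b * w) : volume {x | ((b + 1) / ε : ℝ≥0) < G x} ≤ ε * w := by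
  refine le_mul_of_div_mul_le (b := b) hε (le_trans ?_ h)
  refine le_trans (mul_le_mul' le_rfl (measure_mono fun x hx => ?_))
    (mul_meas_ge_le_lintegral₀ hG (((b + 1) / ε : ℝ≥0) : ℝ≥0∞))
  exact le_of_lt (Set.mem_ofPred_eq ▸ hx)

theorem VectorBound.exists_volume_osc_le (h₁ : Bump C η₁) (h₂ : Bump C η₂) (h₃ : Bump C η₃)
    (hr0 : 1 / 2 < r) (hr : r ≠ ∞) (hr₁ : 1 ≤ r₁) (hr₂ : 1 ≤ r₂) (hH : r⁻¹ = r₁⁻¹ + r₂⁻¹)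
    (hs0 : s₀ ≠ 0) (hs : s₀ ≠ ∞) (hHs : s₀⁻¹ = p₀⁻¹ + q₀⁻¹) (C₀ : ℝ≥0) {ε : ℝ≥0} (hε : 0 < ε) :
    ∃ K : ℝ≥0, ∀ N, VectorBound η₁ η₂ η₃ r₁ r₂ r p₀ q₀ s₀ C₀ N →
      ∀ (Λ : Finset ℤ) (m : ℤ) (y : ℝ) (f g : ℕ → ℝ → ℂ), (∀ i, Adm (f i)) → (∀ i, Adm (g i)) →
      hl (fun x => ellN r₁ N fun i => ‖f i x‖ₑ) y ≤ 1 →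
      hl (fun x => ellN r₂ N fun i => ‖g i x‖ₑ) y ≤ 1 →
      volume {x | x ∈ cell m (idx m y) ∧ (K : ℝ≥0∞) < modulus r N fun i =>
        tripara η₁ η₂ η₃ Λ (f i) (g i) x -
          tripara η₁ η₂ η₃ (Λ.filter (· ≤ m)) (f i) (g i) (2 ^ (-m) * idx m y)} ≤
        ε * ENNReal.ofReal (2 ^ (-m)) := by
  have hr00 : r ≠ 0 := (zero_le.trans_lt hr0).ne'
  have hρ := rhoOf_pos hr00 hr
  have hp₀ := holder_ne_zero_left hs0 hHs
  have hq₀ := holder_ne_zero_left hs0 (hHs.trans (add_comm _ _))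
  have hs' : 0 < s₀.toReal := ENNReal.toReal_pos hs0 hs
  set δ : ℝ≥0 := ε / 5 with hδ
  have hδ0 : 0 < δ := by positivity
  obtain ⟨B, hB⟩ : ∃ B : ℝ≥0, B = (32 + 1) / δ + 2 := ⟨_, rfl⟩
  obtain ⟨K₁, hK₁⟩ := exists_czDecomp (half_lt_rhoOf hr0 hr) rhoOf_le_one (B := B)
    (hB ▸ le_add_self)
  obtain ⟨c, hc⟩ := exists_sum_geometric_le hρ
  set D₁ : ℝ≥0 := (K₁ + 1) / δ with hD₁
  set b : ℝ≥0 := (4 * C₀ * B ^ 2) ^ s₀.toReal * 8 with hb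
  set L : ℝ≥0 := (b + 1) / δ with hL
  set M₁ : ℝ≥0 := (512 * C * (C * 32 * (C * 32))) ^ rhoOf r with hM₁
  set M₂ : ℝ≥0 := (16 * C * (C * C * (128 * (128 + 4 * B)))) ^ rhoOf r with hM₂
  set M₃ : ℝ≥0 := (16 * C * (C * C * (32 * B))) ^ rhoOf r with hM₃
  refine ⟨M₁ * c + (3 * (M₂ * c) + M₃ * (D₁ + D₁) + (L ^ (1 / s₀.toReal)) ^ rhoOf r),
    fun N HN Λ m y f g hf hg hfy hgy => ?_⟩
  obtain ⟨ff, fb, fg, E, β, Df⟩ := hK₁ h₁ hr₁ hp₀ N m y f hf hfy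
  obtain ⟨gf, gb, gg, E', β', Dg⟩ := hK₁ h₂ hr₂ hq₀ N m y g hg hgy
  set w := ENNReal.ofReal ((2 : ℝ) ^ (-m)) with hw
  have hw0 : w ≠ 0 := by simp [hw]; positivity
  set Λ₁ := Λ.filter (· ≤ m)
  set Λ₂ := Λ.filter (¬ · ≤ m)
  have hE : ∀ {E : Set ℝ}, B * volume E ≤ 32 * w → volume E ≤ δ * w := fun {E} h => by
    refine le_mul_of_div_mul_le (b := 32)
        hδ0 (le_trans (mul_le_mul' ?_ le_rfl) (by exact_mod_cast h))
    exact ENNReal.coe_le_coe.2 (hB ▸ le_self_add)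
  have hbad : ∀ {E : Set ℝ} {β : ℤ → ℝ → ℝ≥0∞}, MeasurableSet E → (∀ k, Measurable (β k)) →
      ∫⁻ x in Eᶜ, ∑ k ∈ Λ₂, β k x ^ rhoOf r ≤ K₁ * w →
      volume {x | (D₁ : ℝ≥0∞) < Eᶜ.indicator (fun x => ∑ k ∈ Λ₂, β k x ^ rhoOf r) x} ≤ δ * w := by
    intro E β hE hβ h
    rw [← lintegral_indicator hE.compl] at h
    refine volume_lt_le_of_lintegral_le ?_ hδ0 h
    exact ((Finset.measurable_sum _ fun k _ => (hβ k).pow_const _).indicator hE.compl).aemeasurable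
  have hgood := HN.lintegral_good_le hs0 hs hHs (B := B) (v := 8 * w) (by simpa using hw0)
    (by finiteness) Df.adm_good Dg.adm_good Df.good_norm_le Dg.good_norm_le Λ₂
  have hTm : ∀ i, Measurable (tripara η₁ η₂ η₃ Λ₂ (fg i) (gg i)) := fun i =>
    (h₁.continuous_tripara h₂ h₃ Λ₂ (Df.adm_good i) (Dg.adm_good i)).measurable
  have hgood' : volume {x | (L : ℝ≥0∞) <
      (ellN r N fun i => ‖tripara η₁ η₂ η₃ Λ₂ (fg i) (gg i) x‖ₑ) ^ s₀.toReal} ≤ δ * w := by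
    refine volume_lt_le_of_lintegral_le ?_ hδ0 (hgood.trans (le_of_eq ?_))
    · exact ((measurable_ellN fun i => (hTm i).enorm).pow_const _).aemeasurable
    · rw [hb]; push_cast; ring
  have hsub : {x | x ∈ cell m (idx m y) ∧
      ((M₁ * c + (3 * (M₂ * c) + M₃ * (D₁ + D₁) + (L ^ (1 / s₀.toReal)) ^ rhoOf r) : ℝ≥0) : ℝ≥0∞) <
        modulus r N fun i => tripara η₁ η₂ η₃ Λ (f i) (g i) x -
          tripara η₁ η₂ η₃ Λ₁ (f i) (g i) (2 ^ (-m) * idx m y)} ⊆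
      E ∪ (E' ∪ ({x | (D₁ : ℝ≥0∞) < Eᶜ.indicator (fun x => ∑ k ∈ Λ₂, β k x ^ rhoOf r) x} ∪
        ({x | (D₁ : ℝ≥0∞) < E'ᶜ.indicator (fun x => ∑ k ∈ Λ₂, β' k x ^ rhoOf r) x} ∪
        {x | (L : ℝ≥0∞) <
          (ellN r N fun i => ‖tripara η₁ η₂ η₃ Λ₂ (fg i) (gg i) x‖ₑ) ^ s₀.toReal}))) := by
    rintro x ⟨hx, hKx⟩
    by_contra hcon
    simp only [Set.mem_union, Set.mem_ofPred_eq, not_or, not_lt] at hcon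
    obtain ⟨hxE, hxE', hxβ, hxβ', hxL⟩ := hcon
    rw [Set.indicator_of_mem (by exact hxE)] at hxβ
    rw [Set.indicator_of_mem (by exact hxE')] at hxβ'
    refine hKx.not_ge ?_
    have e : (fun i => tripara η₁ η₂ η₃ Λ (f i) (g i) x -
          tripara η₁ η₂ η₃ Λ₁ (f i) (g i) (2 ^ (-m) * idx m y)) = fun i =>
        (tripara η₁ η₂ η₃ Λ₁ (f i) (g i) x -
          tripara η₁ η₂ η₃ Λ₁ (f i) (g i) (2 ^ (-m) * idx m y)) +
        tripara η₁ η₂ η₃ Λ₂ (f i) (g i) x := by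
      funext i
      have : tripara η₁ η₂ η₃ Λ (f i) (g i) x = tripara η₁ η₂ η₃ Λ₁ (f i) (g i) x +
          tripara η₁ η₂ η₃ Λ₂ (f i) (g i) x :=
        (Finset.sum_filter_add_sum_filter_not Λ (· ≤ m) _).symm
      rw [this]
      ring
    rw [e]
    refine (modulus_add_le hr00 hr _ _).trans ?_
    rw [ENNReal.coe_add]
    refine add_le_add ?_ ?_
    · refine (h₁.modulus_low_le h₂ h₃ hr00 hr hr₁ hr₂ hH hf hg hfy hgy hx (left_mem_cell m _) Λ₁
        fun k hk => (Finset.mem_filter.1 hk).2).trans ?_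
      rw [← Finset.mul_sum, ENNReal.coe_mul, hM₁, ENNReal.coe_rpow_of_nonneg _ hρ.le]
      push_cast
      refine mul_le_mul' le_rfl (le_trans (le_of_eq ?_) (hc m Λ₁))
      refine Finset.sum_congr rfl fun k hk => ?_
      have : k ≤ m := (Finset.mem_filter.1 hk).2
      rw [abs_of_nonpos (by omega), neg_neg]
    · refine (Df.modulus_high_le h₁ h₂ h₃ hr00 hr hH Dg hx hxE hxE' Λ₂
        fun k hk => not_le.1 (Finset.mem_filter.1 hk).2).trans ?_
      rw [ENNReal.coe_add, ENNReal.coe_add]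
      refine add_le_add (add_le_add ?_ ?_) ?_
      · rw [← Finset.mul_sum, ← Finset.mul_sum, ENNReal.coe_mul, ENNReal.coe_mul, hM₂,
          ENNReal.coe_rpow_of_nonneg _ hρ.le]
        push_cast
        refine mul_le_mul' le_rfl (mul_le_mul' le_rfl (le_trans (le_of_eq ?_) (hc m Λ₂)))
        refine Finset.sum_congr rfl fun k hk => ?_
        have : ¬ k ≤ m := (Finset.mem_filter.1 hk).2
        rw [abs_of_nonneg (by omega), neg_sub]
      · rw [ENNReal.coe_mul, hM₃, ENNReal.coe_rpow_of_nonneg _ hρ.le, ENNReal.coe_add]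
        push_cast
        exact mul_le_mul' le_rfl (add_le_add hxβ hxβ')
      · rw [ENNReal.coe_rpow_of_nonneg _ hρ.le, ENNReal.coe_rpow_of_nonneg _ (by positivity)]
        refine ENNReal.rpow_le_rpow ?_ hρ.le
        rwa [one_div, ENNReal.le_rpow_inv_iff hs']
  calc _ ≤ _ := measure_mono hsub
    _ ≤ δ * w + (δ * w + (δ * w + (δ * w + δ * w))) := by
      refine (measure_union_le _ _).trans (add_le_add (hE Df.measure_le) ?_)
      refine (measure_union_le _ _).trans (add_le_add (hE Dg.measure_le) ?_)
      refine (measure_union_le _ _).trans (add_le_add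
        (hbad Df.measurableSet Df.measurable_bad (Df.bad_le Λ₂)) ?_)
      exact (measure_union_le _ _).trans (add_le_add
        (hbad Dg.measurableSet Dg.measurable_bad (Dg.bad_le Λ₂)) hgood')
    _ = ((5 * δ : ℝ≥0) : ℝ≥0∞) * w := by push_cast; ring
    _ = ε * w := by rw [hδ, mul_div_cancel₀ _ (by norm_num)]

end Oscillation

theorem hl_const_mul_le {F : ℝ → ℝ≥0∞} {c : ℝ≥0∞} (hc : c ≠ ∞) (x : ℝ) :
    hl (fun y => c * F y) x ≤ c * hl F x := by
  refine iSup_le fun n => ?_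
  rw [lintegral_const_mul' _ _ hc, mul_left_comm]
  exact mul_le_mul' le_rfl (le_iSup (fun n : ℤ => ENNReal.ofReal ((2 : ℝ) ^ n) *
    ∫⁻ y in Metric.closedBall x ((2 : ℝ) ^ (-n)), F y) n)

theorem Adm.exists_ellN_le {t : ℝ≥0∞} (N : ℕ) {f : ℕ → ℝ → ℂ} (hf : ∀ i, Adm (f i)) :
    ∃ B : ℝ≥0, ∀ x, ellN t N (fun i => ‖f i x‖ₑ) ≤ B := by
  choose M hM using fun i => (hf i).bdd
  refine ⟨(ellN t N fun i => ENNReal.ofReal (M i)).toNNReal, fun x => ?_⟩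
  rw [ENNReal.coe_toNNReal (ellN_ne_top fun i => ENNReal.ofReal_ne_top)]
  refine ellN_mono fun i => ?_
  rw [← ofReal_norm]
  exact ENNReal.ofReal_le_ofReal (hM i x)

theorem hl_ellN_ne_top {t : ℝ≥0∞} {N : ℕ} {f : ℕ → ℝ → ℂ} (hf : ∀ i, Adm (f i)) (x : ℝ) :
    hl (fun x => ellN t N fun i => ‖f i x‖ₑ) x ≠ ∞ := by
  obtain ⟨B, hB⟩ := Adm.exists_ellN_le (t := t) N hf
  exact ne_top_of_le_ne_top (by finiteness : 2 * (B : ℝ≥0∞) ≠ ∞)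
    (hl_le_of_ae_le (Filter.Eventually.of_forall hB) x)

theorem hl_ellN_inv_mul_le {t : ℝ≥0∞} (ht : t ≠ 0) {N : ℕ} {f : ℕ → ℝ → ℂ} {y : ℝ} {a : ℝ≥0}
    (ha : 0 < a) (h : hl (fun x => ellN t N fun i => ‖f i x‖ₑ) y ≤ a) :
    hl (fun x => ellN t N fun i => ‖((a : ℂ)⁻¹) * f i x‖ₑ) y ≤ 1 := by
  have hn : ‖((a : ℂ)⁻¹)‖ₑ = (a : ℝ≥0∞)⁻¹ := by
    rw [← ENNReal.coe_inv ha.ne', enorm_eq_nnnorm]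
    congr 1
    ext
    simp
  have ha' : (a : ℝ≥0∞)⁻¹ ≠ ∞ := by simp [ha.ne']
  simp only [enorm_mul, hn]
  refine (hl_mono (fun x => ellN_const_mul_le ht ha' _) y).trans ((hl_const_mul_le ha' y).trans ?_)
  exact (mul_le_mul' le_rfl h).trans (ENNReal.inv_mul_cancel (by simp [ha.ne']) (by simp)).le

section Extrapolation

variable {C : ℝ≥0} {η₁ η₂ η₃ : ℝ → ℂ} {r r₁ r₂ p q s p₀ q₀ s₀ : ℝ≥0∞}

theorem VectorBound.exists_volume_osc_le_of_pos (h₁ : Bump C η₁) (h₂ : Bump C η₂) (h₃ : Bump C η₃)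
    (hr0 : 1 / 2 < r) (hr : r ≠ ∞) (hr₁ : 1 ≤ r₁) (hr₂ : 1 ≤ r₂) (hH : r⁻¹ = r₁⁻¹ + r₂⁻¹)
    (hs0 : s₀ ≠ 0) (hs : s₀ ≠ ∞) (hHs : s₀⁻¹ = p₀⁻¹ + q₀⁻¹) (C₀ : ℝ≥0) {ε : ℝ≥0} (hε : 0 < ε) :
    ∃ K : ℝ≥0, ∀ N, VectorBound η₁ η₂ η₃ r₁ r₂ r p₀ q₀ s₀ C₀ N →
      ∀ (Λ : Finset ℤ) (m : ℤ) (y : ℝ) (f g : ℕ → ℝ → ℂ), (∀ i, Adm (f i)) → (∀ i, Adm (g i)) →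
      ∀ a b : ℝ≥0, 0 < a → 0 < b →
      hl (fun x => ellN r₁ N fun i => ‖f i x‖ₑ) y ≤ a →
      hl (fun x => ellN r₂ N fun i => ‖g i x‖ₑ) y ≤ b →
      volume {x | x ∈ cell m (idx m y) ∧ (K * (a * b) ^ rhoOf r : ℝ≥0∞) < modulus r N fun i =>
        tripara η₁ η₂ η₃ Λ (f i) (g i) x -
          tripara η₁ η₂ η₃ (Λ.filter (· ≤ m)) (f i) (g i) (2 ^ (-m) * idx m y)} ≤
        ε * ENNReal.ofReal (2 ^ (-m)) := by
  have hr00 : r ≠ 0 := (zero_le.trans_lt hr0).ne'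
  obtain ⟨K, hK⟩ := VectorBound.exists_volume_osc_le h₁ h₂ h₃ hr0 hr hr₁ hr₂ hH hs0 hs hHs C₀ hε
  refine ⟨K, fun N HN Λ m y f g hf hg a b ha hb hfy hgy => ?_⟩
  refine le_trans (measure_mono ?_) (hK N HN Λ m y (fun i x => (a : ℂ)⁻¹ * f i x)
    (fun i x => (b : ℂ)⁻¹ * g i x) (fun i => (hf i).const_mul _) (fun i => (hg i).const_mul _)
    (hl_ellN_inv_mul_le (zero_lt_one.trans_le hr₁).ne' ha hfy)
    (hl_ellN_inv_mul_le (zero_lt_one.trans_le hr₂).ne' hb hgy))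
  rintro x ⟨hx, hlt⟩
  refine ⟨hx, ?_⟩
  simp only [tripara_const_mul, ← mul_sub]
  set d : ℕ → ℂ := fun i => tripara η₁ η₂ η₃ Λ (f i) (g i) x -
    tripara η₁ η₂ η₃ (Λ.filter (· ≤ m)) (f i) (g i) (2 ^ (-m) * idx m y) with hd
  have ha' : (a : ℂ) ≠ 0 := by simpa using ha.ne'
  have hb' : (b : ℂ) ≠ 0 := by simpa using hb.ne'
  have e : modulus r N d ≤
      (a * b : ℝ≥0∞) ^ rhoOf r * modulus r N (fun i => (a : ℂ)⁻¹ * (b : ℂ)⁻¹ * d i) := by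
    have := modulus_const_mul_le (N := N) hr00 hr ((a : ℂ) * b)
      (fun i => (a : ℂ)⁻¹ * (b : ℂ)⁻¹ * d i)
    have hn : ‖(a : ℂ) * b‖ₑ = (a * b : ℝ≥0∞) := by
      rw [← ENNReal.coe_mul, enorm_eq_nnnorm]
      congr 1
      ext
      simp
    rw [hn] at this
    convert this using 3 with i
    field_simp
  rw [mul_comm] at hlt
  exact lt_of_mul_lt_mul_left' (hlt.trans_le e)

theorem VectorBound.exists_volume_osc_le_hl (h₁ : Bump C η₁) (h₂ : Bump C η₂) (h₃ : Bump C η₃)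
    (hr0 : 1 / 2 < r) (hr : r ≠ ∞) (hr₁ : 1 ≤ r₁) (hr₂ : 1 ≤ r₂) (hH : r⁻¹ = r₁⁻¹ + r₂⁻¹)
    (hs0 : s₀ ≠ 0) (hs : s₀ ≠ ∞) (hHs : s₀⁻¹ = p₀⁻¹ + q₀⁻¹) (C₀ : ℝ≥0) {ε : ℝ≥0} (hε : 0 < ε) :
    ∃ K : ℝ≥0, ∀ N, VectorBound η₁ η₂ η₃ r₁ r₂ r p₀ q₀ s₀ C₀ N →
      ∀ (Λ : Finset ℤ) (m : ℤ) (y : ℝ) (f g : ℕ → ℝ → ℂ), (∀ i, Adm (f i)) → (∀ i, Adm (g i)) →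
      volume {x | x ∈ cell m (idx m y) ∧
        (K * (hl (fun x => ellN r₁ N fun i => ‖f i x‖ₑ) y *
          hl (fun x => ellN r₂ N fun i => ‖g i x‖ₑ) y) ^ rhoOf r : ℝ≥0∞) <
        modulus r N fun i => tripara η₁ η₂ η₃ Λ (f i) (g i) x -
          tripara η₁ η₂ η₃ (Λ.filter (· ≤ m)) (f i) (g i) (2 ^ (-m) * idx m y)} ≤
        ε * ENNReal.ofReal (2 ^ (-m)) := by
  have hr00 : r ≠ 0 := (zero_le.trans_lt hr0).ne'
  have hρ := rhoOf_pos hr00 hr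
  obtain ⟨K, hK⟩ :=
    VectorBound.exists_volume_osc_le_of_pos h₁ h₂ h₃ hr0 hr hr₁ hr₂ hH hs0 hs hHs C₀ hε
  refine ⟨K, fun N HN Λ m y f g hf hg => ?_⟩
  obtain ⟨a, ha⟩ : ∃ a : ℝ≥0, a = hl (fun x => ellN r₁ N fun i => ‖f i x‖ₑ) y :=
    ⟨_, ENNReal.coe_toNNReal (hl_ellN_ne_top hf y)⟩
  obtain ⟨b, hb⟩ : ∃ b : ℝ≥0, b = hl (fun x => ellN r₂ N fun i => ‖g i x‖ₑ) y :=
    ⟨_, ENNReal.coe_toNNReal (hl_ellN_ne_top hg y)⟩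
  rw [← ha, ← hb]
  set d : ℝ → ℝ≥0∞ := fun x => modulus r N fun i => tripara η₁ η₂ η₃ Λ (f i) (g i) x -
    tripara η₁ η₂ η₃ (Λ.filter (· ≤ m)) (f i) (g i) (2 ^ (-m) * idx m y) with hd
  let e : ℕ → ℝ≥0 := fun j => 1 / ((j : ℝ≥0) + 1)
  have he : Filter.Tendsto e Filter.atTop (nhds 0) := tendsto_one_div_add_atTop_nhds_zero_nat
  let T : ℕ → ℝ≥0 := fun j => K * ((a + e j) * (b + e j)) ^ rhoOf r
  have hT : Filter.Tendsto T Filter.atTop (nhds (K * (a * b) ^ rhoOf r)) := by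
    have h1 : Filter.Tendsto (fun j => (a + e j) * (b + e j)) Filter.atTop (nhds (a * b)) := by
      simpa using (tendsto_const_nhds.add he).mul (tendsto_const_nhds.add he)
    exact tendsto_const_nhds.mul (h1.nnrpow tendsto_const_nhds (Or.inr hρ))
  have heanti : Antitone e := fun i j hij => by
    simp only [e]
    gcongr
  have hTanti : Antitone T := fun i j hij => by
    have := heanti hij
    simp only [T]
    gcongr
  have hsub : {x | x ∈ cell m (idx m y) ∧ (K * (a * b) ^ rhoOf r : ℝ≥0∞) < d x} ⊆
      ⋃ j, {x | x ∈ cell m (idx m y) ∧ (T j : ℝ≥0∞) < d x} := by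
    rintro x ⟨hx, hlt⟩
    have hT' : Filter.Tendsto (fun j => (T j : ℝ≥0∞)) Filter.atTop
        (nhds (K * (a * b) ^ rhoOf r : ℝ≥0∞)) := by
      have := ENNReal.tendsto_coe.2 hT
      rwa [ENNReal.coe_mul, ENNReal.coe_rpow_of_nonneg _ hρ.le, ENNReal.coe_mul] at this
    obtain ⟨j, hj⟩ := (hT'.eventually_lt_const hlt).exists
    exact Set.mem_iUnion.2 ⟨j, hx, hj⟩
  refine (measure_mono hsub).trans ?_
  have hmono : Monotone fun j => {x | x ∈ cell m (idx m y) ∧ (T j : ℝ≥0∞) < d x} :=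
    fun i j hij x hx => ⟨hx.1, (ENNReal.coe_le_coe.2 (hTanti hij)).trans_lt hx.2⟩
  rw [hmono.measure_iUnion]
  refine iSup_le fun j => ?_
  have hej : 0 < e j := by simp only [e]; positivity
  have := hK N HN Λ m y f g hf hg (a + e j) (b + e j) (by positivity) (by positivity)
    (by rw [← ha]; exact ENNReal.coe_le_coe.2 le_self_add)
    (by rw [← hb]; exact ENNReal.coe_le_coe.2 le_self_add)
  refine le_trans (le_of_eq ?_) this
  simp only [T, hd]
  rw [ENNReal.coe_mul, ENNReal.coe_rpow_of_nonneg _ hρ.le, ENNReal.coe_mul]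

end Extrapolation

theorem continuous_modulus {r : ℝ≥0∞} {N : ℕ} (hr : r ≠ ∞) {v : ℕ → ℝ → ℂ}
    (hv : ∀ i, Continuous (v i)) : Continuous fun x => modulus r N fun i => v i x := by
  simp only [modulus, ellN, hr, if_false]
  have : ∀ a : ℝ, Continuous fun z : ℝ≥0∞ => z ^ a := fun a => ENNReal.continuous_rpow_const
  exact (this _).comp ((this _).comp (continuous_finsetSum _ fun i _ => (this _).comp (hv i).enorm))

theorem tendsto_left_cell (x : ℝ) :
    Filter.Tendsto (fun n : ℕ => (2 : ℝ) ^ (-(n : ℤ)) * idx n x) Filter.atTop (nhds x) := by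
  rw [tendsto_iff_dist_tendsto_zero]
  refine squeeze_zero (fun _ => dist_nonneg) (fun n => ?_)
    (_root_.tendsto_pow_atTop_nhds_zero_of_lt_one (r := (1 / 2 : ℝ)) (by norm_num) (by norm_num))
  refine (dist_lt_of_mem_cell (left_mem_cell n (idx n x)) (mem_cell_idx n x)).le.trans (le_of_eq ?_)
  simp

section Extrapolation

variable {C : ℝ≥0} {η₁ η₂ η₃ : ℝ → ℂ} {r r₁ r₂ p q s p₀ q₀ s₀ : ℝ≥0∞}

/-- Extrapolation: one vector-valued bound for a paraproduct implies the whole Hölder range. -/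
theorem VectorBound.exists_extrapolate (h₁ : Bump C η₁) (h₂ : Bump C η₂) (h₃ : Bump C η₃)
    (hr0 : 1 / 2 < r) (hr : r ≠ ∞) (hr₁ : 1 ≤ r₁) (hr₂ : 1 ≤ r₂) (hH : r⁻¹ = r₁⁻¹ + r₂⁻¹)
    (hs₀0 : s₀ ≠ 0) (hs₀ : s₀ ≠ ∞) (hHs₀ : s₀⁻¹ = p₀⁻¹ + q₀⁻¹)
    (hs0 : s ≠ 0) (hs : s ≠ ∞) (hp : 1 < p) (hq : 1 < q) (hHs : s⁻¹ = p⁻¹ + q⁻¹) (C₀ : ℝ≥0) :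
    ∃ C₁ : ℝ≥0, ∀ N, VectorBound η₁ η₂ η₃ r₁ r₂ r p₀ q₀ s₀ C₀ N →
      VectorBound η₁ η₂ η₃ r₁ r₂ r p q s C₁ N := by
  have hr00 : r ≠ 0 := (zero_le.trans_lt hr0).ne'
  have hρ := rhoOf_pos hr00 hr
  have hs' : 0 < s.toReal := ENNReal.toReal_pos hs0 hs
  set σ : ℝ := s.toReal / rhoOf r with hσ
  have hσ0 : 0 < σ := by positivity
  have hρσ : rhoOf r * σ = s.toReal := by rw [hσ]; field_simp
  set ε : ℝ≥0 := 1 / (8 * 3 ^ σ) with hε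
  have h3 : (1 : ℝ≥0) ≤ 3 ^ σ := NNReal.one_le_rpow (by norm_num) hσ0.le
  have hε0 : 0 < ε := by positivity
  have hεσ : 4 * ε * 3 ^ σ = 1 / 2 := by rw [hε]; field_simp; norm_num
  have hε2 : ε ≤ 1 / 2 := by
    rw [← hεσ]
    calc ε = ε * 1 := (mul_one _).symm
      _ ≤ 4 * ε * 3 ^ σ := mul_le_mul' (le_mul_of_one_le_left' (by norm_num)) h3
  have hεσ' : 4 * (ε : ℝ≥0∞) * 3 ^ σ ≤ 1 / 2 := by
    have := ENNReal.coe_le_coe.2 hεσ.le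
    rw [ENNReal.coe_mul, ENNReal.coe_rpow_of_nonneg _ hσ0.le] at this
    simpa using this
  have hε2' : (ε : ℝ≥0∞) ≤ 1 / 2 := by simpa using ENNReal.coe_le_coe.2 hε2
  obtain ⟨K, hK⟩ :=
    VectorBound.exists_volume_osc_le_hl h₁ h₂ h₃ hr0 hr hr₁ hr₂ hH hs₀0 hs₀ hHs₀ C₀ hε0
  obtain ⟨A₁, hA₁⟩ := LqNorm_hl_le hp
  obtain ⟨A₂, hA₂⟩ := LqNorm_hl_le hq
  refine ⟨(2 * 3 ^ σ * K ^ σ) ^ (1 / s.toReal) * (A₁ * A₂), fun N HN Λ f g hf hg => ?_⟩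
  set F : ℝ → ℝ≥0∞ := fun x => ellN r₁ N fun i => ‖f i x‖ₑ with hF
  set G : ℝ → ℝ≥0∞ := fun x => ellN r₂ N fun i => ‖g i x‖ₑ with hG
  have hFm : Measurable F := measurable_ellN fun i => (hf i).meas.enorm
  have hGm : Measurable G := measurable_ellN fun i => (hg i).meas.enorm
  obtain ⟨M, hM⟩ := Λ.bddAbove
  obtain ⟨m', hm'⟩ := Λ.bddBelow
  have hcont : ∀ Λ i, Continuous (tripara η₁ η₂ η₃ Λ (f i) (g i)) := fun Λ i =>
    h₁.continuous_tripara h₂ h₃ Λ (hf i) (hg i)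
  let c : ℤ → ℤ → ℕ → ℂ := fun n j i =>
    tripara η₁ η₂ η₃ (Λ.filter (· ≤ n)) (f i) (g i) (2 ^ (-n) * j)
  let h : ℝ → ℕ → ℂ := fun x i => tripara η₁ η₂ η₃ Λ (f i) (g i) x
  have hcm := lintegral_cmax_le (ν := modulus r N) (c := c) (h := h) (m := m' - 1)
    (A := fun y => K * (hl F y * hl G y) ^ rhoOf r)
    (modulus_le_of_sub hr00 hr) (modulus_le_of_sub' hr00 hr)
    (continuous_modulus hr fun i => hcont Λ i).measurable hσ0 hε2' hεσ'
    (fun n _ y => hK N HN Λ n y f g hf hg)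
    (fun j => by
      have : Λ.filter (· ≤ m' - 1) = ∅ := Finset.filter_eq_empty_iff.2 fun k hk => by
        have := hm' hk
        omega
      simp only [c, this, tripara, Finset.sum_empty, modulus, enorm_zero, ellN_zero hr00]
      exact ENNReal.zero_rpow_of_pos hρ)
    (((((measurable_hl hFm).mul (measurable_hl hGm)).pow_const _)).const_mul _)
    (fun x => ENNReal.mul_ne_top (by simp) (ENNReal.rpow_ne_top_of_nonneg hρ.le
      (ENNReal.mul_ne_top (hl_ellN_ne_top hf x) (hl_ellN_ne_top hg x))))
  have hpt : ∀ x, modulus r N (h x) ≤ cmax (modulus r N) c (m' - 1) x := fun x => by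
    have hlim : Filter.Tendsto (fun n : ℕ => modulus r N (h ((2 : ℝ) ^ (-(n : ℤ)) * idx n x)))
        Filter.atTop (nhds (modulus r N (h x))) :=
      ((continuous_modulus hr fun i => hcont Λ i).tendsto x).comp (tendsto_left_cell x)
    refine le_of_tendsto hlim ?_
    filter_upwards [Filter.eventually_ge_atTop (max M (m' - 1)).toNat] with n hn
    have hn' : max M (m' - 1) ≤ n := Int.toNat_le.1 hn
    have hΛ : Λ.filter (· ≤ (n : ℤ)) = Λ := Finset.filter_true_of_mem fun k hk =>
      (hM hk).trans ((le_max_left _ _).trans hn')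
    refine le_trans (le_of_eq ?_) (le_iSup₂ (f := fun (n : ℤ) (_ : m' - 1 ≤ n) =>
      modulus r N (c n (idx n x))) (n : ℤ) ((le_max_right _ _).trans hn'))
    simp only [c, h, hΛ]
  have hInt : ∫⁻ x, (ellN r N fun i => ‖tripara η₁ η₂ η₃ Λ (f i) (g i) x‖ₑ) ^ s.toReal ≤
      2 * 3 ^ σ * (K ^ σ * ∫⁻ x, (hl F x * hl G x) ^ s.toReal) := by
    calc ∫⁻ x, (ellN r N fun i => ‖tripara η₁ η₂ η₃ Λ (f i) (g i) x‖ₑ) ^ s.toReal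
        ≤ ∫⁻ x, cmax (modulus r N) c (m' - 1) x ^ σ := lintegral_mono fun x => by
          have := ENNReal.rpow_le_rpow (hpt x) hσ0.le
          rw [modulus, ← ENNReal.rpow_mul, hρσ] at this
          exact this
      _ ≤ _ := hcm
      _ = _ := by
          rw [← lintegral_const_mul' _ _ (ENNReal.rpow_ne_top_of_nonneg hσ0.le (by simp))]
          congr 1
          refine lintegral_congr fun x => ?_
          rw [ENNReal.mul_rpow_of_nonneg _ _ hσ0.le, ← ENNReal.rpow_mul, hρσ]
  obtain ⟨B₁, hB₁⟩ := Adm.exists_ellN_le (t := r₁) N hf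
  obtain ⟨B₂, hB₂⟩ := Adm.exists_ellN_le (t := r₂) N hg
  have hprod : LqNorm volume s (fun x => hl F x * hl G x) ≤
      (A₁ * LqNorm volume p F) * (A₂ * LqNorm volume q G) :=
    (LqNorm_mul_le hs0 hs hHs (measurable_hl hFm).aemeasurable
      (measurable_hl hGm).aemeasurable).trans
      (mul_le_mul' (hA₁ F hFm B₁ hB₁) (hA₂ G hGm B₂ hB₂))
  have hs1 : 0 ≤ 1 / s.toReal := by positivity
  calc LqNorm volume s (fun x => ellN r N fun i => ‖tripara η₁ η₂ η₃ Λ (f i) (g i) x‖ₑ)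
      = (∫⁻ x, (ellN r N fun i => ‖tripara η₁ η₂ η₃ Λ (f i) (g i) x‖ₑ) ^ s.toReal) ^
          (1 / s.toReal) := by rw [LqNorm, if_neg hs]
    _ ≤ (2 * 3 ^ σ * (K ^ σ * ∫⁻ x, (hl F x * hl G x) ^ s.toReal)) ^ (1 / s.toReal) :=
        ENNReal.rpow_le_rpow hInt hs1
    _ = ((2 * 3 ^ σ * K ^ σ) ^ (1 / s.toReal) : ℝ≥0) *
          LqNorm volume s (fun x => hl F x * hl G x) := by
        rw [LqNorm, if_neg hs, ← mul_assoc, ENNReal.mul_rpow_of_nonneg _ _ hs1,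
          ENNReal.coe_rpow_of_nonneg _ hs1, ENNReal.coe_mul, ENNReal.coe_mul,
          ENNReal.coe_rpow_of_nonneg _ hσ0.le, ENNReal.coe_rpow_of_nonneg _ hσ0.le]
        norm_num
    _ ≤ ((2 * 3 ^ σ * K ^ σ) ^ (1 / s.toReal) : ℝ≥0) *
          ((A₁ * LqNorm volume p F) * (A₂ * LqNorm volume q G)) := mul_le_mul' le_rfl hprod
    _ = _ := by
        push_cast
        ring

end Extrapolation

theorem LqNorm_ellN_eq {X : Type*} [MeasurableSpace X] {μ : Measure X} {t : ℝ≥0∞} (ht0 : t ≠ 0)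
    (ht : t ≠ ∞) {N : ℕ} {a : ℕ → X → ℝ≥0∞} (ha : ∀ i, Measurable (a i)) :
    LqNorm μ t (fun x => ellN t N fun i => a i x) = ellN t N fun i => LqNorm μ t (a i) := by
  have h0 : t.toReal ≠ 0 := (ENNReal.toReal_pos ht0 ht).ne'
  simp only [LqNorm, ellN, ht, if_false, ← ENNReal.rpow_mul, one_div_mul_cancel h0,
    ENNReal.rpow_one]
  rw [lintegral_finsetSum _ fun i _ => (ha i).pow_const _]

theorem ellN_LqNorm_le {X : Type*} [MeasurableSpace X] {μ : Measure X} {t : ℝ≥0∞} (ht0 : t ≠ 0)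
    {N : ℕ} {a : ℕ → X → ℝ≥0∞} (ha : ∀ i, Measurable (a i)) :
    (ellN t N fun i => LqNorm μ t (a i)) ≤ LqNorm μ t (fun x => ellN t N fun i => a i x) := by
  by_cases ht : t = ∞
  · subst ht
    rw [ellN, if_pos rfl]
    refine iSup₂_le fun i hi => LqNorm_mono fun x => ?_
    exact le_ellN ht0 (Finset.mem_range.1 hi)
  · exact (LqNorm_ellN_eq ht0 ht ha).ge

section Scalar

variable {C : ℝ≥0} {η₁ η₂ η₃ : ℝ → ℂ} {r r₁ r₂ : ℝ≥0∞}

theorem exists_vectorBound_one (h₁ : Bump C η₁) (h₂ : Bump C η₂) (h₃ : Bump C η₃)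
    (h₂0 : ∫ x, η₂ x = 0) (h₃0 : ∫ x, η₃ x = 0) (hr : r ≠ 0) (hr₁ : r₁ ≠ 0) (hr₂ : r₂ ≠ 0) :
    ∃ C₀ : ℝ≥0, VectorBound η₁ η₂ η₃ r₁ r₂ r ∞ 2 2 C₀ 1 := by
  obtain ⟨K, hK⟩ := exists_tripara_LqNorm_two_le h₁ h₂ h₃ h₂0 h₃0
  refine ⟨K, fun Λ f g hf hg => ?_⟩
  simp only [ellN_one hr, ellN_one hr₁, ellN_one hr₂]
  exact hK Λ _ _ (hf 0) (hg 0)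

theorem VectorBound.diagonal (h₁ : Bump C η₁) (h₂ : Bump C η₂) (h₃ : Bump C η₃)
    (hr0 : r ≠ 0) (hr : r ≠ ∞) (hH : r⁻¹ = r₁⁻¹ + r₂⁻¹) {C₀ : ℝ≥0}
    (H : VectorBound η₁ η₂ η₃ r₁ r₂ r r₁ r₂ r C₀ 1) (N : ℕ) :
    VectorBound η₁ η₂ η₃ r₁ r₂ r r₁ r₂ r C₀ N := by
  have hr₁ := holder_ne_zero_left hr0 hH
  have hr₂ := holder_ne_zero_left hr0 (hH.trans (add_comm _ _))
  intro Λ f g hf hg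
  have hT : ∀ i, LqNorm volume r (fun x => ‖tripara η₁ η₂ η₃ Λ (f i) (g i) x‖ₑ) ≤
      C₀ * (LqNorm volume r₁ (fun x => ‖f i x‖ₑ) * LqNorm volume r₂ (fun x => ‖g i x‖ₑ)) :=
    fun i => by
      have := H Λ (fun _ => f i) (fun _ => g i) (fun _ => hf i) (fun _ => hg i)
      simpa only [ellN_one hr0, ellN_one hr₁, ellN_one hr₂, mul_assoc] using this
  rw [LqNorm_ellN_eq hr0 hr fun i =>
    (h₁.continuous_tripara h₂ h₃ Λ (hf i) (hg i)).measurable.enorm]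
  refine (ellN_mono hT).trans ((ellN_const_mul_le hr0 (by simp) _).trans ?_)
  rw [mul_assoc]
  refine mul_le_mul' le_rfl ((ellN_mul_le hr0 hr hH _ _).trans (mul_le_mul' ?_ ?_))
  · exact ellN_LqNorm_le hr₁ fun i => (hf i).meas.enorm
  · exact ellN_LqNorm_le hr₂ fun i => (hg i).meas.enorm

end Scalar

section Schwartz

variable {C C' : ℝ≥0} {η η' : ℝ → ℂ}

theorem SchwartzMap.adm (f : SchwartzMap ℝ ℂ) : Adm f := by
  refine ⟨f.continuous.measurable, f.integrable, SchwartzMap.seminorm ℝ 0 0 f, fun x => ?_⟩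
  exact f.norm_le_seminorm ℝ x

theorem Bump.of_deriv (hη : Differentiable ℝ η) (h : ∀ x, ‖η x‖ ≤ C / (1 + |x|) ^ 6)
    (h' : ∀ x, ‖deriv η x‖ ≤ C / (1 + |x|) ^ 6) : Bump (64 * C) η := by
  have hpos : ∀ x : ℝ, 0 < 1 + |x| := fun x => by positivity
  refine ⟨hη.continuous, fun x => (h x).trans ?_, fun x y => ?_⟩
  · push_cast
    gcongr
    nlinarith [C.coe_nonneg]
  push_cast
  by_cases hxy : |x - y| ≤ 1
  · have hball : ∀ z ∈ Metric.closedBall x |x - y|, ‖deriv η z‖ ≤ 64 * C / (1 + |x|) ^ 6 := by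
      intro z hz
      have hz' : |x - z| ≤ |x - y| := by
        rwa [Metric.mem_closedBall, dist_comm, Real.dist_eq] at hz
      have h1 : 1 + |x| ≤ 2 * (1 + |z|) := by
        have := abs_sub_abs_le_abs_sub x z
        have := abs_nonneg z
        linarith
      refine (h' z).trans ?_
      rw [div_le_div_iff₀ (by have := hpos z; positivity) (by have := hpos x; positivity)]
      calc (C : ℝ) * (1 + |x|) ^ 6 ≤ C * (2 * (1 + |z|)) ^ 6 := by gcongr
        _ = _ := by ring
    have := (convex_closedBall x |x - y|).norm_image_sub_le_of_norm_deriv_le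
      (fun z _ => hη z) hball (y := x) (x := y)
          (by rw [Metric.mem_closedBall, dist_comm, Real.dist_eq])
      (Metric.mem_closedBall_self (abs_nonneg _))
    refine this.trans ?_
    rw [Real.norm_eq_abs]
    have : 0 ≤ 64 * (C : ℝ) * |x - y| * (1 / (1 + |y|) ^ 6) := by positivity
    calc 64 * C / (1 + |x|) ^ 6 * |x - y| = 64 * C * |x - y| * (1 / (1 + |x|) ^ 6) := by ring
      _ ≤ _ := by rw [mul_add]; linarith
  · push Not at hxy
    calc ‖η x - η y‖ ≤ C / (1 + |x|) ^ 6 + C / (1 + |y|) ^ 6 :=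
          (norm_sub_le _ _).trans (add_le_add (h x) (h y))
      _ = C * 1 * (1 / (1 + |x|) ^ 6 + 1 / (1 + |y|) ^ 6) := by ring
      _ ≤ 64 * C * |x - y| * (1 / (1 + |x|) ^ 6 + 1 / (1 + |y|) ^ 6) := by
          gcongr
          nlinarith [C.coe_nonneg]

theorem SchwartzMap.exists_bump (f : SchwartzMap ℝ ℂ) : ∃ C : ℝ≥0, Bump C f := by
  have hdec : ∀ g : SchwartzMap ℝ ℂ, ∃ C : ℝ, ∀ x, ‖g x‖ ≤ C / (1 + |x|) ^ 6 := fun g => by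
    refine ⟨2 ^ 6 * (Finset.Iic (6, 0)).sup (fun m => SchwartzMap.seminorm ℝ m.1 m.2) g,
      fun x => ?_⟩
    rw [le_div_iff₀ (by positivity), mul_comm]
    have := SchwartzMap.one_add_le_sup_seminorm_apply (𝕜 := ℝ) (m := (6, 0)) (k := 6) (n := 0)
      le_rfl le_rfl g x
    rwa [norm_iteratedFDeriv_zero] at this
  obtain ⟨A, hA⟩ := hdec f
  obtain ⟨A', hA'⟩ := hdec (SchwartzMap.derivCLM ℝ ℂ f)
  have hle : ∀ {a : ℝ} {x : ℝ}, a ≤ |A| + |A'| →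
      a / (1 + |x|) ^ 6 ≤ ((|A| + |A'|).toNNReal : ℝ) / (1 + |x|) ^ 6 := fun h => by
    rw [Real.coe_toNNReal _ (by positivity)]
    gcongr
  refine ⟨64 * (|A| + |A'|).toNNReal, Bump.of_deriv f.differentiable (fun x => (hA x).trans ?_)
    fun x => (hA' x).trans ?_⟩
  · exact hle ((le_abs_self A).trans (le_add_of_nonneg_right (abs_nonneg _)))
  · exact hle ((le_abs_self A').trans (le_add_of_nonneg_left (abs_nonneg _)))

theorem Bump.bump_psiOf (hη : Bump C η) : Bump (5 * C) (psiOf η) := by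
  have hmono : ∀ x : ℝ, 1 / (1 + |2 * x|) ^ 6 ≤ 1 / (1 + |x|) ^ 6 := fun x => by
    rw [abs_mul, abs_two]
    gcongr
    linarith [abs_nonneg x]
  refine ⟨(continuous_const.mul (hη.cont.comp (by fun_prop))).sub hη.cont, fun x => ?_,
    fun x y => ?_⟩
  · have h1 := hη.bound (2 * x)
    have h2 := hη.bound x
    rw [div_eq_mul_one_div] at h1 h2 ⊢
    have h3 := mul_le_mul_of_nonneg_left (hmono x) C.coe_nonneg
    have h4 : (0 : ℝ) ≤ C * (1 / (1 + |x|) ^ 6) := by positivity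
    calc ‖2 * η (2 * x) - η x‖ ≤ 2 * ‖η (2 * x)‖ + ‖η x‖ :=
          (norm_sub_le _ _).trans (by simp)
      _ ≤ _ := by push_cast; linarith
  · have h1 := hη.lip (2 * x) (2 * y)
    have h2 := hη.lip x y
    rw [← mul_sub, abs_mul, abs_two] at h1
    have h3 := mul_le_mul_of_nonneg_left (add_le_add (hmono x) (hmono y))
      (by positivity : (0 : ℝ) ≤ C * (2 * |x - y|))
    calc ‖psiOf η x - psiOf η y‖
        = ‖2 * (η (2 * x) - η (2 * y)) - (η x - η y)‖ := by
          congr 1; simp only [psiOf]; ring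
      _ ≤ 2 * ‖η (2 * x) - η (2 * y)‖ + ‖η x - η y‖ := (norm_sub_le _ _).trans (by simp)
      _ ≤ _ := by push_cast; linarith

theorem integral_psiOf (hη : Integrable η) : ∫ x, psiOf η x = 0 := by
  unfold psiOf
  rw [integral_sub ((hη.comp_mul_left' two_ne_zero).const_mul 2) hη, integral_const_mul,
    Measure.integral_comp_mul_left, abs_of_pos (by positivity), Complex.real_smul]
  push_cast
  ring

end Schwartz

/-- Quasi-Banach valued estimates for paraproducts: for `1 < r₁, r₂ ≤ ∞`, `1/2 < r < ∞`
with `1/r₁ + 1/r₂ = 1/r`, the `ℓ^r`-valued paraproduct maps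
`L^p(ℓ^{r₁}) × L^q(ℓ^{r₂}) → L^s(ℓ^r)` for all Hölder tuples `(p, q, s)` with
`1 < p, q ≤ ∞`, `1/2 < s < ∞`. -/
theorem paraproduct_quasiBanach_vector_valued
    (φ : SchwartzMap ℝ ℂ)
    (hφ₁ : ∀ ξ : ℝ, |ξ| ≤ 1 / 2 → ft1 (⇑φ) ξ = 1)
    (hφ₂ : ∀ ξ : ℝ, 1 ≤ |ξ| → ft1 (⇑φ) ξ = 0)
    (r₁ r₂ r : ℝ≥0∞) (hr₁ : 1 < r₁) (hr₂ : 1 < r₂) (hr : 1 / 2 < r) (hr' : r < ∞)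
    (hHr : r⁻¹ = r₁⁻¹ + r₂⁻¹)
    (p q s : ℝ≥0∞) (hp : 1 < p) (hq : 1 < q) (hs : 1 / 2 < s) (hs' : s < ∞)
    (hHs : s⁻¹ = p⁻¹ + q⁻¹) :
    ∃ C : ℝ≥0, ∀ (N : ℕ) (Λ : Finset ℤ) (f g : ℕ → SchwartzMap ℝ ℂ),
      LqNorm volume s
          (fun x => ellN r N (fun k => (‖para (⇑φ) Λ (⇑(f k)) (⇑(g k)) x‖₊ : ℝ≥0∞))) ≤
        (C : ℝ≥0∞) *
          LqNorm volume p (fun x => ellN r₁ N (fun k => (‖f k x‖₊ : ℝ≥0∞))) *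
          LqNorm volume q (fun x => ellN r₂ N (fun k => (‖g k x‖₊ : ℝ≥0∞))) := by
  obtain ⟨C, hC⟩ := φ.exists_bump
  have h₁ : Bump (5 * C) φ := hC.mono (le_mul_of_one_le_left' (by norm_num))
  have h₂ : Bump (5 * C) (psiOf φ) := hC.bump_psiOf
  have h0 : ∫ x, psiOf φ x = 0 := integral_psiOf φ.integrable
  have hr0 : r ≠ 0 := (zero_le.trans_lt hr).ne'
  have hs0 : s ≠ 0 := (zero_le.trans_lt hs).ne'
  obtain ⟨C₀, hC₀⟩ := exists_vectorBound_one h₁ h₂ h₂ h0 h0 hr0 (zero_lt_one.trans hr₁).ne'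
    (zero_lt_one.trans hr₂).ne'
  obtain ⟨C₁, hC₁⟩ := VectorBound.exists_extrapolate h₁ h₂ h₂ hr hr'.ne hr₁.le hr₂.le hHr
    two_ne_zero ENNReal.ofNat_ne_top (p₀ := ∞) (q₀ := 2) (by simp) hr0 hr'.ne hr₁ hr₂ hHr C₀
  obtain ⟨C₂, hC₂⟩ := VectorBound.exists_extrapolate h₁ h₂ h₂ hr hr'.ne hr₁.le hr₂.le hHr
    hr0 hr'.ne hHr hs0 hs'.ne hp hq hHs C₁
  exact ⟨C₂, fun N Λ f g => hC₂ N (VectorBound.diagonal h₁ h₂ h₂ hr0 hr'.ne hHr (hC₁ 1 hC₀) N) Λ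
    (fun i => f i) (fun i => g i) (fun i => (f i).adm) (fun i => (g i).adm)⟩
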